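/- arXiv:1111.0796 — 4 statements merged into one kernel-verified Lean document; each statement's English description precedes it below -/
import Mathlib

section
/- Let s ∈ (0,1) and let v = v¹_s be given by v(x) = (2/π) ∫₀^∞ (sin(xr)/r) e^{−r^{2s}} dr. Then v is a bounded C^∞ function and for every x ∈ ℝ, ((-∂ₓₓ)^s v)(x) = (1/(2s)) x v′(x) = (x/(sπ)) ∫₀^∞ cos(xr) e^{−r^{2s}} dr. -/
open Real MeasureTheory Filter Set

/-- Normalizing constant of the one-dimensional fractional Laplacian. -/
noncomputable def fracLapCoef (s : ℝ) : ℝ :=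
  (4:ℝ) ^ s * s * Real.Gamma (s + 1/2) / (Real.sqrt π * Real.Gamma (1 - s))

/-- The one-dimensional fractional Laplacian `(-∂ₓₓ)^s v (x)`. -/
noncomputable def fracLap (s : ℝ) (v : ℝ → ℝ) (x : ℝ) : ℝ :=
  fracLapCoef s * ∫ y in Set.Ioi (0:ℝ), (2 * v x - v (x + y) - v (x - y)) * y ^ (-1 - 2*s)

/-- `f` is of class `C^{1,γ}`: continuously differentiable with `γ`-Hölder derivative. -/
def IsC1Holder (γ : ℝ) (f : ℝ → ℝ) : Prop :=
  ContDiff ℝ 1 f ∧ ∃ C : ℝ, ∀ x y : ℝ, |deriv f x - deriv f y| ≤ C * |x - y| ^ γ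

/-- A layer solution of `(-∂ₓₓ)^s v = f(v)` in `ℝ`. -/
structure IsLayerSolution (s : ℝ) (f : ℝ → ℝ) (v : ℝ → ℝ) : Prop where
  bounded : ∃ M : ℝ, ∀ x, |v x| ≤ M
  smooth : ContDiff ℝ 2 v
  eqn : ∀ x, fracLap s v x = f (v x)
  mono : ∀ x, 0 < deriv v x
  limNeg : Tendsto v atBot (nhds (-1))
  limPos : Tendsto v atTop (nhds 1)

/-- The potential `G(r) = -∫₀^r f`. -/
noncomputable def potG (f : ℝ → ℝ) (r : ℝ) : ℝ := -∫ u in (0:ℝ)..r, f u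
/-- The fundamental solution `p_s(t,x)` of the fractional heat equation. -/
noncomputable def fracHeatKernel (s t x : ℝ) : ℝ :=
  (1/π) * ∫ r in Set.Ioi (0:ℝ), Real.cos (x*r) * Real.exp (-(t * r ^ (2*s)))

/-- The explicit layer solution `v^t_s`. -/
noncomputable def layerV (s t : ℝ) (x : ℝ) : ℝ :=
  (2/π) * ∫ r in Set.Ioi (0:ℝ), (Real.sin (x*r) / r) * Real.exp (-(t * r ^ (2*s)))


lemma aux_A0 {s : ℝ} (h0 : 0 < s) (h1 : s < 1) :
    IntegrableOn (fun u : ℝ => u ^ (-s-1) * (1 - rexp (-u))) (Ioi 0) := by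
  have hm : Measurable (fun u : ℝ => u ^ (-s-1) * (1 - rexp (-u))) := by fun_prop
  rw [← Ioc_union_Ioi_eq_Ioi (zero_le_one : (0:ℝ) ≤ 1)]
  refine IntegrableOn.union ?_ ?_
  · have h : IntegrableOn (fun u : ℝ => u ^ (-s)) (Ioc 0 1) :=
      (intervalIntegrable_iff_integrableOn_Ioc_of_le zero_le_one).1
        (intervalIntegral.intervalIntegrable_rpow' (by linarith))
    refine Integrable.mono' h hm.aestronglyMeasurable ?_
    filter_upwards [ae_restrict_mem measurableSet_Ioc] with u hu
    have hu0 : 0 < u := hu.1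
    have e1 : 0 ≤ 1 - rexp (-u) := by
      have : rexp (-u) ≤ 1 := Real.exp_le_one_iff.2 (by linarith)
      linarith
    have e2 : 1 - rexp (-u) ≤ u := by
      have := Real.add_one_le_exp (-u)
      linarith
    have e3 : u ^ (-s) = u ^ (-s-1) * u := by
      rw [← Real.rpow_add_one hu0.ne']; congr 1; ring
    rw [Real.norm_of_nonneg (by positivity), e3]
    gcongr
  · have h : IntegrableOn (fun u : ℝ => u ^ (-s-1)) (Ioi 1) :=
      integrableOn_Ioi_rpow_of_lt (by linarith) one_pos
    refine Integrable.mono' h hm.aestronglyMeasurable ?_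
    filter_upwards [ae_restrict_mem measurableSet_Ioi] with u hu
    have hu0 : 0 < u := one_pos.trans hu
    have e1 : 0 ≤ 1 - rexp (-u) := by
      have : rexp (-u) ≤ 1 := Real.exp_le_one_iff.2 (by linarith)
      linarith
    have e2 : 1 - rexp (-u) ≤ 1 := by
      have := Real.exp_pos (-u)
      linarith
    rw [Real.norm_of_nonneg (by positivity)]
    exact mul_le_of_le_one_right (by positivity) e2

lemma aux_A1 {s : ℝ} (h0 : 0 < s) (h1 : s < 1) :
    ∫ u in Ioi (0:ℝ), u ^ (-s-1) * (1 - rexp (-u)) = Real.Gamma (1 - s) / s := by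
  have hi := aux_A0 h0 h1
  have hG := Real.GammaIntegral_convergent (s := 1 - s) (by linarith)
  have hGe := Real.Gamma_eq_integral (s := 1 - s) (by linarith)
  have key : ∫ u in Ioi (0:ℝ), (s * (u ^ (-s-1) * (1 - rexp (-u))) - rexp (-u) * u ^ (1 - s - 1))
      = 0 - (fun u : ℝ => -(u ^ (-s) * (1 - rexp (-u)))) 0 := by
    refine integral_Ioi_of_hasDerivAt_of_tendsto (f := fun u : ℝ => -(u ^ (-s) * (1 - rexp (-u)))) ?_ ?_ ?_ ?_
    · -- continuity at 0
      have hb : ∀ u ∈ Ici (0:ℝ), ‖-(u ^ (-s) * (1 - rexp (-u)))‖ ≤ u ^ (1 - s) := by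
        intro u hu
        rcases eq_or_lt_of_le (show (0:ℝ) ≤ u from hu) with rfl | hu0
        · simp [Real.zero_rpow (by linarith : (1 - s) ≠ 0)]
        have e1 : 0 ≤ 1 - rexp (-u) := by
          have : rexp (-u) ≤ 1 := Real.exp_le_one_iff.2 (by linarith)
          linarith
        have e2 : 1 - rexp (-u) ≤ u := by
          have := Real.add_one_le_exp (-u)
          linarith
        have e3 : u ^ (1-s) = u ^ (-s) * u := by
          rw [← Real.rpow_add_one hu0.ne']; congr 1; ring
        rw [norm_neg, Real.norm_of_nonneg (by positivity), e3]
        gcongr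
      unfold ContinuousWithinAt
      simp only [neg_zero, Real.exp_zero, sub_self, mul_zero]
      refine squeeze_zero_norm' (eventually_nhdsWithin_of_forall hb) ?_
      have : ContinuousAt (fun u : ℝ => u ^ (1 - s)) 0 :=
        Real.continuousAt_rpow_const _ _ (Or.inr (by linarith))
      have h2 := this.tendsto
      rw [Real.zero_rpow (by linarith : (1 - s) ≠ 0)] at h2
      exact h2.mono_left nhdsWithin_le_nhds
    · intro u hu
      have hu0 : (0:ℝ) < u := hu
      have d1 := Real.hasDerivAt_rpow_const (x := u) (p := -s) (Or.inl hu0.ne')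
      have d2 : HasDerivAt (fun u : ℝ => 1 - rexp (-u)) (rexp (-u)) u := by
        have := ((hasDerivAt_id u).neg.exp).const_sub 1
        simpa using this
      have := (d1.mul d2).neg
      refine HasDerivAt.congr_deriv this ?_
      rw [show 1 - s - 1 = -s by ring]
      ring
    · exact (hi.const_mul s).sub hG
    · have t1 : Tendsto (fun u : ℝ => u ^ (-s)) atTop (nhds 0) := tendsto_rpow_neg_atTop h0
      have t2 : Tendsto (fun u : ℝ => 1 - rexp (-u)) atTop (nhds 1) := by
        have := (Real.tendsto_exp_neg_atTop_nhds_zero).const_sub 1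
        simpa using this
      simpa using (t1.mul t2).neg
  rw [integral_sub (hi.const_mul s) hG, integral_const_mul, ← hGe] at key
  simp only [neg_zero, Real.exp_zero, sub_self, mul_zero] at key
  field_simp
  linarith

lemma aux_A2 {s : ℝ} (h0 : 0 < s) (h1 : s < 1) :
    ∫ t in Ioi (0:ℝ), t ^ (s-1) * (1 - rexp (-(1/(4*t)))) =
      (4:ℝ)^(-s) * (Real.Gamma (1 - s) / s) := by
  rw [← aux_A1 h0 h1, ← integral_comp_rpow_Ioi _ (show (-1:ℝ) ≠ 0 by norm_num)]
  have := integral_comp_mul_left_Ioi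
    (fun u : ℝ => u ^ (-s-1) * (1 - rexp (-u))) 0 (show (0:ℝ) < 4⁻¹ by norm_num)
  rw [mul_zero] at this
  rw [← inv_smul_smul₀ (show (4⁻¹:ℝ)⁻¹ ≠ 0 by norm_num) (∫ u in Ioi (0:ℝ), u ^ (-s-1) * (1 - rexp (-u))), 
    ← this, smul_eq_mul, ← mul_assoc, ← integral_const_mul]
  refine setIntegral_congr_fun measurableSet_Ioi fun u hu => ?_
  have hu0 : (0:ℝ) < u := hu
  simp only [smul_eq_mul]
  rw [Real.rpow_neg_one, Real.inv_rpow hu0.le, ← Real.rpow_neg hu0.le,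
    Real.mul_rpow (by norm_num) hu0.le, Real.inv_rpow (by norm_num : (0:ℝ) ≤ 4), ← Real.rpow_neg (by norm_num)]
  have e1 : (4:ℝ)^(-s) * (4⁻¹)⁻¹⁻¹ * (4:ℝ) ^ (-(-s-1)) = 1 := by
    rw [show -(-s-1) = s + 1 by ring, Real.rpow_add_one (by norm_num), Real.rpow_neg (by norm_num)]
    have : (4:ℝ)^s ≠ 0 := by positivity
    field_simp
  have e2 : u ^ (-1-1:ℝ) * u ^ (-(s-1)) = u ^ (-s-1) := by
    rw [← Real.rpow_add hu0]; congr 1; ring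
  have e3 : -(1/(4*u⁻¹)) = -(4⁻¹ * u) := by field_simp
  rw [e3]
  calc _ = (u ^ (-1-1:ℝ) * u ^ (-(s-1))) * (1 - rexp (-(4⁻¹ * u))) := by
        norm_num; ring
    _ = ((4:ℝ)^(-s) * (4⁻¹)⁻¹⁻¹ * (4:ℝ) ^ (-(-s-1))) * (u ^ (-s-1) * (1 - rexp (-(4⁻¹ * u)))) := by
        rw [e1, e2]; ring
    _ = _ := by ring

lemma aux_A3 {t : ℝ} (ht : 0 < t) :
    ∫ y in Ioi (0:ℝ), (1 - Real.cos y) * rexp (-(t * y ^ 2)) =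
      √π / 2 * t ^ (-(1/2:ℝ)) * (1 - rexp (-(1/(4*t)))) ∧
    IntegrableOn (fun y : ℝ => (1 - Real.cos y) * rexp (-(t * y ^ 2))) (Ioi 0) := by
  have hg : Integrable (fun y : ℝ => rexp (-(t * y ^ 2))) := by
    simpa using integrable_exp_neg_mul_sq ht
  have hc : Integrable (fun y : ℝ => Real.cos y * rexp (-(t * y ^ 2))) := by
    refine hg.mono' (by fun_prop) (Eventually.of_forall fun y => ?_)
    rw [norm_mul, Real.norm_of_nonneg (Real.exp_pos _).le]
    exact mul_le_of_le_one_left (Real.exp_pos _).le (Real.abs_cos_le_one y)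
  have hcos : ∫ y in Ioi (0:ℝ), Real.cos y * rexp (-(t * y ^ 2))
      = √(π / t) / 2 * rexp (-(1/(4*t))) := by
    have h := fourierIntegral_gaussian (b := (t:ℂ)) (by simpa using ht) 1
    have hi : Integrable (fun x : ℝ => Complex.exp (Complex.I * 1 * ↑x) * Complex.exp (-(t:ℂ) * ↑x ^ 2)) := by
      refine hg.mono' (by fun_prop) (Eventually.of_forall fun y => ?_)
      rw [norm_mul, Complex.norm_exp, Complex.norm_exp]
      simp [← Complex.ofReal_pow]
    have h2 := integral_re hi
    rw [h] at h2
    have e1 : ∀ x : ℝ, RCLike.re (Complex.exp (Complex.I * 1 * ↑x) * Complex.exp (-(t:ℂ) * ↑x ^ 2))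
        = Real.cos |x| * rexp (-(t * |x| ^ 2)) := by
      intro x
      rw [show (-(t:ℂ) * ↑x ^ 2) = ((-(t * x^2) : ℝ) : ℂ) by push_cast; ring, ← Complex.ofReal_exp]
      rw [show Complex.I * 1 * (x:ℂ) = x * Complex.I by ring, Complex.exp_mul_I]
      rw [RCLike.re_to_complex, Complex.re_mul_ofReal]
      simp [Complex.cos_ofReal_re]
    simp_rw [e1] at h2
    rw [integral_comp_abs (f := fun x => Real.cos x * rexp (-(t * x ^ 2)))] at h2
    have e2 : ((π:ℂ) / t) ^ (1/2 : ℂ) * Complex.exp (-1 ^ 2 / (4 * t))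
        = ((√(π/t) * rexp (-(1/(4*t))) : ℝ) : ℂ) := by
      rw [Real.sqrt_eq_rpow]
      push_cast [Complex.ofReal_cpow (show (0:ℝ) ≤ π / t by positivity)]
      congr 2
      ring
    rw [e2] at h2
    simp only [RCLike.re_to_complex, Complex.ofReal_re] at h2
    linarith
  have hgg : ∫ y in Ioi (0:ℝ), rexp (-(t * y ^ 2)) = √(π / t) / 2 := by
    simpa using integral_gaussian_Ioi t
  have hsub : (fun y : ℝ => (1 - Real.cos y) * rexp (-(t * y ^ 2)))
      = fun y => rexp (-(t * y ^ 2)) - Real.cos y * rexp (-(t * y ^ 2)) := by ext y; ring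
  rw [hsub]
  refine ⟨?_, (hg.sub hc).integrableOn⟩
  rw [integral_sub hg.integrableOn hc.integrableOn, hcos, hgg, Real.sqrt_div pi_pos.le,
    Real.rpow_neg ht.le, ← Real.sqrt_eq_rpow]
  ring

noncomputable def KK (s : ℝ) : ℝ :=
  √π / 2 * ((4:ℝ)^(-s) * (Real.Gamma (1 - s) / s)) / Real.Gamma (s + 1/2)

lemma KK_pos {s : ℝ} (h0 : 0 < s) (h1 : s < 1) : 0 < KK s := by
  have := Real.Gamma_pos_of_pos (show 0 < 1 - s by linarith)
  have := Real.Gamma_pos_of_pos (show 0 < s + 1/2 by linarith)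
  unfold KK
  positivity

lemma aux_A4 {s : ℝ} (h0 : 0 < s) (h1 : s < 1) :
    ∫ y in Ioi (0:ℝ), (1 - Real.cos y) * y ^ (-1 - 2*s) = KK s := by
  have hG1 := Real.Gamma_pos_of_pos (show 0 < 1 - s by linarith)
  have hG2 := Real.Gamma_pos_of_pos (show 0 < s + 1/2 by linarith)
  let f : ℝ → ℝ → ℝ := fun t y => t ^ (s + 1/2 - 1) * ((1 - Real.cos y) * rexp (-(t * y ^ 2)))
  have hin : ∀ t ∈ Ioi (0:ℝ), ∫ y in Ioi (0:ℝ), f t y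
      = √π / 2 * (t ^ (s-1) * (1 - rexp (-(1/(4*t))))) := by
    intro t ht
    have ht0 : (0:ℝ) < t := ht
    simp only [f]
    rw [integral_const_mul, (aux_A3 ht0).1, show s - 1 = (s + 1/2 - 1) + -(1/2) by ring,
      Real.rpow_add ht0]
    ring
  have hval : ∫ t in Ioi (0:ℝ), ∫ y in Ioi (0:ℝ), f t y
      = √π / 2 * ((4:ℝ)^(-s) * (Real.Gamma (1 - s) / s)) := by
    rw [setIntegral_congr_fun measurableSet_Ioi hin, integral_const_mul, aux_A2 h0 h1]
  have hint : Integrable (Function.uncurry f)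
      ((volume.restrict (Ioi (0:ℝ))).prod (volume.restrict (Ioi (0:ℝ)))) := by
    have hm : Measurable (Function.uncurry f) := by
      simp only [f, Function.uncurry_def]; fun_prop
    refine (integrable_prod_iff hm.aestronglyMeasurable).2 ⟨?_, ?_⟩
    · filter_upwards [ae_restrict_mem measurableSet_Ioi] with t ht
      exact (aux_A3 ht).2.const_mul (t ^ (s + 1/2 - 1))
    · have : Integrable (fun t => ∫ y in Ioi (0:ℝ), f t y) (volume.restrict (Ioi (0:ℝ))) := by
        apply Integrable.of_integral_ne_zero
        rw [hval]
        positivity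
      refine this.congr ?_
      filter_upwards [ae_restrict_mem measurableSet_Ioi] with t ht
      have ht0 : (0:ℝ) < t := ht
      refine integral_congr_ae (Eventually.of_forall fun y => ?_)
      have : 0 ≤ 1 - Real.cos y := by linarith [Real.cos_le_one y]
      simp only [Function.uncurry, f]
      rw [Real.norm_of_nonneg (by positivity)]
  have hsw := integral_integral_swap hint
  rw [hval] at hsw
  have hy : ∀ y ∈ Ioi (0:ℝ), ∫ t in Ioi (0:ℝ), f t y
      = Real.Gamma (s + 1/2) * ((1 - Real.cos y) * y ^ (-1 - 2*s)) := by
    intro y hy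
    have hy0 : (0:ℝ) < y := hy
    have := Real.integral_rpow_mul_exp_neg_mul_Ioi (a := s + 1/2) (r := y^2) (by linarith) (by positivity)
    simp only [f]
    have e : ∀ t : ℝ, t ^ (s + 1/2 - 1) * ((1 - Real.cos y) * rexp (-(t * y ^ 2)))
      = (1 - Real.cos y) * (t ^ (s + 1/2 - 1) * rexp (-(y^2 * t))) := by
      intro t; rw [mul_comm t (y^2)]; ring
    simp_rw [e]
    rw [integral_const_mul, this]
    have : (1 / y^2) ^ (s+1/2) = y ^ (-1 - 2*s) := by
      rw [one_div, Real.inv_rpow (by positivity), ← Real.rpow_natCast, ← Real.rpow_mul hy0.le,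
        ← Real.rpow_neg hy0.le]
      congr 1; push_cast; ring
    rw [this]; ring
  rw [setIntegral_congr_fun measurableSet_Ioi hy, integral_const_mul] at hsw
  unfold KK
  rw [hsw]
  field_simp

lemma aux_A5 {s : ℝ} (h0 : 0 < s) (h1 : s < 1) {r : ℝ} (hr : 0 < r) :
    ∫ y in Ioi (0:ℝ), (1 - Real.cos (r * y)) * y ^ (-1 - 2*s) = KK s * r ^ (2*s) := by
  have := integral_comp_mul_left_Ioi
    (fun y : ℝ => (1 - Real.cos y) * y ^ (-1 - 2*s)) 0 hr
  rw [mul_zero, aux_A4 h0 h1] at this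
  have h2 : ∫ y in Ioi (0:ℝ), (1 - Real.cos (r * y)) * (r * y) ^ (-1 - 2*s)
      = r ^ (-1 - 2*s) * ∫ y in Ioi (0:ℝ), (1 - Real.cos (r * y)) * y ^ (-1 - 2*s) := by
    rw [← integral_const_mul]
    refine setIntegral_congr_fun measurableSet_Ioi fun y hy => ?_
    have hy0 : (0:ℝ) < y := hy
    rw [Real.mul_rpow hr.le hy0.le]; ring
  rw [h2, smul_eq_mul] at this
  have e : r ^ (-1 - 2*s) * (r * r ^ (2*s)) = 1 := by
    rw [mul_comm r, ← Real.rpow_add_one hr.ne', ← Real.rpow_add hr]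
    rw [show -1 - 2*s + (2*s+1) = 0 by ring, Real.rpow_zero]
  have hp : 0 < r ^ (-1 - 2*s) := by positivity
  apply mul_left_cancel₀ hp.ne'
  rw [this]
  calc _ = r⁻¹ * KK s * (r ^ (-1 - 2*s) * (r * r ^ (2*s))) := by rw [e]; ring
    _ = _ := by field_simp

lemma aux_A6 {s : ℝ} (h0 : 0 < s) (h1 : s < 1) {r : ℝ} (hr : 0 < r) :
    IntegrableOn (fun y : ℝ => (1 - Real.cos (r * y)) * y ^ (-1 - 2*s)) (Ioi 0) := by
  apply Integrable.of_integral_ne_zero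
  rw [aux_A5 h0 h1 hr]
  have := KK_pos h0 h1
  positivity

lemma gint {s : ℝ} (h0 : 0 < s) {q : ℝ} (hq : -1 < q) :
    IntegrableOn (fun r : ℝ => r ^ q * rexp (-(r ^ (2*s)))) (Ioi 0) := by
  apply Integrable.of_integral_ne_zero
  rw [integral_rpow_mul_exp_neg_rpow (by linarith) hq]
  have := Real.Gamma_pos_of_pos (show 0 < (q+1)/(2*s) from div_pos (by linarith) (by linarith))
  positivity

lemma gint0 {s : ℝ} (h0 : 0 < s) :
    IntegrableOn (fun r : ℝ => rexp (-(r ^ (2*s)))) (Ioi 0) := by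
  simpa using gint h0 (q := 0) (by norm_num)

lemma gcos {s : ℝ} (h0 : 0 < s) (x : ℝ) :
    IntegrableOn (fun r : ℝ => Real.cos (x*r) * rexp (-(r ^ (2*s)))) (Ioi 0) := by
  refine Integrable.mono' (gint0 h0) (by fun_prop) (Eventually.of_forall fun r => ?_)
  rw [norm_mul, Real.norm_of_nonneg (Real.exp_pos _).le]
  exact mul_le_of_le_one_left (Real.exp_pos _).le (Real.abs_cos_le_one _)

lemma sin_div_le (x : ℝ) {r : ℝ} (hr : 0 < r) : |Real.sin (x*r) / r| ≤ |x| := by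
  rw [abs_div, abs_of_pos hr, div_le_iff₀ hr]
  calc _ ≤ |x * r| := Real.abs_sin_le_abs
    _ = _ := by rw [abs_mul, abs_of_pos hr]

lemma gsin {s : ℝ} (h0 : 0 < s) (x : ℝ) :
    IntegrableOn (fun r : ℝ => Real.sin (x*r) / r * rexp (-(r ^ (2*s)))) (Ioi 0) := by
  refine Integrable.mono' ((gint0 h0).const_mul |x|)
    (Measurable.aestronglyMeasurable (by fun_prop)) ?_
  filter_upwards [ae_restrict_mem measurableSet_Ioi] with r hr
  rw [norm_mul, Real.norm_of_nonneg (Real.exp_pos _).le]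
  exact mul_le_mul_of_nonneg_right (sin_div_le x hr) (Real.exp_pos _).le

lemma g_deriv {s : ℝ} {r : ℝ} (hr : 0 < r) :
    HasDerivAt (fun r : ℝ => rexp (-(r ^ (2*s))))
      (-(2*s * (r ^ (2*s-1) * rexp (-(r ^ (2*s)))))) r := by
  have d1 := Real.hasDerivAt_rpow_const (x := r) (p := 2*s) (Or.inl hr.ne')
  refine HasDerivAt.congr_deriv d1.neg.exp ?_
  simp only [Pi.neg_apply]
  ring

lemma g_tend {s : ℝ} (h0 : 0 < s) :
    Tendsto (fun r : ℝ => rexp (-(r ^ (2*s)))) atTop (nhds 0) :=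
  Real.tendsto_exp_neg_atTop_nhds_zero.comp (tendsto_rpow_atTop (by linarith))

lemma ibp {s : ℝ} (h0 : 0 < s) (x : ℝ) :
    ∫ r in Ioi (0:ℝ), Real.sin (x*r) * (r ^ (2*s-1) * rexp (-(r ^ (2*s))))
      = x / (2*s) * ∫ r in Ioi (0:ℝ), Real.cos (x*r) * rexp (-(r ^ (2*s))) := by
  have hi : IntegrableOn (fun r : ℝ => Real.sin (x*r) * (r ^ (2*s-1) * rexp (-(r ^ (2*s))))) (Ioi 0) := by
    refine Integrable.mono' (gint h0 (q := 2*s-1) (by linarith))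
      (Measurable.aestronglyMeasurable (by fun_prop)) ?_
    filter_upwards [ae_restrict_mem measurableSet_Ioi] with r hr
    have hr0 : (0:ℝ) < r := hr
    rw [norm_mul, Real.norm_of_nonneg (show 0 ≤ r ^ (2*s-1) * rexp (-(r ^ (2*s))) by positivity)]
    exact mul_le_of_le_one_left (by positivity) (Real.abs_sin_le_one _)
  have key : ∫ r in Ioi (0:ℝ), (x * (Real.cos (x*r) * rexp (-(r ^ (2*s))))
      - (2*s) * (Real.sin (x*r) * (r ^ (2*s-1) * rexp (-(r ^ (2*s))))))
      = 0 - (fun r : ℝ => Real.sin (x*r) * rexp (-(r ^ (2*s)))) 0 := by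
    refine integral_Ioi_of_hasDerivAt_of_tendsto
      (f := fun r : ℝ => Real.sin (x*r) * rexp (-(r ^ (2*s)))) ?_ ?_ ?_ ?_
    · have : Continuous (fun r : ℝ => Real.sin (x*r) * rexp (-(r ^ (2*s)))) := by
        have := Real.continuous_rpow_const (q := 2*s) (by linarith)
        fun_prop
      exact this.continuousWithinAt
    · intro r hr
      have d1 : HasDerivAt (fun r : ℝ => Real.sin (x*r)) (Real.cos (x*r) * x) r := by
        simpa using ((hasDerivAt_id r).const_mul x).sin
      refine HasDerivAt.congr_deriv (d1.mul (g_deriv hr)) ?_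
      ring
    · exact ((gcos h0 x).const_mul x).sub (hi.const_mul (2*s))
    · refine squeeze_zero_norm (fun r => ?_) (g_tend h0)
      rw [norm_mul, Real.norm_of_nonneg (Real.exp_pos _).le]
      exact mul_le_of_le_one_left (Real.exp_pos _).le (Real.abs_sin_le_one _)
  rw [integral_sub ((gcos h0 x).const_mul x) (hi.const_mul (2*s)), integral_const_mul,
    integral_const_mul] at key
  simp only [mul_zero, Real.sin_zero, zero_mul, sub_self] at key
  rw [div_mul_eq_mul_div, eq_div_iff (by positivity)]
  linarith

lemma layerV_eq (s x : ℝ) : layerV s 1 x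
    = (2/π) * ∫ r in Ioi (0:ℝ), Real.sin (x*r) / r * rexp (-(r ^ (2*s))) := by
  simp only [layerV, one_mul]

lemma layerV_deriv {s : ℝ} (h0 : 0 < s) (x : ℝ) :
    HasDerivAt (layerV s 1)
      ((2/π) * ∫ r in Ioi (0:ℝ), Real.cos (x*r) * rexp (-(r ^ (2*s)))) x := by
  have hfun : layerV s 1 = fun x => (2/π) * ∫ r in Ioi (0:ℝ), Real.sin (x*r) / r * rexp (-(r ^ (2*s))) := by
    ext x; exact layerV_eq s x
  rw [hfun]
  refine HasDerivAt.const_mul _ ?_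
  refine (hasDerivAt_integral_of_dominated_loc_of_deriv_le (s := univ)
    (F := fun x r => Real.sin (x*r) / r * rexp (-(r ^ (2*s))))
    (F' := fun x r => Real.cos (x*r) * rexp (-(r ^ (2*s))))
    (bound := fun r => rexp (-(r ^ (2*s)))) univ_mem ?_ (gsin h0 x) (gcos h0 x).aestronglyMeasurable
    ?_ (gint0 h0) ?_).2
  · exact Eventually.of_forall fun x => (gsin h0 x).aestronglyMeasurable
  · refine Eventually.of_forall fun r x _ => ?_
    rw [norm_mul, Real.norm_of_nonneg (Real.exp_pos _).le]
    exact mul_le_of_le_one_left (Real.exp_pos _).le (Real.abs_cos_le_one _)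
  · filter_upwards [ae_restrict_mem measurableSet_Ioi] with r hr x _
    have hr0 : r ≠ 0 := (show (0:ℝ) < r from hr).ne'
    have d1 : HasDerivAt (fun x : ℝ => Real.sin (x*r)) (Real.cos (x*r) * r) x := by
      simpa using ((hasDerivAt_id x).mul_const r).sin
    refine HasDerivAt.congr_deriv ((d1.div_const r).mul_const _) ?_
    field_simp

lemma cos_smooth {s : ℝ} (h0 : 0 < s) :
    ContDiff ℝ (⊤ : ℕ∞) (fun x : ℝ => ∫ r in Ioi (0:ℝ), Real.cos (x*r) * rexp (-(r ^ (2*s)))) := by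
  let f : ℝ → ℂ := (Ioi (0:ℝ)).indicator (fun r => ((rexp (-(r ^ (2*s))) : ℝ) : ℂ))
  have hf : ContDiff ℝ (⊤ : ℕ∞) (FourierTransform.fourier f) := by
    apply Real.contDiff_fourier
    intro n _
    have h := gint h0 (q := n) (by have : (0:ℝ) ≤ n := n.cast_nonneg
                                   linarith)
    rw [← integrable_indicator_iff measurableSet_Ioi] at h
    refine h.congr (Eventually.of_forall fun r => ?_)
    by_cases hr : r ∈ Ioi (0:ℝ)
    · have hr0 : (0:ℝ) < r := hr
      simp only [f, indicator_of_mem hr, Complex.norm_real, Real.rpow_natCast]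
      rw [Real.norm_of_nonneg hr0.le, Real.norm_of_nonneg (Real.exp_pos _).le]
    · simp only [f, indicator_of_notMem hr, norm_zero, mul_zero]
  have heq : (fun x : ℝ => ∫ r in Ioi (0:ℝ), Real.cos (x*r) * rexp (-(r ^ (2*s))))
      = fun x => Complex.reCLM (FourierTransform.fourier f ((2*π)⁻¹ * x)) := by
    ext x
    have e1 : (fun v : ℝ => Complex.exp (↑(-2 * π * v * ((2*π)⁻¹ * x)) * Complex.I) • f v)
        = (Ioi (0:ℝ)).indicator (fun v : ℝ => Complex.exp (((-(x*v) : ℝ) : ℂ) * Complex.I)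
          * ((rexp (-(v ^ (2*s))) : ℝ) : ℂ)) := by
      ext v
      have : -2 * π * v * ((2*π)⁻¹ * x) = -(x*v) := by field_simp
      rw [this]
      by_cases hr : v ∈ Ioi (0:ℝ)
      · simp only [f, indicator_of_mem hr, smul_eq_mul]
      · simp only [f, indicator_of_notMem hr, smul_zero]
    rw [Real.fourier_real_eq_integral_exp_smul, e1, integral_indicator measurableSet_Ioi]
    have hi : Integrable (fun v : ℝ => Complex.exp (((-(x*v) : ℝ) : ℂ) * Complex.I)
          * ((rexp (-(v ^ (2*s))) : ℝ) : ℂ)) (volume.restrict (Ioi (0:ℝ))) := by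
      refine Integrable.mono' (gint0 h0) (Measurable.aestronglyMeasurable (by fun_prop))
        (Eventually.of_forall fun r => ?_)
      rw [norm_mul, Complex.norm_exp_ofReal_mul_I, one_mul, Complex.norm_real,
        Real.norm_of_nonneg (Real.exp_pos _).le]
    rw [← ContinuousLinearMap.integral_comp_comm Complex.reCLM hi]
    refine integral_congr_ae (Eventually.of_forall fun v => ?_)
    simp only [Complex.reCLM_apply]
    rw [Complex.re_mul_ofReal, Complex.exp_ofReal_mul_I_re, Real.cos_neg]
  rw [heq]
  exact Complex.reCLM.contDiff.comp (hf.comp (contDiff_const.mul contDiff_id))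

lemma layerV_smooth {s : ℝ} (h0 : 0 < s) : ContDiff ℝ (⊤ : ℕ∞) (layerV s 1) := by
  rw [contDiff_infty_iff_deriv]
  refine ⟨fun x => (layerV_deriv h0 x).differentiableAt, ?_⟩
  have : deriv (layerV s 1) = fun x : ℝ => (2/π) * ∫ r in Ioi (0:ℝ), Real.cos (x*r) * rexp (-(r ^ (2*s))) := by
    ext x; exact (layerV_deriv h0 x).deriv
  rw [this]
  exact contDiff_const.mul (cos_smooth h0)

lemma sin_int_bound {s : ℝ} (h0 : 0 < s) {x : ℝ} (hx : 0 < x) :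
    |∫ r in Ioi (0:ℝ), Real.sin (x*r) / r * rexp (-(r ^ (2*s)))| ≤ 3 := by
  have hi := gsin h0 x
  have ha : (0:ℝ) < x⁻¹ := inv_pos.2 hx
  have hx1 : x * x⁻¹ = 1 := mul_inv_cancel₀ hx.ne'
  rw [← Ioc_union_Ioi_eq_Ioi ha.le] at hi ⊢
  rw [setIntegral_union (Ioc_disjoint_Ioi le_rfl) measurableSet_Ioi hi.left_of_union hi.right_of_union]
  have b1 : |∫ r in Ioc (0:ℝ) x⁻¹, Real.sin (x*r) / r * rexp (-(r ^ (2*s)))| ≤ 1 := by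
    have := norm_setIntegral_le_of_norm_le_const (μ := volume) (s := Ioc (0:ℝ) x⁻¹) (C := x)
      (f := fun r => Real.sin (x*r) / r * rexp (-(r ^ (2*s)))) (by simp) (fun r hr => by
        have hr0 : 0 < r := hr.1
        rw [norm_mul, Real.norm_of_nonneg (Real.exp_pos _).le]
        have h1 := sin_div_le x hr0
        rw [abs_of_pos hx] at h1
        have h2 : rexp (-(r ^ (2*s))) ≤ 1 := Real.exp_le_one_iff.2 (by
          have : 0 ≤ r ^ (2*s) := by positivity
          linarith)
        calc _ ≤ x * 1 := mul_le_mul h1 h2 (Real.exp_pos _).le hx.le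
          _ = x := mul_one x)
    simpa [ha.le, hx1] using this
  have b2 : |∫ r in Ioi x⁻¹, Real.sin (x*r) / r * rexp (-(r ^ (2*s)))| ≤ 2 := by
    let h : ℝ → ℝ := fun r => rexp (-(r ^ (2*s))) / r
    let h' : ℝ → ℝ := fun r => ((-(2*s * (r ^ (2*s-1) * rexp (-(r ^ (2*s)))))) * r
      - rexp (-(r ^ (2*s))) * 1) / r ^ 2
    have hd : ∀ r ∈ Ioi x⁻¹, HasDerivAt h (h' r) r := by
      intro r hr
      have hr0 : 0 < r := ha.trans hr
      exact (g_deriv hr0).div (hasDerivAt_id r) hr0.ne'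
    have hd0 : ContinuousWithinAt h (Ici x⁻¹) x⁻¹ :=
      ((g_deriv ha).div (hasDerivAt_id _) ha.ne').continuousAt.continuousWithinAt
    have hneg : ∀ r ∈ Ioi x⁻¹, h' r ≤ 0 := by
      intro r hr
      have hr0 : 0 < r := ha.trans hr
      have e1 : 0 < 2*s * (r ^ (2*s-1) * rexp (-(r ^ (2*s)))) * r := by positivity
      have e2 := Real.exp_pos (-(r ^ (2*s)))
      exact div_nonpos_of_nonpos_of_nonneg (by linarith) (by positivity)
    have ht : Tendsto h atTop (nhds 0) := by
      have := (g_tend h0).mul tendsto_inv_atTop_zero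
      simpa [h, div_eq_mul_inv] using this
    have hint := integrableOn_Ioi_deriv_of_nonpos hd0 hd hneg ht
    have hval := integral_Ioi_of_hasDerivAt_of_nonpos hd0 hd hneg ht
    have hci : IntegrableOn (fun r => Real.cos (x*r) * h' r) (Ioi x⁻¹) := by
      refine Integrable.mono' hint.norm
        ((Measurable.aestronglyMeasurable (by fun_prop)).mul hint.aestronglyMeasurable)
        (Eventually.of_forall fun r => ?_)
      rw [norm_mul]
      exact mul_le_of_le_one_left (norm_nonneg _) (Real.abs_cos_le_one _)
    have hcb : |∫ r in Ioi x⁻¹, Real.cos (x*r) * h' r| ≤ h x⁻¹ := by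
      have : ‖∫ r in Ioi x⁻¹, Real.cos (x*r) * h' r‖ ≤ ∫ r in Ioi x⁻¹, -(h' r) := by
        refine norm_integral_le_of_norm_le hint.neg ?_
        filter_upwards [ae_restrict_mem measurableSet_Ioi] with r hr
        rw [norm_mul, Real.norm_of_nonpos (hneg r hr)]
        exact mul_le_of_le_one_left (by linarith [hneg r hr]) (Real.abs_cos_le_one _)
      rw [integral_neg, hval] at this
      simpa using this
    have key : ∫ r in Ioi x⁻¹, (Real.cos (x*r) * h' r
        - x * (Real.sin (x*r) / r * rexp (-(r ^ (2*s)))))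
        = 0 - (fun r => Real.cos (x*r) * h r) x⁻¹ := by
      refine integral_Ioi_of_hasDerivAt_of_tendsto (f := fun r => Real.cos (x*r) * h r) ?_ ?_ ?_ ?_
      · exact ContinuousWithinAt.mul (by fun_prop) hd0
      · intro r hr
        have d1 : HasDerivAt (fun r : ℝ => Real.cos (x*r)) (-Real.sin (x*r) * x) r := by
          simpa using ((hasDerivAt_id r).const_mul x).cos
        refine HasDerivAt.congr_deriv (d1.mul (hd r hr)) ?_
        simp only [h]
        ring
      · exact hci.sub (hi.right_of_union.const_mul x)
      · refine squeeze_zero_norm (fun r => ?_) (by simpa using ht.norm)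
        rw [norm_mul]
        exact mul_le_of_le_one_left (norm_nonneg _) (Real.abs_cos_le_one _)
    rw [integral_sub hci (hi.right_of_union.const_mul x), integral_const_mul] at key
    simp only [hx1] at key
    have hh : 0 ≤ h x⁻¹ := div_nonneg (Real.exp_pos _).le ha.le
    have hhx : h x⁻¹ ≤ x := by
      simp only [h]
      rw [div_inv_eq_mul]
      refine mul_le_of_le_one_left hx.le (Real.exp_le_one_iff.2 ?_)
      have : 0 ≤ x⁻¹ ^ (2*s) := by positivity
      linarith
    have hc1 : |Real.cos 1 * h x⁻¹| ≤ h x⁻¹ := by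
      rw [abs_mul, abs_of_nonneg hh]
      exact mul_le_of_le_one_left hh (Real.abs_cos_le_one _)
    set J := ∫ r in Ioi x⁻¹, Real.sin (x*r) / r * rexp (-(r ^ (2*s))) with hJ
    have hxJ : |x * J| ≤ x * 2 := by
      rw [abs_le] at *
      constructor <;> linarith [hc1.1, hc1.2, hcb.1, hcb.2]
    rw [abs_mul, abs_of_pos hx] at hxJ
    exact le_of_mul_le_mul_left hxJ hx
  exact (abs_add_le _ _).trans (by linarith)

lemma layerV_bdd {s : ℝ} (h0 : 0 < s) (x : ℝ) : |layerV s 1 x| ≤ 2/π * 3 := by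
  rw [layerV_eq, abs_mul, abs_of_pos (show 0 < 2/π by positivity)]
  gcongr
  rcases lt_trichotomy x 0 with hx | rfl | hx
  · have := sin_int_bound h0 (neg_pos.2 hx)
    simpa [neg_div, integral_neg] using this
  · simp
  · exact sin_int_bound h0 hx

lemma coef_KK {s : ℝ} (h0 : 0 < s) (h1 : s < 1) : fracLapCoef s * (2 * KK s) = 1 := by
  have hG1 := Real.Gamma_pos_of_pos (show 0 < 1 - s by linarith)
  have hG2 := Real.Gamma_pos_of_pos (show 0 < s + 1/2 by linarith)
  unfold fracLapCoef KK
  rw [Real.rpow_neg (by norm_num)]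
  have : (0:ℝ) < 4 ^ s := by positivity
  have : 0 < √π := Real.sqrt_pos.2 pi_pos
  field_simp

lemma fracLap_eq {s : ℝ} (h0 : 0 < s) (h1 : s < 1) (x : ℝ) :
    fracLap s (layerV s 1) x
      = (2/π) * ∫ r in Ioi (0:ℝ), Real.sin (x*r) * (r ^ (2*s-1) * rexp (-(r ^ (2*s)))) := by
  let f : ℝ → ℝ → ℝ := fun r y => (Real.sin (x*r) / r * rexp (-(r ^ (2*s)))) *
    ((1 - Real.cos (r*y)) * y ^ (-1 - 2*s))
  have hK := KK_pos h0 h1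
  have hv : ∀ y ∈ Ioi (0:ℝ), (2 * layerV s 1 x - layerV s 1 (x + y) - layerV s 1 (x - y)) * y ^ (-1 - 2*s)
      = (2/π) * 2 * ∫ r in Ioi (0:ℝ), f r y := by
    intro y _
    simp only [layerV_eq]
    have e : ∀ r : ℝ, f r y = y ^ (-1 - 2*s) / 2 * ((2 * (Real.sin (x*r) / r * rexp (-(r ^ (2*s))))
        - Real.sin ((x+y)*r) / r * rexp (-(r ^ (2*s)))) - Real.sin ((x-y)*r) / r * rexp (-(r ^ (2*s)))) := by
      intro r
      simp only [f]
      rw [add_mul x y r, sub_mul x y r, Real.sin_add, Real.sin_sub, mul_comm r y]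
      ring
    simp_rw [e]
    have i1 : Integrable (fun r : ℝ => 2 * (Real.sin (x*r) / r * rexp (-(r ^ (2*s))))
        - Real.sin ((x+y)*r) / r * rexp (-(r ^ (2*s)))) (volume.restrict (Ioi (0:ℝ))) :=
      ((gsin h0 x).const_mul 2).sub (gsin h0 (x+y))
    rw [integral_const_mul, integral_sub i1 (gsin h0 (x-y)),
      integral_sub ((gsin h0 x).const_mul 2) (gsin h0 (x+y)), integral_const_mul]
    ring
  have hr : ∀ r ∈ Ioi (0:ℝ), ∫ y in Ioi (0:ℝ), f r y
      = KK s * (Real.sin (x*r) * (r ^ (2*s-1) * rexp (-(r ^ (2*s))))) := by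
    intro r hr
    have hr0 : (0:ℝ) < r := hr
    simp only [f]
    rw [integral_const_mul, aux_A5 h0 h1 hr0, Real.rpow_sub_one hr0.ne']
    ring
  have hint : Integrable (Function.uncurry f)
      ((volume.restrict (Ioi (0:ℝ))).prod (volume.restrict (Ioi (0:ℝ)))) := by
    have hm : Measurable (Function.uncurry f) := by
      simp only [f, Function.uncurry_def]; fun_prop
    refine (integrable_prod_iff hm.aestronglyMeasurable).2 ⟨?_, ?_⟩
    · filter_upwards [ae_restrict_mem measurableSet_Ioi] with r hr
      exact (aux_A6 h0 h1 hr).const_mul (Real.sin (x*r) / r * rexp (-(r ^ (2*s))))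
    · have hb := (gint h0 (q := 2*s) (by linarith)).const_mul (|x| * KK s)
      refine Integrable.mono' hb
        (hm.norm.stronglyMeasurable.integral_prod_right').aestronglyMeasurable ?_
      filter_upwards [ae_restrict_mem measurableSet_Ioi] with r hr
      have hr0 : (0:ℝ) < r := hr
      have e : ∫ y in Ioi (0:ℝ), ‖Function.uncurry f (r, y)‖
          = |Real.sin (x*r) / r| * rexp (-(r ^ (2*s))) * (KK s * r ^ (2*s)) := by
        rw [← aux_A5 h0 h1 hr0, ← integral_const_mul]
        refine setIntegral_congr_fun measurableSet_Ioi fun y hy => ?_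
        have hy0 : (0:ℝ) < y := hy
        have : 0 ≤ 1 - Real.cos (r*y) := by linarith [Real.cos_le_one (r*y)]
        simp only [Function.uncurry, f]
        rw [norm_mul, norm_mul, Real.norm_of_nonneg (Real.exp_pos _).le,
          Real.norm_of_nonneg (show 0 ≤ (1 - Real.cos (r*y)) * y ^ (-1 - 2*s) by positivity),
          Real.norm_eq_abs]
      rw [e, Real.norm_of_nonneg (by positivity)]
      calc _ ≤ |x| * rexp (-(r ^ (2*s))) * (KK s * r ^ (2*s)) := by
            have := sin_div_le x hr0
            exact mul_le_mul_of_nonneg_right (mul_le_mul_of_nonneg_right this (Real.exp_pos _).le)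
              (by positivity)
        _ = _ := by ring
  unfold fracLap
  rw [setIntegral_congr_fun measurableSet_Ioi hv, integral_const_mul,
    ← integral_integral_swap hint, setIntegral_congr_fun measurableSet_Ioi hr, integral_const_mul]
  calc _ = (fracLapCoef s * (2 * KK s)) * ((2/π) * ∫ r in Ioi (0:ℝ), Real.sin (x*r) * (r ^ (2*s-1) * rexp (-(r ^ (2*s))))) := by ring
    _ = _ := by rw [coef_KK h0 h1, one_mul]

/-- The explicit layer `v = v¹_s` is smooth, bounded, and satisfies
`(-∂ₓₓ)^s v (x) = (1/(2s)) x v'(x) = (x/(sπ)) ∫₀^∞ cos(xr) e^{-r^{2s}} dr`. -/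
theorem statement8 (s : ℝ) (hs : s ∈ Set.Ioo (0:ℝ) 1) :
    (∃ M : ℝ, ∀ x : ℝ, |layerV s 1 x| ≤ M) ∧
    ContDiff ℝ (⊤ : ℕ∞) (layerV s 1) ∧
    (∀ x : ℝ,
      fracLap s (layerV s 1) x = (1/(2*s)) * x * deriv (layerV s 1) x ∧
      fracLap s (layerV s 1) x
        = (x/(s*π)) * ∫ r in Set.Ioi (0:ℝ), Real.cos (x*r) * Real.exp (-(r ^ (2*s)))) := by
  obtain ⟨h0, h1⟩ := hs
  refine ⟨⟨2/π * 3, layerV_bdd h0⟩, layerV_smooth h0, fun x => ?_⟩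
  have hpi := pi_pos
  have h2 : fracLap s (layerV s 1) x
        = (x/(s*π)) * ∫ r in Set.Ioi (0:ℝ), Real.cos (x*r) * Real.exp (-(r ^ (2*s))) := by
    rw [fracLap_eq h0 h1, ibp h0]
    field_simp
  refine ⟨?_, h2⟩
  rw [h2, (layerV_deriv h0 x).deriv]
  field_simp
end

section
/- Let s ∈ (0,1) and t > 0. Then there exists a function f : ℝ → ℝ, continuous and odd, of class C¹ on [−1,1], with f(0) = f(1) = 0, f(r) > 0 for every r ∈ (0,1), one-sided derivatives f′(−1) = f′(1) = −1/t, such that the function v^t_s satisfies ((-∂ₓₓ)^s v^t_s)(x) = f(v^t_s(x)) for every x ∈ ℝ. Moreover, f′ (restricted to [−1,1]) is differentiable at 1 with second derivative f″(1) = −(π/t)(cos(πs)/sin(πs)) Γ(4s)/Γ(2s)², which is negative if 0 < s < 1/2, zero if s = 1/2, and positive if 1/2 < s < 1. -/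
open Real MeasureTheory Filter Set

lemma aux_cosGauss (u : ℝ) (hu : 0 < u) :
    ∫ z in Ioi (0:ℝ), Real.cos z * Real.exp (-u * z^2) = √(π/u)/2 * Real.exp (-(1/(4*u))) := by
  have h := fourierIntegral_gaussian (b := (u:ℂ)) (by simpa using hu) 1
  have hint : Integrable (fun x : ℝ => Complex.exp (Complex.I * 1 * x) * Complex.exp (-(u:ℂ) * x^2)) := by
    have := integrable_cexp_quadratic (b := (u:ℂ)) (by simpa using hu) Complex.I 0
    refine this.congr (Eventually.of_forall fun x => ?_)
    simp only [← Complex.exp_add]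
    congr 1; ring
  have e : ∀ x : ℝ, (Complex.exp (Complex.I * 1 * x) * Complex.exp (-(u:ℂ) * x^2)).re
      = Real.cos |x| * Real.exp (-u * |x|^2) := by
    intro x
    rw [show (-(u:ℂ) * x^2) = ((-u * x^2 : ℝ) : ℂ) by push_cast; ring, ← Complex.ofReal_exp,
      Complex.re_mul_ofReal, mul_one, mul_comm Complex.I, Complex.exp_ofReal_mul_I_re, Real.cos_abs, sq_abs]
  have h3 := Complex.reCLM.integral_comp_comm hint
  simp only [Complex.reCLM_apply, e] at h3
  rw [integral_comp_abs (f := fun x => Real.cos x * Real.exp (-u * x^2)), h] at h3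
  have h4 : ((π:ℂ)/u)^(1/2:ℂ) * Complex.exp (-1^2/(4*u)) = ((√(π/u) * Real.exp (-(1/(4*u))) : ℝ) : ℂ) := by
    push_cast
    rw [Real.sqrt_eq_rpow, Complex.ofReal_cpow (by positivity)]
    push_cast
    congr 2
    ring
  rw [h4, Complex.ofReal_re] at h3
  linarith

lemma aux_K (s : ℝ) (hs : s ∈ Ioo (0:ℝ) 1) :
    IntegrableOn (fun u : ℝ => u^(s-1) * (1 - Real.exp (-(1/(4*u))))) (Ioi 0) ∧
    ∫ u in Ioi (0:ℝ), u^(s-1) * (1 - Real.exp (-(1/(4*u)))) = 4^(-s) * Real.Gamma (1-s) / s := by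
  have hs0 := hs.1
  have hs1 := hs.2
  set F : ℝ → ℝ → ℝ := fun a u => (if 4*a*u < 1 then u^(s-1) else 0) * Real.exp (-a) with hF
  have hmeas : AEStronglyMeasurable (Function.uncurry F)
      ((volume.restrict (Ioi (0:ℝ))).prod (volume.restrict (Ioi (0:ℝ)))) := by
    apply Measurable.aestronglyMeasurable
    apply Measurable.mul
    · apply Measurable.ite
      · exact measurableSet_lt (by fun_prop) (by fun_prop)
      · fun_prop
      · fun_prop
    · fun_prop
  have inner1 : ∀ a : ℝ, 0 < a → IntegrableOn (fun u => F a u) (Ioi 0) ∧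
      ∫ u in Ioi (0:ℝ), F a u = 4^(-s) / s * (Real.exp (-a) * a ^ ((1-s) - 1)) := by
    intro a ha
    have e : EqOn (fun u => F a u) ((Ioo 0 (1/(4*a))).indicator (fun u => u^(s-1) * Real.exp (-a))) (Ioi 0) := by
      intro u hu
      have hu : 0 < u := hu
      have : 4*a*u < 1 ↔ u ∈ Ioo 0 (1/(4*a)) := by
        rw [mem_Ioo, lt_div_iff₀ (by positivity)]
        constructor
        · intro h; exact ⟨hu, by linarith⟩
        · intro h; linarith [h.2]
      simp only [hF, indicator, this]
      split_ifs <;> simp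
    have hI : IntervalIntegrable (fun u : ℝ => u^(s-1)) volume 0 (1/(4*a)) :=
      intervalIntegral.intervalIntegrable_rpow' (by linarith)
    have hI2 : IntegrableOn (fun u : ℝ => u^(s-1) * Real.exp (-a)) (Ioo 0 (1/(4*a))) := by
      rw [intervalIntegrable_iff_integrableOn_Ioo_of_le (by positivity)] at hI
      exact hI.mul_const _
    constructor
    · rw [integrableOn_congr_fun e measurableSet_Ioi]
      exact (hI2.integrable_indicator measurableSet_Ioo).integrableOn
    · rw [setIntegral_congr_fun measurableSet_Ioi e, setIntegral_indicator measurableSet_Ioo]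
      have : Ioi 0 ∩ Ioo 0 (1/(4*a)) = Ioo 0 (1/(4*a)) := by
        ext; simp only [mem_inter_iff, mem_Ioi, mem_Ioo]; tauto
      rw [this, ← integral_Ioc_eq_integral_Ioo, ← intervalIntegral.integral_of_le (by positivity),
        intervalIntegral.integral_mul_const, integral_rpow (by left; linarith)]
      rw [show s - 1 + 1 = s by ring, zero_rpow hs0.ne', show (1 - s - 1) = -s by ring,
        one_div, Real.inv_rpow (by positivity), Real.mul_rpow (by norm_num) ha.le, rpow_neg (by norm_num), rpow_neg ha.le]
      field_simp
      simp
  have inner2 : ∀ u : ℝ, 0 < u → ∫ a in Ioi (0:ℝ), F a u = u^(s-1) * (1 - Real.exp (-(1/(4*u)))) := by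
    intro u hu
    have e : EqOn (fun a => F a u) ((Ioo 0 (1/(4*u))).indicator (fun a => u^(s-1) * Real.exp (-a))) (Ioi 0) := by
      intro a ha
      have ha : 0 < a := ha
      have : 4*a*u < 1 ↔ a ∈ Ioo 0 (1/(4*u)) := by
        rw [mem_Ioo, lt_div_iff₀ (by positivity)]
        constructor
        · intro h; exact ⟨ha, by linarith⟩
        · intro h; linarith [h.2]
      simp only [hF, indicator, this]
      split_ifs <;> simp
    rw [setIntegral_congr_fun measurableSet_Ioi e, setIntegral_indicator measurableSet_Ioo]
    have : Ioi 0 ∩ Ioo 0 (1/(4*u)) = Ioo 0 (1/(4*u)) := by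
        ext; simp only [mem_inter_iff, mem_Ioi, mem_Ioo]; tauto
    rw [this, ← integral_Ioc_eq_integral_Ioo, ← intervalIntegral.integral_of_le (by positivity),
        intervalIntegral.integral_const_mul]
    congr 1
    rw [intervalIntegral.integral_comp_neg (fun x => Real.exp x)]
    simp
  have hnn : ∀ a u : ℝ, 0 < u → ‖F a u‖ = F a u := by
    intro a u hu
    rw [Real.norm_of_nonneg]
    simp only [hF]
    have := Real.exp_pos (-a)
    split_ifs <;> positivity
  have hFi : Integrable (Function.uncurry F)
      ((volume.restrict (Ioi (0:ℝ))).prod (volume.restrict (Ioi (0:ℝ)))) := by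
    rw [integrable_prod_iff hmeas]
    constructor
    · filter_upwards [ae_restrict_mem measurableSet_Ioi] with a ha using (inner1 a ha).1
    · have h : IntegrableOn (fun a : ℝ => 4^(-s) / s * (Real.exp (-a) * a ^ ((1-s) - 1))) (Ioi 0) :=
        (Real.GammaIntegral_convergent (s := 1 - s) (by linarith)).const_mul _
      refine h.congr_fun ?_ measurableSet_Ioi
      intro a ha
      simp only [Function.uncurry]
      rw [← (inner1 a ha).2]
      exact setIntegral_congr_fun measurableSet_Ioi (fun u hu => (hnn a u hu).symm)
  have hsw := integral_integral_swap hFi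
  have hr := hFi.integral_prod_right
  constructor
  · refine IntegrableOn.congr_fun (f := fun u => ∫ a in Ioi (0:ℝ), F a u) hr ?_ measurableSet_Ioi
    intro u hu; exact inner2 u hu
  · rw [← setIntegral_congr_fun measurableSet_Ioi (fun u hu => inner2 u hu), ← hsw,
      setIntegral_congr_fun measurableSet_Ioi (fun a ha => (inner1 a ha).2), integral_const_mul,
      ← Real.Gamma_eq_integral (by linarith)]
    ring

lemma aux_J (s : ℝ) (hs : s ∈ Ioo (0:ℝ) 1) :
    IntegrableOn (fun z : ℝ => (1 - Real.cos z) * z^(-1-2*s)) (Ioi 0) ∧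
    fracLapCoef s * (2 * ∫ z in Ioi (0:ℝ), (1 - Real.cos z) * z^(-1-2*s)) = 1 := by
  have hs0 := hs.1
  have hs1 := hs.2
  set F : ℝ → ℝ → ℝ := fun u z => (1 - Real.cos z) * (u^(s-1/2) * Real.exp (-u * z^2)) with hF
  have hmeas : AEStronglyMeasurable (Function.uncurry F)
      ((volume.restrict (Ioi (0:ℝ))).prod (volume.restrict (Ioi (0:ℝ)))) := by
    apply Measurable.aestronglyMeasurable
    simp only [hF]
    fun_prop
  have hg : ∀ u : ℝ, 0 < u → IntegrableOn (fun z : ℝ => Real.exp (-u * z^2)) (Ioi 0) := fun u hu =>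
    (integrable_exp_neg_mul_sq hu).integrableOn
  have hgc : ∀ u : ℝ, 0 < u → IntegrableOn (fun z : ℝ => Real.cos z * Real.exp (-u * z^2)) (Ioi 0) := by
    intro u hu
    refine (hg u hu).mono' (by fun_prop) (Eventually.of_forall fun z => ?_)
    rw [norm_mul, Real.norm_eq_abs, Real.norm_of_nonneg (Real.exp_pos _).le]
    exact mul_le_of_le_one_left (Real.exp_pos _).le (Real.abs_cos_le_one z)
  have eF : ∀ u z : ℝ, F u z = u^(s-1/2) * (Real.exp (-u * z^2) - Real.cos z * Real.exp (-u * z^2)) := by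
    intro u z; simp only [hF]; ring
  have inner1 : ∀ u : ℝ, 0 < u → IntegrableOn (fun z => F u z) (Ioi 0) ∧
      ∫ z in Ioi (0:ℝ), F u z = √π/2 * (u^(s-1) * (1 - Real.exp (-(1/(4*u))))) := by
    intro u hu
    simp only [eF]
    refine ⟨((hg u hu).sub (hgc u hu)).const_mul _, ?_⟩
    rw [integral_const_mul, integral_sub (hg u hu) (hgc u hu), aux_cosGauss u hu, integral_gaussian_Ioi]
    rw [Real.sqrt_div pi_pos.le, Real.sqrt_eq_rpow u, show s - 1/2 = (s-1) + 1/2 by ring, rpow_add hu]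
    have : u^(1/2:ℝ) ≠ 0 := by positivity
    field_simp
  have inner2 : ∀ z : ℝ, 0 < z → ∫ u in Ioi (0:ℝ), F u z = Real.Gamma (s+1/2) * ((1 - Real.cos z) * z^(-1-2*s)) := by
    intro z hz
    have := Real.integral_rpow_mul_exp_neg_mul_Ioi (a := s + 1/2) (r := z^2) (by linarith) (by positivity)
    simp only [hF]
    rw [integral_const_mul]
    have e : ∫ u in Ioi (0:ℝ), u^(s-1/2) * Real.exp (-u * z^2) = (1/z^2)^(s+1/2) * Real.Gamma (s+1/2) := by
      rw [← this]
      refine setIntegral_congr_fun measurableSet_Ioi (fun u hu => ?_)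
      congr 2
      · ring
      · ring
    rw [e]
    have : (1/z^2)^(s+1/2) = z^(-1-2*s) := by
      rw [show (1/z^2) = z^(-2:ℝ) by rw [rpow_neg hz.le]; simp, ← rpow_mul hz.le]
      congr 1; ring
    rw [this]; ring
  obtain ⟨k1, k2⟩ := aux_K s hs
  have hFi : Integrable (Function.uncurry F)
      ((volume.restrict (Ioi (0:ℝ))).prod (volume.restrict (Ioi (0:ℝ)))) := by
    rw [integrable_prod_iff hmeas]
    constructor
    · filter_upwards [ae_restrict_mem measurableSet_Ioi] with a ha using (inner1 a ha).1
    · have h : IntegrableOn (fun u : ℝ => √π/2 * (u^(s-1) * (1 - Real.exp (-(1/(4*u)))))) (Ioi 0) :=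
        k1.const_mul _
      refine h.congr_fun ?_ measurableSet_Ioi
      intro a ha
      simp only [Function.uncurry]
      rw [← (inner1 a ha).2]
      refine setIntegral_congr_fun measurableSet_Ioi (fun u hu => (?_ : F a u = ‖F a u‖))
      rw [Real.norm_of_nonneg]
      have : 0 ≤ 1 - Real.cos u := by linarith [Real.cos_le_one u]
      have ha' : (0:ℝ) < a := ha
      simp only [hF]
      positivity
  have hsw := integral_integral_swap hFi
  have hr := hFi.integral_prod_right
  have hG : 0 < Real.Gamma (s+1/2) := Real.Gamma_pos_of_pos (by linarith)
  constructor
  · have : IntegrableOn (fun z => Real.Gamma (s+1/2) * ((1 - Real.cos z) * z^(-1-2*s))) (Ioi 0) := by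
      refine IntegrableOn.congr_fun (f := fun u => ∫ a in Ioi (0:ℝ), F a u) hr ?_ measurableSet_Ioi
      intro u hu; exact inner2 u hu
    refine IntegrableOn.congr_fun (this.const_mul (Real.Gamma (s+1/2))⁻¹) (fun z _ => ?_) measurableSet_Ioi
    field_simp
  · rw [setIntegral_congr_fun measurableSet_Ioi (fun a ha => (inner1 a ha).2), integral_const_mul, k2,
      setIntegral_congr_fun measurableSet_Ioi (fun u hu => inner2 u hu), integral_const_mul] at hsw
    have e : ∫ z in Ioi (0:ℝ), (1 - Real.cos z) * z^(-1-2*s) =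
      (√π/2 * (4^(-s) * Real.Gamma (1-s)/s)) / Real.Gamma (s+1/2) := by
      rw [eq_div_iff hG.ne', hsw]; ring
    rw [e, fracLapCoef, rpow_neg (by norm_num)]
    have h1 : 0 < Real.Gamma (1-s) := Real.Gamma_pos_of_pos (by linarith)
    have h2 : (4:ℝ)^s ≠ 0 := by positivity
    have h3 : √π ≠ 0 := by positivity
    field_simp


lemma aux_lap (s : ℝ) (hs : s ∈ Ioo (0:ℝ) 1) (k m v : ℝ → ℝ) (hk : Continuous k)
    (hadd : ∀ a b, k (a+b) + k (a-b) = 2 * k a * Real.cos b) (hm : Measurable m)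
    (hm0 : ∀ x, IntegrableOn (fun r => k (x*r) * m r) (Ioi 0)) (x : ℝ)
    (hm1 : IntegrableOn (fun r => k (x*r) * m r * r^(2*s)) (Ioi 0))
    (hv : ∀ x, v x = ∫ r in Ioi (0:ℝ), k (x*r) * m r) :
    IntegrableOn (fun y => (2 * v x - v (x+y) - v (x-y)) * y^(-1-2*s)) (Ioi 0) ∧
    fracLap s v x = ∫ r in Ioi (0:ℝ), k (x*r) * m r * r^(2*s) := by
  obtain ⟨j1, j2⟩ := aux_J s hs
  set J := ∫ z in Ioi (0:ℝ), (1 - Real.cos z) * z^(-1-2*s) with hJ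
  have hsc : ∀ r : ℝ, 0 < r → IntegrableOn (fun y : ℝ => (1 - Real.cos (r*y)) * y^(-1-2*s)) (Ioi 0) ∧
      ∫ y in Ioi (0:ℝ), (1 - Real.cos (r*y)) * y^(-1-2*s) = r^(2*s) * J := by
    intro r hr
    have e : EqOn (fun y : ℝ => r^(1+2*s) * ((1 - Real.cos (r*y)) * (r*y)^(-1-2*s)))
        (fun y : ℝ => (1 - Real.cos (r*y)) * y^(-1-2*s)) (Ioi 0) := by
      intro y hy
      have hy : 0 < y := hy
      simp only
      rw [Real.mul_rpow hr.le hy.le]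
      have : r^(1+2*s) * r^(-1-2*s) = 1 := by rw [← rpow_add hr]; ring_nf; simp
      linear_combination ((1 - Real.cos (r*y)) * y^(-1-2*s)) * this
    have h1 := (integrableOn_Ioi_comp_mul_left_iff (fun z : ℝ => (1 - Real.cos z) * z^(-1-2*s)) 0 hr).2
      (by simpa using j1)
    have h2 := integral_comp_mul_left_Ioi (fun z : ℝ => (1 - Real.cos z) * z^(-1-2*s)) 0 hr
    constructor
    · exact IntegrableOn.congr_fun (h1.const_mul _) e measurableSet_Ioi
    · rw [← setIntegral_congr_fun measurableSet_Ioi e, integral_const_mul, h2, mul_zero, ← hJ, smul_eq_mul,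
        rpow_add hr, rpow_one]
      field_simp
  set F : ℝ → ℝ → ℝ := fun r y => (k (x*r) * m r) * (2 * ((1 - Real.cos (r*y)) * y^(-1-2*s))) with hF
  have hmeas : AEStronglyMeasurable (Function.uncurry F)
      ((volume.restrict (Ioi (0:ℝ))).prod (volume.restrict (Ioi (0:ℝ)))) := by
    apply Measurable.aestronglyMeasurable
    have hk' := hk.measurable
    simp only [hF]
    fun_prop
  have hFi : Integrable (Function.uncurry F)
      ((volume.restrict (Ioi (0:ℝ))).prod (volume.restrict (Ioi (0:ℝ)))) := by
    rw [integrable_prod_iff hmeas]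
    constructor
    · filter_upwards [ae_restrict_mem measurableSet_Ioi] with r hr
      exact ((hsc r hr).1.const_mul 2).const_mul (k (x*r) * m r)
    · have h : IntegrableOn (fun r : ℝ => 2 * J * ‖k (x*r) * m r * r^(2*s)‖) (Ioi 0) :=
        hm1.norm.const_mul _
      refine IntegrableOn.congr_fun h ?_ measurableSet_Ioi
      intro r hr
      have hr : 0 < r := hr
      have : ∀ y ∈ Ioi (0:ℝ), ‖F r y‖ = ‖k (x*r) * m r‖ * (2 * ((1 - Real.cos (r*y)) * y^(-1-2*s))) := by
        intro y hy
        have hy : 0 < y := hy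
        simp only [hF]
        rw [norm_mul]
        congr 1
        rw [Real.norm_of_nonneg]
        have : 0 ≤ 1 - Real.cos (r*y) := by linarith [Real.cos_le_one (r*y)]
        positivity
      simp only [Function.uncurry]
      rw [setIntegral_congr_fun measurableSet_Ioi this, integral_const_mul, integral_const_mul, (hsc r hr).2,
        norm_mul _ (r^(2*s)), Real.norm_of_nonneg (by positivity : 0 ≤ r^(2*s))]
      ring
  have hin : ∀ y, ∫ r in Ioi (0:ℝ), F r y = (2 * v x - v (x+y) - v (x-y)) * y^(-1-2*s) := by
    intro y
    have h12 : IntegrableOn (fun r => 2 * (k (x*r) * m r) - k ((x+y)*r) * m r) (Ioi 0) :=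
      ((hm0 x).const_mul 2).sub (hm0 (x+y))
    rw [hv, hv, hv, ← integral_const_mul, ← integral_sub ((hm0 _).const_mul _) (hm0 _),
      ← integral_sub h12 (hm0 _), ← integral_mul_const]
    congr 1
    ext r
    have := hadd (x*r) (r*y)
    simp only [hF]
    rw [show (x+y)*r = x*r + r*y by ring, show (x-y)*r = x*r - r*y by ring]
    linear_combination (m r * y^(-1-2*s)) * this
  constructor
  · have := hFi.integral_prod_right
    simp only [Function.uncurry, hin] at this
    exact this
  · have hsw := integral_integral_swap hFi
    simp only [hin] at hsw
    rw [fracLap, ← hsw]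
    have : ∀ r ∈ Ioi (0:ℝ), ∫ y in Ioi (0:ℝ), F r y = (2*J) * (k (x*r) * m r * r^(2*s)) := by
      intro r hr
      simp only [hF]
      rw [integral_const_mul, integral_const_mul, (hsc r hr).2]
      ring
    rw [setIntegral_congr_fun measurableSet_Ioi this, integral_const_mul, ← mul_assoc, j2, one_mul]

lemma intE (s t : ℝ) (hs : s ∈ Ioo (0:ℝ) 1) (ht : 0 < t) (a : ℝ) (ha : -1 < a) :
    IntegrableOn (fun r : ℝ => r^a * Real.exp (-(t * r^(2*s)))) (Ioi 0) := by
  have := integrableOn_rpow_mul_exp_neg_mul_rpow (p := 2*s) (s := a) (b := t) ha (by linarith [hs.1]) ht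
  simpa only [neg_mul] using this

/-- domination by a bounded factor -/
lemma intE_mul (s t : ℝ) (hs : s ∈ Ioo (0:ℝ) 1) (ht : 0 < t) (a C : ℝ) (ha : -1 < a) (g : ℝ → ℝ)
    (hg : Measurable g) (hb : ∀ r, 0 < r → |g r| ≤ C * r^a) :
    IntegrableOn (fun r : ℝ => g r * Real.exp (-(t * r^(2*s)))) (Ioi 0) := by
  refine Integrable.mono' ((intE s t hs ht a ha).const_mul C) (by fun_prop) ?_
  filter_upwards [ae_restrict_mem measurableSet_Ioi] with r hr
  rw [norm_mul, Real.norm_eq_abs, Real.norm_of_nonneg (Real.exp_pos _).le, ← mul_assoc]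
  exact mul_le_mul_of_nonneg_right (hb r hr) (Real.exp_pos _).le

noncomputable def pD (s t x : ℝ) : ℝ :=
  -(1/π) * ∫ r in Ioi (0:ℝ), (r * Real.sin (x*r)) * Real.exp (-(t * r^(2*s)))

lemma deriv_p (s t : ℝ) (hs : s ∈ Ioo (0:ℝ) 1) (ht : 0 < t) (x : ℝ) :
    HasDerivAt (fracHeatKernel s t) (pD s t x) x := by
  have h := hasDerivAt_integral_of_dominated_loc_of_deriv_le (μ := volume.restrict (Ioi (0:ℝ))) (x₀ := x)
    (s := univ) (F := fun x r => Real.cos (x*r) * Real.exp (-(t * r^(2*s))))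
    (F' := fun x r => -((r * Real.sin (x*r)) * Real.exp (-(t * r^(2*s)))))
    (bound := fun r => r^(1:ℝ) * Real.exp (-(t * r^(2*s)))) univ_mem
    (Eventually.of_forall fun x => by fun_prop)
    (intE_mul s t hs ht 0 1 (by norm_num) _ (by fun_prop) (fun r hr => by simpa using Real.abs_cos_le_one _))
    (by fun_prop)
    (by
      filter_upwards [ae_restrict_mem measurableSet_Ioi] with r hr x _
      have hr : 0 < r := hr
      rw [norm_neg, norm_mul, norm_mul, Real.norm_of_nonneg hr.le, Real.norm_of_nonneg (Real.exp_pos _).le, rpow_one]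
      refine mul_le_mul_of_nonneg_right ?_ (Real.exp_pos _).le
      exact mul_le_of_le_one_right hr.le (Real.abs_sin_le_one _))
    (intE s t hs ht 1 (by norm_num))
    (by
      filter_upwards with r x _
      have : HasDerivAt (fun x => Real.cos (x*r)) (-Real.sin (x*r) * (1*r)) x :=
        ((hasDerivAt_id x).mul_const r).cos
      convert! this.mul_const (Real.exp (-(t * r^(2*s)))) using 1
      ring)
  have h2 := h.2.const_mul (1/π)
  convert! h2 using 1
  rw [pD, integral_neg]; ring

lemma cont_pD (s t : ℝ) (hs : s ∈ Ioo (0:ℝ) 1) (ht : 0 < t) : Continuous (pD s t) := by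
  unfold pD
  refine continuous_const.mul ?_
  refine continuous_of_dominated (bound := fun r => r^(1:ℝ) * Real.exp (-(t * r^(2*s))))
    (fun x => by fun_prop) (fun x => ?_) (intE s t hs ht 1 (by norm_num)) ?_
  · filter_upwards [ae_restrict_mem measurableSet_Ioi] with r hr
    have hr : 0 < r := hr
    rw [norm_mul, norm_mul, Real.norm_of_nonneg hr.le, Real.norm_of_nonneg (Real.exp_pos _).le, rpow_one]
    refine mul_le_mul_of_nonneg_right ?_ (Real.exp_pos _).le
    exact mul_le_of_le_one_right hr.le (Real.abs_sin_le_one _)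
  · filter_upwards with r
    fun_prop

lemma abs_sin_div_le (x r : ℝ) (hr : 0 < r) : |Real.sin (x*r) / r| ≤ |x| := by
  rw [abs_div, abs_of_pos hr, div_le_iff₀ hr]
  calc |Real.sin (x*r)| ≤ |x*r| := Real.abs_sin_le_abs
    _ = |x| * r := by rw [abs_mul, abs_of_pos hr]

lemma deriv_V (s t : ℝ) (hs : s ∈ Ioo (0:ℝ) 1) (ht : 0 < t) (x : ℝ) :
    HasDerivAt (layerV s t) (2 * fracHeatKernel s t x) x := by
  have h := hasDerivAt_integral_of_dominated_loc_of_deriv_le (μ := volume.restrict (Ioi (0:ℝ))) (x₀ := x)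
    (s := univ) (F := fun x r => (Real.sin (x*r) / r) * Real.exp (-(t * r^(2*s))))
    (F' := fun x r => (Real.cos (x*r)) * Real.exp (-(t * r^(2*s))))
    (bound := fun r => r^(0:ℝ) * Real.exp (-(t * r^(2*s)))) univ_mem
    (Eventually.of_forall fun x => Measurable.aestronglyMeasurable (by fun_prop))
    (intE_mul s t hs ht 0 |x| (by norm_num) _ (by fun_prop) (fun r hr => by simpa using abs_sin_div_le x r hr))
    (by fun_prop)
    (by
      filter_upwards [ae_restrict_mem measurableSet_Ioi] with r hr x _
      rw [norm_mul, Real.norm_of_nonneg (Real.exp_pos _).le, rpow_zero]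
      refine mul_le_mul_of_nonneg_right ?_ (Real.exp_pos _).le
      exact Real.abs_cos_le_one _)
    (intE s t hs ht 0 (by norm_num))
    (by
      filter_upwards [ae_restrict_mem measurableSet_Ioi] with r hr x _
      have hr : 0 < r := hr
      have : HasDerivAt (fun x => Real.sin (x*r)) (Real.cos (x*r) * (1*r)) x :=
        ((hasDerivAt_id x).mul_const r).sin
      convert! (this.div_const r).mul_const (Real.exp (-(t * r^(2*s)))) using 1
      field_simp)
  have h2 := h.2.const_mul (2/π)
  convert! h2 using 1
  rw [fracHeatKernel]; ring

/-- integration by parts against `r^(2s-1) e^{-t r^{2s}}` -/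
lemma aux_parts (s t : ℝ) (hs : s ∈ Ioo (0:ℝ) 1) (ht : 0 < t) (u u' : ℝ → ℝ) (hu0 : u 0 = 0)
    (C : ℝ) (hu : ∀ r, HasDerivAt u (u' r) r) (hub : ∀ r, 0 < r → |u r| ≤ C * r^(1:ℝ))
    (hu' : IntegrableOn (fun r => u' r * Real.exp (-(t * r^(2*s)))) (Ioi 0)) :
    ∫ r in Ioi (0:ℝ), u r * (r^(2*s-1) * Real.exp (-(t * r^(2*s)))) =
      (1/(2*s*t)) * ∫ r in Ioi (0:ℝ), u' r * Real.exp (-(t * r^(2*s))) := by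
  have hs0 := hs.1
  have huc : Continuous u := continuous_iff_continuousAt.2 fun r => (hu r).continuousAt
  have hC : 0 ≤ C := by have := (abs_nonneg _).trans (hub 1 one_pos); simpa using this
  have hlim1 : Tendsto (fun r : ℝ => r^(1:ℝ) * Real.exp (-(t * r^(2*s)))) atTop (nhds 0) := by
    have h1 : Tendsto (fun y : ℝ => y^(1/(2*s)) * Real.exp (-t * y)) atTop (nhds 0) :=
      tendsto_rpow_mul_exp_neg_mul_atTop_nhds_zero _ _ ht
    have h2 := h1.comp (tendsto_rpow_atTop (y := 2*s) (by linarith))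
    refine h2.congr' ?_
    filter_upwards [eventually_gt_atTop 0] with r hr
    simp only [Function.comp]
    rw [← rpow_mul hr.le]
    congr 2
    · field_simp
    · ring
  have key := integral_Ioi_mul_deriv_eq_deriv_mul (a := 0) (a' := (0:ℝ)) (b' := 0) (u := u) (u' := u')
    (v := fun r => Real.exp (-(t * r^(2*s))))
    (v' := fun r => -(2*s*t) * (r^(2*s-1) * Real.exp (-(t * r^(2*s))))) (fun r _ => hu r)
    (fun r hr => by
      have hr : 0 < r := hr
      have := (((Real.hasDerivAt_rpow_const (p := 2*s) (Or.inl hr.ne')).const_mul t).neg).exp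
      convert! this using 1
      simp only [Pi.neg_apply]
      ring)
    (by
      have := (intE_mul s t hs ht (2*s) C (by linarith) (fun r => u r * r^(2*s-1)) (by
        have := huc.measurable; fun_prop) (fun r hr => by
          rw [abs_mul, abs_of_nonneg (by positivity : 0 ≤ r^(2*s-1))]
          calc _ ≤ (C * r^(1:ℝ)) * r^(2*s-1) := mul_le_mul_of_nonneg_right (hub r hr) (by positivity)
            _ = C * r^(2*s) := by rw [mul_assoc, ← rpow_add hr]; ring_nf)).const_mul (-(2*s*t))
      refine this.congr (Eventually.of_forall fun r => ?_)
      simp only [Pi.mul_apply]; ring)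
    hu'
    (by
      have h1 : Tendsto u (nhdsWithin 0 (Ioi 0)) (nhds 0) := by
        have := huc.tendsto 0; rw [hu0] at this; exact this.mono_left nhdsWithin_le_nhds
      refine squeeze_zero_norm' (a := fun r => |u r|) ?_ (by simpa using h1.abs)
      filter_upwards [self_mem_nhdsWithin] with r hr
      have hr : 0 < r := hr
      rw [Pi.mul_apply, norm_mul, Real.norm_of_nonneg (Real.exp_pos _).le]
      refine mul_le_of_le_one_right (abs_nonneg _) (Real.exp_le_one_iff.2 ?_)
      have : 0 ≤ t * r^(2*s) := by positivity
      linarith)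
    (by
      refine squeeze_zero_norm' (a := fun r => C * (r^(1:ℝ) * Real.exp (-(t * r^(2*s))))) ?_
        (by simpa using hlim1.const_mul C)
      filter_upwards [eventually_gt_atTop 0] with r hr
      rw [Pi.mul_apply, norm_mul, Real.norm_of_nonneg (Real.exp_pos _).le, ← mul_assoc]
      exact mul_le_mul_of_nonneg_right (hub r hr) (Real.exp_pos _).le)
  have e : ∫ r in Ioi (0:ℝ), u r * (-(2*s*t) * (r^(2*s-1) * Real.exp (-(t * r^(2*s))))) =
      -(2*s*t) * ∫ r in Ioi (0:ℝ), u r * (r^(2*s-1) * Real.exp (-(t * r^(2*s)))) := by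
    rw [← integral_const_mul]; congr 1; ext r; ring
  rw [e] at key
  rw [sub_self, zero_sub] at key
  have hne : 2*s*t ≠ 0 := by positivity
  rw [one_div, eq_inv_mul_iff_mul_eq₀ hne]
  linarith

lemma lap_V (s t : ℝ) (hs : s ∈ Ioo (0:ℝ) 1) (ht : 0 < t) (x : ℝ) :
    IntegrableOn (fun y => (2 * layerV s t x - layerV s t (x+y) - layerV s t (x-y)) * y^(-1-2*s)) (Ioi 0) ∧
    fracLap s (layerV s t) x = x * fracHeatKernel s t x / (s*t) := by
  have hs0 := hs.1
  have h := aux_lap s hs Real.sin (fun r => (2/π) * (r⁻¹ * Real.exp (-(t * r^(2*s))))) (layerV s t)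
    Real.continuous_sin (fun a b => by rw [Real.sin_add, Real.sin_sub]; ring) (by fun_prop)
    (fun x => by
      refine (((intE_mul s t hs ht 0 |x| (by norm_num) (fun r => Real.sin (x*r) / r) (by fun_prop)
        (fun r hr => by simpa using abs_sin_div_le x r hr))).const_mul (2/π)).congr
        (Eventually.of_forall fun r => ?_)
      simp only [div_eq_mul_inv]; ring)
    x
    (by
      have := (intE_mul s t hs ht (2*s) |x| (by linarith) (fun r => Real.sin (x*r) / r * r^(2*s)) (by fun_prop)
        (fun r hr => by
          rw [abs_mul, abs_of_nonneg (by positivity : 0 ≤ r^(2*s))]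
          exact mul_le_mul_of_nonneg_right (abs_sin_div_le x r hr) (by positivity))).const_mul (2/π)
      refine this.congr (Eventually.of_forall fun r => ?_)
      simp only [div_eq_mul_inv]; ring)
    (fun x => by
      rw [layerV, ← integral_const_mul]
      congr 1; ext r; rw [div_eq_mul_inv (Real.sin _)]; ring)
  refine ⟨h.1, h.2.trans ?_⟩
  have hp := aux_parts s t hs ht (fun r => Real.sin (x*r)) (fun r => Real.cos (x*r) * x) (by simp) |x|
    (fun r => by
      have := ((hasDerivAt_id r).const_mul x).sin
      simpa using this)
    (fun r hr => by
      rw [rpow_one]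
      calc |Real.sin (x*r)| ≤ |x*r| := Real.abs_sin_le_abs
        _ = |x| * r := by rw [abs_mul, abs_of_pos hr])
    (intE_mul s t hs ht 0 |x| (by norm_num) _ (by fun_prop) (fun r hr => by
      rw [abs_mul, rpow_zero, mul_one]
      exact mul_le_of_le_one_left (abs_nonneg _) (Real.abs_cos_le_one _)))
  have e : ∫ r in Ioi (0:ℝ), Real.sin (x*r) * ((2/π) * (r⁻¹ * Real.exp (-(t * r^(2*s))))) * r^(2*s)
      = (2/π) * ∫ r in Ioi (0:ℝ), Real.sin (x*r) * (r^(2*s-1) * Real.exp (-(t * r^(2*s)))) := by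
    rw [← integral_const_mul]
    refine setIntegral_congr_fun measurableSet_Ioi (fun r hr => ?_)
    have hr : 0 < r := hr
    rw [rpow_sub hr, rpow_one]
    ring
  rw [e, hp, fracHeatKernel]
  have e2 : ∫ r in Ioi (0:ℝ), Real.cos (x*r) * x * Real.exp (-(t * r^(2*s))) =
      x * ∫ r in Ioi (0:ℝ), Real.cos (x*r) * Real.exp (-(t * r^(2*s))) := by
    rw [← integral_const_mul]; congr 1; ext r; ring
  rw [e2]
  field_simp

lemma lap_p (s t : ℝ) (hs : s ∈ Ioo (0:ℝ) 1) (ht : 0 < t) (x : ℝ) :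
    IntegrableOn (fun y => (2 * fracHeatKernel s t x - fracHeatKernel s t (x+y) - fracHeatKernel s t (x-y)) * y^(-1-2*s)) (Ioi 0) ∧
    fracLap s (fracHeatKernel s t) x = (fracHeatKernel s t x + x * pD s t x) / (2*s*t) := by
  have hs0 := hs.1
  have h := aux_lap s hs Real.cos (fun r => (1/π) * (Real.exp (-(t * r^(2*s))))) (fracHeatKernel s t)
    Real.continuous_cos (fun a b => by rw [Real.cos_add, Real.cos_sub]; ring) (by fun_prop)
    (fun x => by
      refine (((intE_mul s t hs ht 0 1 (by norm_num) (fun r => Real.cos (x*r)) (by fun_prop)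
        (fun r hr => by simpa using Real.abs_cos_le_one (x*r)))).const_mul (1/π)).congr
        (Eventually.of_forall fun r => ?_)
      simp only; ring)
    x
    (by
      have := (intE_mul s t hs ht (2*s) 1 (by linarith) (fun r => Real.cos (x*r) * r^(2*s)) (by fun_prop)
        (fun r hr => by
          rw [abs_mul, abs_of_nonneg (by positivity : 0 ≤ r^(2*s))]
          exact mul_le_mul_of_nonneg_right (Real.abs_cos_le_one _) (by positivity))).const_mul (1/π)
      refine this.congr (Eventually.of_forall fun r => ?_)
      simp only; ring)
    (fun x => by
      rw [fracHeatKernel, ← integral_const_mul]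
      congr 1; ext r; ring)
  refine ⟨h.1, h.2.trans ?_⟩
  have hc0 : IntegrableOn (fun r => Real.cos (x*r) * Real.exp (-(t * r^(2*s)))) (Ioi 0) :=
    intE_mul s t hs ht 0 1 (by norm_num) (fun r => Real.cos (x*r)) (by fun_prop)
        (fun r hr => by simpa using Real.abs_cos_le_one (x*r))
  have hs1 : IntegrableOn (fun r => (r * Real.sin (x*r)) * Real.exp (-(t * r^(2*s)))) (Ioi 0) :=
    intE_mul s t hs ht 1 1 (by norm_num) _ (by fun_prop)
        (fun r hr => by
          rw [abs_mul, abs_of_pos hr, one_mul, rpow_one]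
          exact mul_le_of_le_one_right hr.le (Real.abs_sin_le_one _))
  have e0 : ∀ r, (Real.cos (x*r) + r * (-Real.sin (x*r) * x)) * Real.exp (-(t * r^(2*s))) =
      Real.cos (x*r) * Real.exp (-(t * r^(2*s))) - x * ((r * Real.sin (x*r)) * Real.exp (-(t * r^(2*s)))) := by
    intro r; ring
  have hp := aux_parts s t hs ht (fun r => r * Real.cos (x*r)) (fun r => Real.cos (x*r) + r * (-Real.sin (x*r) * x)) (by simp) 1
    (fun r => by
      have := (hasDerivAt_id r).mul ((hasDerivAt_id r).const_mul x).cos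
      convert! this using 1
      simp)
    (fun r hr => by
      rw [rpow_one, abs_mul, abs_of_pos hr, one_mul]
      exact mul_le_of_le_one_right hr.le (Real.abs_cos_le_one _))
    (by
      simp only [e0]
      exact hc0.sub (hs1.const_mul x))
  have e : ∫ r in Ioi (0:ℝ), Real.cos (x*r) * ((1/π) * Real.exp (-(t * r^(2*s)))) * r^(2*s)
      = (1/π) * ∫ r in Ioi (0:ℝ), r * Real.cos (x*r) * (r^(2*s-1) * Real.exp (-(t * r^(2*s)))) := by
    rw [← integral_const_mul]
    refine setIntegral_congr_fun measurableSet_Ioi (fun r hr => ?_)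
    have hr : 0 < r := hr
    rw [rpow_sub hr, rpow_one]
    field_simp
  rw [e, hp, fracHeatKernel, pD]
  simp only [e0]
  rw [integral_sub hc0 (hs1.const_mul x), integral_const_mul]
  field_simp
  ring


/-- integrand on the ray of angle `θ` -/
noncomputable def rayE (s a ε θ u : ℝ) : ℂ :=
  Complex.exp (Complex.I * (θ * (a+1))) * ((u^a : ℝ) : ℂ) *
    Complex.exp (Complex.I * Complex.exp (Complex.I * θ) * u
      - ε * Complex.exp (Complex.I * (2*s*θ)) * ((u^(2*s) : ℝ) : ℂ))

lemma norm_rayE (s a ε θ u : ℝ) (hu : 0 < u) :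
    ‖rayE s a ε θ u‖ = u^a * Real.exp (-(Real.sin θ * u) - ε * Real.cos (2*s*θ) * u^(2*s)) := by
  rw [rayE, norm_mul, norm_mul, Complex.norm_exp, Complex.norm_exp]
  have h1 : (Complex.I * ((θ:ℂ) * (a+1))).re = 0 := by
    rw [show Complex.I * ((θ:ℂ) * (a+1)) = ((θ * (a+1) : ℝ) : ℂ) * Complex.I by push_cast; ring]
    simp
  have h2 : (Complex.I * Complex.exp (Complex.I * θ) * u
      - ε * Complex.exp (Complex.I * (2*s*θ)) * ((u^(2*s) : ℝ) : ℂ)).re =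
      -(Real.sin θ * u) - ε * Real.cos (2*s*θ) * u^(2*s) := by
    rw [mul_comm Complex.I (θ:ℂ), show Complex.I * (2*(s:ℂ)*θ) = ((2*s*θ:ℝ):ℂ) * Complex.I by push_cast; ring,
      Complex.sub_re, Complex.re_mul_ofReal, Complex.re_mul_ofReal, Complex.re_ofReal_mul,
      Complex.exp_ofReal_mul_I_re, Complex.I_mul_re, Complex.exp_ofReal_mul_I_im]
    ring
  rw [h1, h2, Real.exp_zero, one_mul, Complex.norm_real, Real.norm_of_nonneg (by positivity)]

lemma rayE_deriv_θ (s a ε θ u : ℝ) :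
    HasDerivAt (fun θ => rayE s a ε θ u)
      (Complex.I * ((a+1) + Complex.I * Complex.exp (Complex.I * θ) * u
        - 2*s*ε * Complex.exp (Complex.I * (2*s*θ)) * ((u^(2*s) : ℝ) : ℂ)) * rayE s a ε θ u) θ := by
  have hθ : HasDerivAt (fun θ : ℝ => (θ:ℂ)) 1 θ := Complex.ofRealCLM.hasDerivAt
  have h1 := ((hθ.mul_const ((a:ℂ)+1)).const_mul Complex.I).cexp
  have h2 := ((hθ.const_mul Complex.I).cexp.const_mul Complex.I).mul_const (u:ℂ)
  have h3 := (((hθ.const_mul (2*(s:ℂ))).const_mul Complex.I).cexp.const_mul (ε:ℂ)).mul_const ((u^(2*s) : ℝ) : ℂ)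
  have h := (h1.mul_const ((u^a : ℝ) : ℂ)).mul (h2.sub h3).cexp
  convert! h using 1
  simp only [rayE, Pi.sub_apply]
  ring

lemma rayE_deriv_u (s a ε θ u : ℝ) (hu : 0 < u) :
    HasDerivAt (fun u : ℝ => (u:ℂ) * rayE s a ε θ u)
      (((a+1) + Complex.I * Complex.exp (Complex.I * θ) * u
        - 2*s*ε * Complex.exp (Complex.I * (2*s*θ)) * ((u^(2*s) : ℝ) : ℂ)) * rayE s a ε θ u) u := by
  have h0 : HasDerivAt (fun u : ℝ => (u:ℂ)) 1 u := Complex.ofRealCLM.hasDerivAt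
  have ha : HasDerivAt (fun u : ℝ => ((u^a : ℝ) : ℂ)) ((a * u^(a-1) : ℝ) : ℂ) u :=
    (Real.hasDerivAt_rpow_const (p := a) (Or.inl hu.ne')).ofReal_comp
  have hs : HasDerivAt (fun u : ℝ => ((u^(2*s) : ℝ) : ℂ)) ((2*s * u^(2*s-1) : ℝ) : ℂ) u :=
    (Real.hasDerivAt_rpow_const (p := 2*s) (Or.inl hu.ne')).ofReal_comp
  have h := h0.mul ((ha.const_mul (Complex.exp (Complex.I * (θ * (a+1))))).mul
    ((h0.const_mul (Complex.I * Complex.exp (Complex.I * θ))).sub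
      (hs.const_mul (ε * Complex.exp (Complex.I * (2*s*θ))))).cexp)
  convert! h using 1
  rw [rpow_sub hu, rpow_sub hu, rpow_one]
  have hu' : (u:ℂ) ≠ 0 := by exact_mod_cast hu.ne'
  simp only [rayE, Pi.sub_apply, Pi.mul_apply]
  push_cast
  field_simp
  ring

lemma meas_rayE (s a ε θ : ℝ) : Measurable (fun u => rayE s a ε θ u) := by
  unfold rayE
  fun_prop

lemma int_stretch (c q b : ℝ) (hc : 0 < c) (hq : 0 < q) (hb : 0 ≤ b) :
    IntegrableOn (fun u : ℝ => u^b * Real.exp (-(c * u^q))) (Ioi 0) := by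
  have := integrableOn_rpow_mul_exp_neg_mul_rpow (p := q) (s := b) (b := c) (by linarith) hq hc
  simpa only [neg_mul] using this

lemma lim_stretch (c q b : ℝ) (hc : 0 < c) (hq : 0 < q) :
    Tendsto (fun r : ℝ => r^b * Real.exp (-(c * r^q))) atTop (nhds 0) := by
  have h1 : Tendsto (fun y : ℝ => y^(b/q) * Real.exp (-c * y)) atTop (nhds 0) :=
    tendsto_rpow_mul_exp_neg_mul_atTop_nhds_zero _ _ hc
  have h2 := h1.comp (tendsto_rpow_atTop (y := q) hq)
  refine h2.congr' ?_
  filter_upwards [eventually_gt_atTop 0] with r hr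
  simp only [Function.comp]
  rw [← rpow_mul hr.le]
  congr 2
  · field_simp
  · ring

lemma rotate (s a ε θ₀ θ₁ c q : ℝ) (hs : 0 < s) (ha : 0 ≤ a) (hθ : θ₀ < θ₁) (hc : 0 < c) (hq : 0 < q)
    (hb : ∀ θ ∈ Icc θ₀ θ₁, ∀ u, 0 < u → ‖rayE s a ε θ u‖ ≤ u^a * Real.exp (-(c * u^q))) :
    (∫ u in Ioi (0:ℝ), rayE s a ε θ₀ u).re = (∫ u in Ioi (0:ℝ), rayE s a ε θ₁ u).re := by
  set bd : ℝ → ℝ := fun u => (a+1) * (u^a * Real.exp (-(c * u^q))) + u^(1+a) * Real.exp (-(c * u^q))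
    + 2*s*|ε| * (u^(2*s+a) * Real.exp (-(c * u^q))) with hbd
  have hbdi : IntegrableOn bd (Ioi 0) :=
    (((int_stretch c q a hc hq ha).const_mul _).add (int_stretch c q (1+a) hc hq (by linarith))).add
      ((int_stretch c q (2*s+a) hc hq (by linarith)).const_mul _)
  have hdb : ∀ θ ∈ Icc θ₀ θ₁, ∀ u, 0 < u → ‖((a+1) + Complex.I * Complex.exp (Complex.I * θ) * u
        - 2*s*ε * Complex.exp (Complex.I * (2*s*θ)) * ((u^(2*s) : ℝ) : ℂ)) * rayE s a ε θ u‖ ≤ bd u := by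
    intro θ hθ u hu
    have n1 : ‖((a:ℂ)+1) + Complex.I * Complex.exp (Complex.I * θ) * u
        - 2*s*ε * Complex.exp (Complex.I * (2*s*θ)) * ((u^(2*s) : ℝ) : ℂ)‖ ≤ (a+1) + u + 2*s*|ε| * u^(2*s) := by
      refine (norm_sub_le _ _).trans (add_le_add ((norm_add_le _ _).trans (add_le_add ?_ ?_)) ?_)
      · rw [show (a:ℂ)+1 = ((a+1:ℝ):ℂ) by push_cast; ring, Complex.norm_real, Real.norm_of_nonneg (by linarith)]
      · rw [norm_mul, norm_mul, Complex.norm_I, mul_comm Complex.I, Complex.norm_exp_ofReal_mul_I, Complex.norm_real,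
          Real.norm_of_nonneg hu.le]; simp
      · rw [show Complex.I * (2*(s:ℂ)*θ) = ((2*s*θ:ℝ):ℂ) * Complex.I by push_cast; ring, norm_mul, norm_mul,
          Complex.norm_exp_ofReal_mul_I, show (2*(s:ℂ)*ε) = ((2*s*ε:ℝ):ℂ) by push_cast; ring, Complex.norm_real,
          Complex.norm_real, Real.norm_of_nonneg (by positivity : 0 ≤ u^(2*s)), mul_one, Real.norm_eq_abs, abs_mul,
          abs_of_pos (by positivity : 0 < 2*s)]
    rw [norm_mul]
    calc _ ≤ ((a+1) + u + 2*s*|ε| * u^(2*s)) * (u^a * Real.exp (-(c * u^q))) :=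
          mul_le_mul n1 (hb θ hθ u hu) (norm_nonneg _) (by positivity)
      _ = bd u := by
        simp only [hbd]; rw [rpow_add hu, rpow_add hu, rpow_one]; ring
  have hInt : ∀ θ ∈ Icc θ₀ θ₁, IntegrableOn (fun u => rayE s a ε θ u) (Ioi 0) := by
    intro θ hθ
    refine Integrable.mono' (int_stretch c q a hc hq ha) (meas_rayE s a ε θ).aestronglyMeasurable ?_
    filter_upwards [ae_restrict_mem measurableSet_Ioi] with u hu using hb θ hθ u hu
  set G : ℝ → ℂ := fun θ => ∫ u in Ioi (0:ℝ), rayE s a ε θ u with hG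
  have hcont : ContinuousOn G (Icc θ₀ θ₁) := by
    refine continuousOn_of_dominated (bound := fun u => u^a * Real.exp (-(c * u^q)))
      (fun θ _ => (meas_rayE s a ε θ).aestronglyMeasurable) (fun θ hθ => ?_) (int_stretch c q a hc hq ha) ?_
    · filter_upwards [ae_restrict_mem measurableSet_Ioi] with u hu using hb θ hθ u hu
    · filter_upwards with u
      exact (continuous_iff_continuousAt.2 fun θ => (rayE_deriv_θ s a ε θ u).continuousAt).continuousOn
  have hder : ∀ θ ∈ Ioo θ₀ θ₁, HasDerivAt G 0 θ := by
    intro θ hθ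
    have hθ' := Ioo_subset_Icc_self hθ
    have hm : AEStronglyMeasurable (fun u : ℝ => ((a+1) + Complex.I * Complex.exp (Complex.I * θ) * u
        - 2*s*ε * Complex.exp (Complex.I * (2*s*θ)) * ((u^(2*s) : ℝ) : ℂ)) * rayE s a ε θ u) (volume.restrict (Ioi 0)) := by
      have := meas_rayE s a ε θ
      exact Measurable.aestronglyMeasurable (by fun_prop)
    have h := hasDerivAt_integral_of_dominated_loc_of_deriv_le (μ := volume.restrict (Ioi (0:ℝ))) (x₀ := θ)
      (s := Icc θ₀ θ₁) (F := fun θ u => rayE s a ε θ u)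
      (F' := fun θ u => (Complex.I * ((a+1) + Complex.I * Complex.exp (Complex.I * θ) * u
        - 2*s*ε * Complex.exp (Complex.I * (2*s*θ)) * ((u^(2*s) : ℝ) : ℂ)) * rayE s a ε θ u))
      (bound := bd) (Icc_mem_nhds hθ.1 hθ.2)
      (Eventually.of_forall fun θ => (meas_rayE s a ε θ).aestronglyMeasurable)
      (hInt θ hθ')
      (by simp only [mul_assoc]; simp only [mul_assoc] at hm; exact hm.const_mul _)
      (by
        filter_upwards [ae_restrict_mem measurableSet_Ioi] with u hu θ hθ
        rw [mul_assoc, norm_mul, Complex.norm_I, one_mul]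
        exact hdb θ hθ u hu)
      hbdi
      (by
        filter_upwards with u θ _ using rayE_deriv_θ s a ε θ u)
    have hz : ∫ u in Ioi (0:ℝ), (((a:ℂ)+1) + Complex.I * Complex.exp (Complex.I * θ) * u
        - 2*s*ε * Complex.exp (Complex.I * (2*s*θ)) * ((u^(2*s) : ℝ) : ℂ)) * rayE s a ε θ u = 0 := by
      have hi : IntegrableOn (fun u : ℝ => (((a:ℂ)+1) + Complex.I * Complex.exp (Complex.I * θ) * u
        - 2*s*ε * Complex.exp (Complex.I * (2*s*θ)) * ((u^(2*s) : ℝ) : ℂ)) * rayE s a ε θ u) (Ioi 0) := by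
        refine Integrable.mono' hbdi hm ?_
        filter_upwards [ae_restrict_mem measurableSet_Ioi] with u hu using hdb θ hθ' u hu
      have hn : ∀ u : ℝ, 0 < u → ‖(u:ℂ) * rayE s a ε θ u‖ ≤ u^(1+a) * Real.exp (-(c * u^q)) := by
        intro u hu
        rw [norm_mul, Complex.norm_real, Real.norm_of_nonneg hu.le, rpow_add hu, rpow_one, mul_assoc]
        exact mul_le_mul_of_nonneg_left (hb θ hθ' u hu) hu.le
      have := integral_Ioi_of_hasDerivAt_of_tendsto (a := 0) (m := (0:ℂ)) (f := fun u : ℝ => (u:ℂ) * rayE s a ε θ u)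
        (by
          rw [ContinuousWithinAt]
          simp only [Complex.ofReal_zero, zero_mul]
          refine squeeze_zero_norm' (a := fun u : ℝ => u^(1+a)) ?_ ?_
          · filter_upwards [self_mem_nhdsWithin] with u hu
            rcases eq_or_lt_of_le (show (0:ℝ) ≤ u from hu) with h | h
            · rw [← h]; simpa using rpow_nonneg le_rfl (1+a)
            · refine (hn u h).trans (mul_le_of_le_one_right (by positivity) (Real.exp_le_one_iff.2 ?_))
              have : 0 ≤ c * u^q := by positivity
              linarith
          · have : ContinuousAt (fun u : ℝ => u^(1+a)) 0 :=
              Real.continuousAt_rpow_const _ _ (Or.inr (by linarith))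
            have h := this.tendsto
            rw [zero_rpow (by linarith)] at h
            exact h.mono_left nhdsWithin_le_nhds)
        (fun u hu => rayE_deriv_u s a ε θ u hu) hi
        (by
          refine squeeze_zero_norm' (a := fun u : ℝ => u^(1+a) * Real.exp (-(c * u^q))) ?_ (lim_stretch c q (1+a) hc hq)
          filter_upwards [eventually_gt_atTop 0] with u hu using hn u hu)
      rw [this]; simp
    have h2 := h.2
    simp only [mul_assoc] at h2 hz
    rw [integral_const_mul, hz, mul_zero] at h2
    exact h2
  have hcr : ContinuousOn (fun θ => (G θ).re) (Icc θ₀ θ₁) := Complex.continuous_re.comp_continuousOn hcont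
  have hdr : ∀ θ ∈ Ioo θ₀ θ₁, HasDerivAt (fun θ => (G θ).re) 0 θ := by
    intro θ hθ
    have := (Complex.reCLM.hasFDerivAt.comp_hasDerivAt θ (hder θ hθ))
    simpa [Function.comp_def] using this
  obtain ⟨z, hz, hz2⟩ := exists_hasDerivAt_eq_slope _ _ hθ hcr hdr
  have : θ₁ - θ₀ ≠ 0 := by linarith
  rw [eq_div_iff this] at hz2
  simp only [hG] at hz2
  linarith

noncomputable def rayR (s a ε : ℝ) : ℝ := (∫ u in Ioi (0:ℝ), rayE s a ε (π/4) u).re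

lemma rayE_bound (s a ε u : ℝ) (hs : s ∈ Ioo (0:ℝ) 1) (hε : 0 ≤ ε) (hu : 0 < u) :
    ‖rayE s a ε (π/4) u‖ ≤ u^a * Real.exp (-(Real.sin (π/4) * u^(1:ℝ))) := by
  rw [norm_rayE _ _ _ _ _ hu, rpow_one]
  refine mul_le_mul_of_nonneg_left (Real.exp_le_exp.2 ?_) (by positivity)
  have : 0 ≤ Real.cos (2*s*(π/4)) := by
    apply Real.cos_nonneg_of_mem_Icc
    constructor <;> nlinarith [hs.1, hs.2, Real.pi_pos]
  have : 0 ≤ ε * Real.cos (2*s*(π/4)) * u^(2*s) := by positivity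
  linarith

lemma sin_pi4_pos : 0 < Real.sin (π/4) := by
  apply Real.sin_pos_of_pos_of_lt_pi <;> linarith [Real.pi_pos]

lemma rayE_int (s a ε : ℝ) (hs : s ∈ Ioo (0:ℝ) 1) (ha : 0 ≤ a) (hε : 0 ≤ ε) :
    IntegrableOn (fun u => rayE s a ε (π/4) u) (Ioi 0) := by
  refine Integrable.mono' (int_stretch (Real.sin (π/4)) 1 a sin_pi4_pos one_pos ha) (meas_rayE _ _ _ _).aestronglyMeasurable ?_
  filter_upwards [ae_restrict_mem measurableSet_Ioi] with u hu using rayE_bound s a ε u hs hε hu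

lemma rayE_deriv_ε (s a ε θ u : ℝ) (hu : 0 < u) :
    HasDerivAt (fun ε => rayE s a ε θ u) (-(rayE s (a+2*s) ε θ u)) ε := by
  have h0 : HasDerivAt (fun u : ℝ => (u:ℂ)) 1 ε := Complex.ofRealCLM.hasDerivAt
  have h := (((h0.mul_const (Complex.exp (Complex.I * (2*s*θ)))).mul_const ((u^(2*s) : ℝ) : ℂ)).const_sub
    (Complex.I * Complex.exp (Complex.I * θ) * u)).cexp.const_mul
    (Complex.exp (Complex.I * (θ * (a+1))) * ((u^a : ℝ) : ℂ))
  convert! h using 1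
  simp only [rayE]
  rw [rpow_add hu]
  push_cast
  rw [show Complex.I * (θ * ((a:ℂ)+2*s+1)) = Complex.I * (θ * (a+1)) + Complex.I * (2*s*θ) by ring, Complex.exp_add]
  ring

lemma rayR_deriv (s a ε : ℝ) (hs : s ∈ Ioo (0:ℝ) 1) (ha : 0 ≤ a) (hε : 0 < ε) :
    HasDerivAt (rayR s a) (-(rayR s (a+2*s) ε)) ε := by
  have hs0 := hs.1
  have h := hasDerivAt_integral_of_dominated_loc_of_deriv_le (μ := volume.restrict (Ioi (0:ℝ))) (x₀ := ε)
      (s := Ioi 0) (F := fun ε u => rayE s a ε (π/4) u)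
      (F' := fun ε u => -rayE s (a+2*s) ε (π/4) u)
      (bound := fun u => u^(a+2*s) * Real.exp (-(Real.sin (π/4) * u^(1:ℝ)))) (Ioi_mem_nhds hε)
      (Eventually.of_forall fun ε => (meas_rayE _ _ _ _).aestronglyMeasurable)
      (rayE_int s a ε hs ha hε.le)
      ((meas_rayE _ _ _ _).neg.aestronglyMeasurable)
      (by
        filter_upwards [ae_restrict_mem measurableSet_Ioi] with u hu ε hε
        rw [norm_neg]
        exact rayE_bound s _ ε u hs (le_of_lt hε) hu)
      (int_stretch _ 1 _ sin_pi4_pos one_pos (by linarith))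
      (by
        filter_upwards [ae_restrict_mem measurableSet_Ioi] with u hu ε _ using rayE_deriv_ε s a ε (π/4) u hu)
  have h2 := (Complex.reCLM.hasFDerivAt.comp_hasDerivAt ε h.2)
  rw [integral_neg] at h2
  simp [Function.comp_def] at h2
  exact h2

lemma rayR_cont (s a : ℝ) (hs : s ∈ Ioo (0:ℝ) 1) (ha : 0 ≤ a) : ContinuousOn (rayR s a) (Ici 0) := by
  refine Complex.continuous_re.comp_continuousOn ?_
  refine continuousOn_of_dominated (bound := fun u => u^a * Real.exp (-(Real.sin (π/4) * u^(1:ℝ))))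
      (fun θ _ => (meas_rayE _ _ _ _).aestronglyMeasurable) (fun ε hε => ?_) (int_stretch _ 1 a sin_pi4_pos one_pos ha) ?_
  · filter_upwards [ae_restrict_mem measurableSet_Ioi] with u hu using rayE_bound s a ε u hs hε hu
  · filter_upwards [ae_restrict_mem measurableSet_Ioi] with u hu
    exact (continuous_iff_continuousAt.2 fun ε => (rayE_deriv_ε s a ε _ u hu).continuousAt).continuousOn

lemma rayR_zero (s a : ℝ) (hs : s ∈ Ioo (0:ℝ) 1) (ha : 0 ≤ a) :
    rayR s a 0 = -Real.sin (π*a/2) * Real.Gamma (a+1) := by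
  have h := rotate s a 0 (π/4) (π/2) (Real.sin (π/4)) 1 hs.1 ha (by linarith [Real.pi_pos]) sin_pi4_pos one_pos
    (fun θ hθ u hu => by
      rw [norm_rayE _ _ _ _ _ hu, rpow_one]
      refine mul_le_mul_of_nonneg_left (Real.exp_le_exp.2 ?_) (by positivity)
      have : Real.sin (π/4) ≤ Real.sin θ :=
        Real.sin_le_sin_of_le_of_le_pi_div_two (by linarith [Real.pi_pos]) hθ.2 hθ.1
      nlinarith)
  rw [rayR, h]
  have e : ∀ u ∈ Ioi (0:ℝ), rayE s a 0 (π/2) u =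
      Complex.exp ((π/2*(a+1) : ℝ) * Complex.I) * ((Real.exp (-u) * u^((a+1)-1) : ℝ) : ℂ) := by
    intro u hu
    rw [rayE]
    have : Complex.exp (Complex.I * ((π/2:ℝ):ℂ)) = Complex.I := by
      rw [mul_comm]; push_cast; exact Complex.exp_pi_div_two_mul_I
    rw [this, Complex.I_mul_I, add_sub_cancel_right]
    push_cast
    simp only [zero_mul, sub_zero, neg_one_mul]
    rw [mul_comm Complex.I]
    ring
  rw [setIntegral_congr_fun measurableSet_Ioi e, integral_const_mul, integral_complex_ofReal,
    ← Real.Gamma_eq_integral (by linarith), Complex.re_mul_ofReal, Complex.exp_ofReal_mul_I_re]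
  congr 1
  rw [show π/2*(a+1) = π*a/2 + π/2 by ring, Real.cos_add_pi_div_two]

lemma rayR_phi (s ε : ℝ) (hs : s ∈ Ioo (0:ℝ) 1) (hε : 0 < ε) :
    ∫ u in Ioi (0:ℝ), Real.cos u * Real.exp (-(ε * u^(2*s))) = rayR s 0 ε := by
  have hcpos : 0 < Real.cos (s*π/2) := by
    apply Real.cos_pos_of_mem_Ioo
    constructor <;> nlinarith [hs.1, hs.2, Real.pi_pos]
  have h := rotate s 0 ε 0 (π/4) (ε * Real.cos (s*π/2)) (2*s) hs.1 le_rfl (by linarith [Real.pi_pos]) (by positivity)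
    (by linarith [hs.1])
    (fun θ hθ u hu => by
      rw [norm_rayE _ _ _ _ _ hu]
      refine mul_le_mul_of_nonneg_left (Real.exp_le_exp.2 ?_) (by positivity)
      have h1 : 0 ≤ Real.sin θ :=
        Real.sin_nonneg_of_nonneg_of_le_pi hθ.1 (by linarith [hθ.2, Real.pi_pos])
      have h2 : Real.cos (s*π/2) ≤ Real.cos (2*s*θ) := by
        apply Real.cos_le_cos_of_nonneg_of_le_pi
        · nlinarith [hs.1, hθ.1]
        · nlinarith [hs.2, Real.pi_pos]
        · nlinarith [hs.1, hθ.2]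
      have h3 : 0 ≤ Real.sin θ * u := by positivity
      have h4 : ε * Real.cos (s*π/2) * u^(2*s) ≤ ε * Real.cos (2*s*θ) * u^(2*s) := by gcongr
      linarith)
  rw [rayR, ← h]
  have e : ∀ u ∈ Ioi (0:ℝ), (rayE s 0 ε 0 u).re = Real.cos u * Real.exp (-(ε * u^(2*s))) := by
    intro u hu
    rw [rayE]
    simp only [Complex.ofReal_zero, zero_mul, mul_zero, Complex.exp_zero, rpow_zero, Complex.ofReal_one, mul_one, one_mul]
    rw [sub_eq_add_neg, Complex.exp_add, show -((ε:ℂ) * ((u^(2*s):ℝ):ℂ)) = ((-(ε * u^(2*s)) : ℝ):ℂ) by push_cast; ring,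
      ← Complex.ofReal_exp, Complex.re_mul_ofReal, mul_comm Complex.I, Complex.exp_ofReal_mul_I_re]
  have hint : IntegrableOn (fun u => rayE s 0 ε 0 u) (Ioi 0) := by
    refine Integrable.mono' (int_stretch ε (2*s) 0 hε (by linarith [hs.1]) le_rfl) (meas_rayE _ _ _ _).aestronglyMeasurable ?_
    filter_upwards [ae_restrict_mem measurableSet_Ioi] with u hu
    rw [norm_rayE _ _ _ _ _ hu]
    simp
  have h3 := Complex.reCLM.integral_comp_comm hint
  simp only [Complex.reCLM_apply] at h3
  rw [← h3]
  exact (setIntegral_congr_fun measurableSet_Ioi e).symm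

/-- `p(x)` in terms of the rotated integral -/
lemma p_eq (s t x : ℝ) (hs : s ∈ Ioo (0:ℝ) 1) (ht : 0 < t) (hx : 0 < x) :
    fracHeatKernel s t x = rayR s 0 (t * x^(-(2*s))) / (π * x) := by
  rw [← rayR_phi s _ hs (by positivity), fracHeatKernel]
  have := integral_comp_mul_left_Ioi (fun u => Real.cos u * Real.exp (-(t * x^(-(2*s)) * u^(2*s)))) 0 hx
  rw [mul_zero] at this
  have e : ∀ r ∈ Ioi (0:ℝ), Real.cos (x*r) * Real.exp (-(t * x^(-(2*s)) * (x*r)^(2*s))) =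
      Real.cos (x*r) * Real.exp (-(t * r^(2*s))) := by
    intro r hr
    have hr : 0 < r := hr
    rw [Real.mul_rpow hx.le hr.le, rpow_neg hx.le]
    have : x^(2*s) ≠ 0 := by positivity
    congr 3
    field_simp
  rw [setIntegral_congr_fun measurableSet_Ioi e] at this
  rw [this, smul_eq_mul]
  field_simp


lemma rayR_tend (s a : ℝ) (hs : s ∈ Ioo (0:ℝ) 1) (ha : 0 ≤ a) :
    Tendsto (rayR s a) (nhdsWithin 0 (Ioi 0)) (nhds (rayR s a 0)) :=
  ((rayR_cont s a hs ha) 0 self_mem_Ici).mono_left (nhdsWithin_mono _ Ioi_subset_Ici_self)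

lemma rayR_zero0 (s : ℝ) (hs : s ∈ Ioo (0:ℝ) 1) : rayR s 0 0 = 0 := by
  rw [rayR_zero s 0 hs le_rfl]; simp

lemma phi_lim1 (s : ℝ) (hs : s ∈ Ioo (0:ℝ) 1) :
    Tendsto (fun ε => rayR s 0 ε / ε) (nhdsWithin 0 (Ioi 0)) (nhds (-rayR s (2*s) 0)) := by
  refine HasDerivAt.lhopital_zero_nhdsGT (f' := fun ε => -rayR s (2*s) ε) (g' := fun _ => 1) ?_ ?_ ?_ ?_ ?_ ?_
  · filter_upwards [self_mem_nhdsWithin] with ε hε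
    simpa using rayR_deriv s 0 ε hs le_rfl hε
  · exact Eventually.of_forall fun ε => hasDerivAt_id ε
  · simp
  · have := rayR_tend s 0 hs le_rfl
    rwa [rayR_zero0 s hs] at this
  · exact tendsto_id.mono_left nhdsWithin_le_nhds
  · simpa using (rayR_tend s (2*s) hs (by linarith [hs.1])).neg

lemma phi_lim2 (s : ℝ) (hs : s ∈ Ioo (0:ℝ) 1) :
    Tendsto (fun ε => (ε * (-rayR s (2*s) ε) - rayR s 0 ε) / ε^2) (nhdsWithin 0 (Ioi 0))
      (nhds (rayR s (4*s) 0 / 2)) := by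
  have h2 := rayR_tend s (2*s) hs (by linarith [hs.1])
  have h0 := rayR_tend s 0 hs le_rfl
  rw [rayR_zero0 s hs] at h0
  have hid : Tendsto (fun ε : ℝ => ε) (nhdsWithin 0 (Ioi 0)) (nhds 0) := tendsto_id.mono_left nhdsWithin_le_nhds
  refine HasDerivAt.lhopital_zero_nhdsGT (f' := fun ε => ε * rayR s (4*s) ε) (g' := fun ε => 2 * ε) ?_ ?_ ?_ ?_ ?_ ?_
  · filter_upwards [self_mem_nhdsWithin] with ε hε
    have h1 := rayR_deriv s 0 ε hs le_rfl hε
    have h2 := rayR_deriv s (2*s) ε hs (by linarith [hs.1]) hε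
    rw [zero_add] at h1
    rw [show 2*s + 2*s = 4*s by ring] at h2
    refine (((hasDerivAt_id ε).mul h2.neg).sub h1).congr_deriv ?_
    show 1 * -rayR s (2*s) ε + ε * -(-rayR s (4*s) ε) - -rayR s (2*s) ε = _
    ring
  · refine Eventually.of_forall fun ε => ?_
    simpa using hasDerivAt_pow 2 ε
  · filter_upwards [self_mem_nhdsWithin] with ε hε
    exact mul_ne_zero two_ne_zero (ne_of_gt hε)
  · simpa using (hid.mul h2.neg).sub h0
  · simpa using hid.pow 2
  · have := (rayR_tend s (4*s) hs (by linarith [hs.1])).div_const 2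
    refine this.congr' ?_
    filter_upwards [self_mem_nhdsWithin] with ε hε
    have : ε ≠ 0 := ne_of_gt hε
    field_simp

lemma eps_tend (s t : ℝ) (hs : s ∈ Ioo (0:ℝ) 1) (ht : 0 < t) :
    Tendsto (fun x : ℝ => t * x^(-(2*s))) atTop (nhdsWithin 0 (Ioi 0)) := by
  refine tendsto_nhdsWithin_iff.2 ⟨?_, ?_⟩
  · simpa using (tendsto_rpow_neg_atTop (y := 2*s) (by linarith [hs.1])).const_mul t
  · filter_upwards [eventually_gt_atTop 0] with x hx
    exact mul_pos ht (rpow_pos_of_pos hx _)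

lemma p_cont (s t : ℝ) (hs : s ∈ Ioo (0:ℝ) 1) (ht : 0 < t) : Continuous (fracHeatKernel s t) :=
  continuous_iff_continuousAt.2 fun x => (deriv_p s t hs ht x).continuousAt

lemma V_cont (s t : ℝ) (hs : s ∈ Ioo (0:ℝ) 1) (ht : 0 < t) : Continuous (layerV s t) :=
  continuous_iff_continuousAt.2 fun x => (deriv_V s t hs ht x).continuousAt

lemma p_even (s t x : ℝ) : fracHeatKernel s t (-x) = fracHeatKernel s t x := by
  simp [fracHeatKernel]

lemma V_odd (s t x : ℝ) : layerV s t (-x) = -layerV s t x := by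
  simp only [layerV, neg_mul, Real.sin_neg, neg_div, integral_neg, mul_neg]

lemma pD_odd (s t x : ℝ) : pD s t (-x) = -pD s t x := by
  simp only [pD, neg_mul, Real.sin_neg, mul_neg, integral_neg]

lemma p_tend (s t : ℝ) (hs : s ∈ Ioo (0:ℝ) 1) (ht : 0 < t) :
    Tendsto (fracHeatKernel s t) atTop (nhds 0) := by
  have h0 := rayR_tend s 0 hs le_rfl
  rw [rayR_zero0 s hs] at h0
  have h1 := h0.comp (eps_tend s t hs ht)
  have h2 := h1.mul ((tendsto_inv_atTop_zero (𝕜 := ℝ)).div_const π)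
  rw [zero_mul] at h2
  refine h2.congr' ?_
  filter_upwards [eventually_gt_atTop 0] with x hx
  rw [p_eq s t x hs ht hx]
  simp only [Function.comp]
  field_simp

lemma p_bigO (s t : ℝ) (hs : s ∈ Ioo (0:ℝ) 1) (ht : 0 < t) :
    fracHeatKernel s t =O[atTop] fun x : ℝ => x^(-(1+2*s)) := by
  have h1 := (phi_lim1 s hs).comp (eps_tend s t hs ht)
  have h2 := (h1.isBigO_one ℝ).mul (Asymptotics.isBigO_refl (fun x : ℝ => (t/π) * x^(-(1+2*s))) atTop)
  have h3 : (fun x : ℝ => (1:ℝ) * ((t/π) * x^(-(1+2*s)))) =O[atTop] fun x : ℝ => x^(-(1+2*s)) := by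
    simpa using Asymptotics.isBigO_const_mul_self (t/π) (fun x : ℝ => x^(-(1+2*s))) atTop
  refine (h2.trans h3).congr' ?_ EventuallyEq.rfl
  filter_upwards [eventually_gt_atTop 0] with x hx
  rw [p_eq s t x hs ht hx]
  simp only [Function.comp]
  have : x^(-(1+2*s)) = x^(-(2*s)) / x := by
    rw [← rpow_sub_one hx.ne']; ring_nf
  rw [this]
  have h4 : x^(-(2*s)) ≠ 0 := (rpow_pos_of_pos hx _).ne'
  field_simp

lemma p_int (s t : ℝ) (hs : s ∈ Ioo (0:ℝ) 1) (ht : 0 < t) : Integrable (fracHeatKernel s t) := by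
  refine LocallyIntegrable.integrable_of_isBigO_atTop_of_norm_isNegInvariant
    (p_cont s t hs ht).locallyIntegrable ?_ (p_bigO s t hs ht) (integrableAtFilter_rpow_atTop_iff.2 (by linarith [hs.1]))
  refine Eventually.of_forall fun x => ?_
  simp [p_even]

lemma e_cont (s t : ℝ) (hs : s ∈ Ioo (0:ℝ) 1) : Continuous (fun r : ℝ => Real.exp (-(t * |r|^(2*s)))) := by
  have : Continuous (fun r : ℝ => |r|^(2*s)) := continuous_abs.rpow_const (fun _ => Or.inr (by linarith [hs.1]))
  fun_prop

lemma e_int (s t : ℝ) (hs : s ∈ Ioo (0:ℝ) 1) (ht : 0 < t) :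
    Integrable (fun r : ℝ => Real.exp (-(t * |r|^(2*s)))) := by
  refine LocallyIntegrable.integrable_of_isBigO_atTop_of_norm_isNegInvariant (g := fun r : ℝ => r^(-2:ℝ))
    (e_cont s t hs).locallyIntegrable ?_ ?_ (integrableAtFilter_rpow_atTop_iff.2 (by norm_num))
  · refine Eventually.of_forall fun x => ?_
    simp
  · have h := (lim_stretch t (2*s) 2 ht (by linarith [hs.1])).isBigO_one ℝ
    have h2 := h.mul (Asymptotics.isBigO_refl (fun x : ℝ => x^(-2:ℝ)) atTop)
    refine h2.congr' ?_ (by simp)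
    filter_upwards [eventually_gt_atTop 0] with x hx
    have : x^(2:ℝ) * x^(-2:ℝ) = 1 := by rw [← rpow_add hx]; norm_num
    rw [abs_of_pos hx]
    linear_combination Real.exp (-(t * x^(2*s))) * this

open FourierTransform in
lemma fourier_e (s t : ℝ) (hs : s ∈ Ioo (0:ℝ) 1) (ht : 0 < t) (ξ : ℝ) :
    𝓕 (fun r : ℝ => ((Real.exp (-(t * |r|^(2*s))) : ℝ) : ℂ)) ξ = ((2 * π * fracHeatKernel s t ((2*π) * ξ) : ℝ) : ℂ) := by
  rw [Real.fourier_real_eq_integral_exp_smul]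
  set F : ℝ → ℂ := fun v => Complex.exp (((-2 * π * v * ξ : ℝ) : ℂ) * Complex.I) • ((Real.exp (-(t * |v|^(2*s))) : ℝ) : ℂ) with hF
  have hFi : Integrable F := by
    refine Integrable.mono' (e_int s t hs ht) ?_ ?_
    · have := e_cont s t hs
      apply Continuous.aestronglyMeasurable
      fun_prop
    · refine Eventually.of_forall fun v => ?_
      simp only [F]
      rw [smul_eq_mul, norm_mul, Complex.norm_exp_ofReal_mul_I, one_mul, Complex.norm_real, Real.norm_of_nonneg (by positivity)]
  have h1 : ∫ v, F (-v) = ∫ v, F v := integral_neg_eq_self F volume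
  have h2 : ∫ v, (F v + F (-v)) = (∫ v, F v) + ∫ v, F (-v) := integral_add hFi hFi.comp_neg
  have h3 : ∀ v, F v + F (-v) = ((2 * (Real.cos ((2*π*ξ) * |v|) * Real.exp (-(t * |v|^(2*s)))) : ℝ) : ℂ) := by
    intro v
    simp only [F, smul_eq_mul, abs_neg]
    rw [← add_mul]
    have e : Complex.exp (((-2 * π * v * ξ : ℝ) : ℂ) * Complex.I) + Complex.exp (((-2 * π * (-v) * ξ : ℝ) : ℂ) * Complex.I)
        = ((2 * Real.cos ((2*π*ξ) * |v|) : ℝ) : ℂ) := by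
      have : Real.cos ((2*π*ξ) * |v|) = Real.cos (2*π*v*ξ) := by
        rcases abs_cases v with ⟨h, -⟩ | ⟨h, -⟩ <;> rw [h]
        · ring_nf
        · rw [← Real.cos_neg]; ring_nf
      rw [this]
      push_cast
      rw [Complex.cos]
      ring_nf
    rw [e]
    push_cast
    ring
  have h4 : ∫ v, F v = ((∫ v : ℝ, Real.cos ((2*π*ξ) * |v|) * Real.exp (-(t * |v|^(2*s))) : ℝ) : ℂ) := by
    simp_rw [h3] at h2
    rw [integral_complex_ofReal, integral_const_mul, h1] at h2
    push_cast at h2 ⊢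
    linear_combination -h2/2
  rw [h4]
  congr 1
  rw [integral_comp_abs (f := fun v => Real.cos ((2*π*ξ) * v) * Real.exp (-(t * v^(2*s)))), fracHeatKernel]
  field_simp

open FourierTransform in
lemma p_total (s t : ℝ) (hs : s ∈ Ioo (0:ℝ) 1) (ht : 0 < t) : ∫ x, fracHeatKernel s t x = 1 := by
  have h2π : (2*π) ≠ 0 := by positivity
  have hF : 𝓕 (fun r : ℝ => ((Real.exp (-(t * |r|^(2*s))) : ℝ) : ℂ)) = fun ξ => ((2 * π * fracHeatKernel s t ((2*π) * ξ) : ℝ) : ℂ) :=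
    funext (fourier_e s t hs ht)
  have hc := e_cont s t hs
  have h := Integrable.fourierInv_fourier_eq (f := fun r : ℝ => ((Real.exp (-(t * |r|^(2*s))) : ℝ) : ℂ))
    (e_int s t hs ht).ofReal (by
      rw [hF]
      exact ((((integrable_comp_mul_left_iff _ h2π).2 (p_int s t hs ht)).const_mul (2*π)).ofReal)) (v := 0)
    (by apply Continuous.continuousAt; fun_prop)
  rw [hF, Real.fourierInv_eq'] at h
  simp only [inner_zero_right, mul_zero, Complex.ofReal_zero, zero_mul, Complex.exp_zero, one_smul] at h
  rw [integral_complex_ofReal, integral_const_mul, Measure.integral_comp_mul_left] at h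
  have h0 : (2*s) ≠ 0 := by linarith [hs.1]
  simp only [abs_zero, zero_rpow h0, mul_zero, neg_zero, Real.exp_zero] at h
  have h := Complex.ofReal_injective h
  rw [abs_of_pos (by positivity), smul_eq_mul] at h
  rwa [mul_inv_cancel_left₀ h2π] at h

lemma p_half (s t : ℝ) (hs : s ∈ Ioo (0:ℝ) 1) (ht : 0 < t) : ∫ x in Ioi 0, fracHeatKernel s t x = 1/2 := by
  have h := integral_comp_abs (f := fracHeatKernel s t)
  have : ∀ x, fracHeatKernel s t |x| = fracHeatKernel s t x := by
    intro x
    rcases abs_cases x with ⟨h, -⟩ | ⟨h, -⟩ <;> rw [h]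
    rw [p_even]
  simp_rw [this] at h
  rw [p_total s t hs ht] at h
  linarith

lemma V_zero (s t : ℝ) : layerV s t 0 = 0 := by simp [layerV]

lemma V_top (s t : ℝ) (hs : s ∈ Ioo (0:ℝ) 1) (ht : 0 < t) : Tendsto (layerV s t) atTop (nhds 1) := by
  have h := (intervalIntegral_tendsto_integral_Ioi 0 (p_int s t hs ht).integrableOn tendsto_id).const_mul 2
  rw [p_half s t hs ht] at h
  norm_num at h
  refine h.congr fun x => ?_
  have := intervalIntegral.integral_eq_sub_of_hasDerivAt (a := 0) (b := x) (fun y _ => deriv_V s t hs ht y)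
    ((p_cont s t hs ht).const_mul 2 |>.intervalIntegrable _ _)
  rw [V_zero, sub_zero, intervalIntegral.integral_const_mul] at this
  exact this

lemma V_bot (s t : ℝ) (hs : s ∈ Ioo (0:ℝ) 1) (ht : 0 < t) : Tendsto (layerV s t) atBot (nhds (-1)) := by
  have := ((V_top s t hs ht).comp tendsto_neg_atBot_atTop).neg
  refine this.congr fun x => ?_
  simp [V_odd]


lemma max_princ (s : ℝ) (φ : ℝ → ℝ) (hφ : Continuous φ) (h0 : ∀ y, 0 < y → 0 ≤ φ y)
    (hi : IntegrableOn (fun y => φ y * y^(-1-2*s)) (Ioi 0)) (hz : ∫ y in Ioi (0:ℝ), φ y * y^(-1-2*s) = 0) :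
    ∀ y, 0 < y → φ y = 0 := by
  have h1 := (setIntegral_eq_zero_iff_of_nonneg_ae (by
    filter_upwards [ae_restrict_mem measurableSet_Ioi] with y hy
    exact mul_nonneg (h0 y hy) (rpow_pos_of_pos hy _).le) hi).1 hz
  have hc : ContinuousOn (fun y => φ y * y^(-1-2*s)) (Ioi 0) :=
    hφ.continuousOn.mul (continuousOn_id.rpow_const fun y hy => Or.inl (ne_of_gt hy))
  have h2 := Measure.eqOn_open_of_ae_eq h1 isOpen_Ioi hc continuousOn_const
  intro y hy
  have h3 := h2 hy
  simp only [Pi.zero_apply] at h3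
  exact (mul_eq_zero.1 h3).resolve_right (rpow_pos_of_pos hy _).ne'

lemma coef_ne (s : ℝ) (hs : s ∈ Ioo (0:ℝ) 1) : fracLapCoef s ≠ 0 := by
  intro h
  have := (aux_J s hs).2
  rw [h] at this
  simp at this

lemma V_lap_zero (s t x : ℝ) (hs : s ∈ Ioo (0:ℝ) 1) (ht : 0 < t) (hp : fracHeatKernel s t x = 0) :
    ∫ y in Ioi (0:ℝ), (2*layerV s t x - layerV s t (x+y) - layerV s t (x-y)) * y^(-1-2*s) = 0 := by
  have := (lap_V s t hs ht x).2
  rw [hp, fracLap] at this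
  simpa [coef_ne s hs] using this

lemma p_zero_of_ext (s t x : ℝ) (hs : s ∈ Ioo (0:ℝ) 1) (ht : 0 < t) (h : IsLocalExtr (layerV s t) x) :
    fracHeatKernel s t x = 0 := by
  have := h.hasDerivAt_eq_zero (deriv_V s t hs ht x)
  linarith

lemma V_shift_top (s t c : ℝ) (hs : s ∈ Ioo (0:ℝ) 1) (ht : 0 < t) :
    Tendsto (fun y => layerV s t (c+y)) atTop (nhds 1) :=
  (V_top s t hs ht).comp (tendsto_atTop_add_const_left _ c tendsto_id)

lemma V_shift_bot (s t c : ℝ) (hs : s ∈ Ioo (0:ℝ) 1) (ht : 0 < t) :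
    Tendsto (fun y => layerV s t (c-y)) atTop (nhds (-1)) := by
  refine (V_bot s t hs ht).comp ?_
  exact (tendsto_atBot_add_const_left atTop c tendsto_neg_atTop_atBot).congr fun y => (sub_eq_add_neg c y).symm

lemma V_le_one (s t : ℝ) (hs : s ∈ Ioo (0:ℝ) 1) (ht : 0 < t) (x : ℝ) : layerV s t x ≤ 1 := by
  by_contra hx
  rw [not_le] at hx
  have hc := V_cont s t hs ht
  obtain ⟨x0, h0⟩ := hc.exists_forall_ge' x (by
    rw [cocompact_eq_atBot_atTop]
    refine eventually_sup.2 ⟨?_, ?_⟩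
    · exact ((V_bot s t hs ht).eventually (eventually_lt_nhds (by linarith))).mono fun y hy => hy.le
    · exact ((V_top s t hs ht).eventually (eventually_lt_nhds hx)).mono fun y hy => hy.le)
  have hp := p_zero_of_ext s t x0 hs ht (Or.inr (Eventually.of_forall h0))
  have h1 := max_princ s (fun y => 2*layerV s t x0 - layerV s t (x0+y) - layerV s t (x0-y)) (by fun_prop)
    (fun y _ => by have := h0 (x0+y); have := h0 (x0-y); linarith) (lap_V s t hs ht x0).1 (V_lap_zero s t x0 hs ht hp)
  have h2 := ((tendsto_const_nhds (x := 2*layerV s t x0)).sub (V_shift_top s t x0 hs ht)).sub (V_shift_bot s t x0 hs ht)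
  have h3 : Tendsto (fun y => 2*layerV s t x0 - layerV s t (x0+y) - layerV s t (x0-y)) atTop (nhds 0) := by
    refine tendsto_const_nhds.congr' ?_
    filter_upwards [eventually_gt_atTop 0] with y hy using (h1 y hy).symm
  have h4 := tendsto_nhds_unique h2 h3
  have := h0 x
  linarith

lemma V_ge (s t : ℝ) (hs : s ∈ Ioo (0:ℝ) 1) (ht : 0 < t) (x : ℝ) : -1 ≤ layerV s t x := by
  have := V_le_one s t hs ht (-x)
  rw [V_odd] at this
  linarith

lemma V_mono (s t : ℝ) (hs : s ∈ Ioo (0:ℝ) 1) (ht : 0 < t) : Monotone (layerV s t) := by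
  by_contra hm
  simp only [Monotone, not_forall, not_le] at hm
  obtain ⟨a, b, hab, hV⟩ := hm
  have hc := V_cont s t hs ht
  set G : ℝ × ℝ → ℝ := fun q => layerV s t (max q.1 q.2) - layerV s t (min q.1 q.2) with hG
  have hGc : Continuous G := by fun_prop
  have hGab : G (a,b) = layerV s t b - layerV s t a := by simp [G, hab]
  obtain ⟨M1, hM1⟩ := eventually_atTop.1 ((V_top s t hs ht).eventually
    (eventually_gt_nhds (show 1 + G (a,b) < 1 by linarith)))
  obtain ⟨M2, hM2⟩ := eventually_atBot.1 ((V_bot s t hs ht).eventually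
    (eventually_lt_nhds (show -1 < -1 - G (a,b) by linarith)))
  obtain ⟨q, hq⟩ := hGc.exists_forall_le' (a,b) (by
    have : IsCompact (Icc M2 M1 ×ˢ Icc M2 M1) := isCompact_Icc.prod isCompact_Icc
    filter_upwards [this.compl_mem_cocompact] with q hq
    by_cases h1 : M1 ≤ max q.1 q.2
    · have := hM1 _ h1
      have := V_le_one s t hs ht (min q.1 q.2)
      simp only [G] at *
      linarith
    by_cases h2 : min q.1 q.2 ≤ M2
    · have := hM2 _ h2
      have := V_ge s t hs ht (max q.1 q.2)
      simp only [G] at *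
      linarith
    exfalso
    rw [not_le] at h1 h2
    apply hq
    simp only [max_lt_iff, lt_min_iff] at h1 h2
    exact ⟨⟨h2.1.le, h1.1.le⟩, ⟨h2.2.le, h1.2.le⟩⟩)
  have hmin : ∀ y z, y ≤ z → layerV s t (max q.1 q.2) - layerV s t (min q.1 q.2) ≤ layerV s t z - layerV s t y := by
    intro y z hyz
    have := hq (y,z)
    simpa [G, hyz] using this
  have hneg : layerV s t (max q.1 q.2) - layerV s t (min q.1 q.2) < 0 := by
    have := hq (a,b)
    simp only [hGab] at this
    simp only [G] at this
    linarith
  have hle : min q.1 q.2 ≤ max q.1 q.2 := min_le_max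
  generalize max q.1 q.2 = z at *
  generalize min q.1 q.2 = y at *
  have hlt : y < z := lt_of_le_of_ne hle (by rintro rfl; simp at hneg)
  have hpz : fracHeatKernel s t z = 0 := by
    refine p_zero_of_ext s t z hs ht (Or.inl ?_)
    filter_upwards [eventually_gt_nhds hlt] with w hw
    have := hmin y w hw.le
    linarith
  have hpy : fracHeatKernel s t y = 0 := by
    refine p_zero_of_ext s t y hs ht (Or.inr ?_)
    filter_upwards [eventually_lt_nhds hlt] with w hw
    have := hmin w z hw.le
    linarith
  have e : ∀ r : ℝ, ((2*layerV s t y - layerV s t (y+r) - layerV s t (y-r)) -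
      (2*layerV s t z - layerV s t (z+r) - layerV s t (z-r))) * r^(-1-2*s) =
      (2*layerV s t y - layerV s t (y+r) - layerV s t (y-r)) * r^(-1-2*s) -
      (2*layerV s t z - layerV s t (z+r) - layerV s t (z-r)) * r^(-1-2*s) := fun r => sub_mul _ _ _
  have h1 := max_princ s (fun r => (2*layerV s t y - layerV s t (y+r) - layerV s t (y-r)) -
      (2*layerV s t z - layerV s t (z+r) - layerV s t (z-r))) (by fun_prop)
    (fun r _ => by
      have := hmin (y+r) (z+r) (by linarith)
      have := hmin (y-r) (z-r) (by linarith)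
      linarith)
    (by simp only [e]; exact (lap_V s t hs ht y).1.sub (lap_V s t hs ht z).1)
    (by
      simp only [e]
      rw [integral_sub (lap_V s t hs ht y).1 (lap_V s t hs ht z).1, V_lap_zero s t y hs ht hpy, V_lap_zero s t z hs ht hpz, sub_zero])
  have h2 := (((tendsto_const_nhds (x := 2*layerV s t y)).sub (V_shift_top s t y hs ht)).sub (V_shift_bot s t y hs ht)).sub
    (((tendsto_const_nhds (x := 2*layerV s t z)).sub (V_shift_top s t z hs ht)).sub (V_shift_bot s t z hs ht))
  have h3 : Tendsto (fun r => (2*layerV s t y - layerV s t (y+r) - layerV s t (y-r)) -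
      (2*layerV s t z - layerV s t (z+r) - layerV s t (z-r))) atTop (nhds 0) := by
    refine tendsto_const_nhds.congr' ?_
    filter_upwards [eventually_gt_atTop 0] with y hy using (h1 y hy).symm
  have h4 := tendsto_nhds_unique h2 h3
  linarith

lemma p_nonneg (s t : ℝ) (hs : s ∈ Ioo (0:ℝ) 1) (ht : 0 < t) (x : ℝ) : 0 ≤ fracHeatKernel s t x := by
  have h : 0 ≤ deriv (layerV s t) x := (V_mono s t hs ht).deriv_nonneg
  rw [(deriv_V s t hs ht x).deriv] at h
  linarith

lemma p_zero_pos (s t : ℝ) (hs : s ∈ Ioo (0:ℝ) 1) (ht : 0 < t) : 0 < fracHeatKernel s t 0 := by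
  have hi := intE s t hs ht 0 (by norm_num)
  simp only [rpow_zero, one_mul] at hi
  have : 0 < ∫ r in Ioi (0:ℝ), Real.exp (-(t * r^(2*s))) := by
    rw [setIntegral_pos_iff_support_of_nonneg_ae (Eventually.of_forall fun r => (Real.exp_pos _).le) hi]
    have : Function.support (fun r : ℝ => Real.exp (-(t * r^(2*s)))) = univ := by
      ext r; simp [(Real.exp_pos _).ne']
    rw [this]; simp
  rw [fracHeatKernel]
  simp only [zero_mul, Real.cos_zero, one_mul]
  positivity

lemma p_pos (s t : ℝ) (hs : s ∈ Ioo (0:ℝ) 1) (ht : 0 < t) (x : ℝ) : 0 < fracHeatKernel s t x := by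
  refine lt_of_le_of_ne (p_nonneg s t hs ht x) fun h => ?_
  have hx0 := h.symm
  have hne : x ≠ 0 := by
    rintro rfl
    exact (p_zero_pos s t hs ht).ne' hx0
  have hd : pD s t x = 0 := by
    refine IsLocalExtr.hasDerivAt_eq_zero (Or.inl (Eventually.of_forall fun y => ?_)) (deriv_p s t hs ht x)
    rw [hx0]; exact p_nonneg s t hs ht y
  have hl := lap_p s t hs ht x
  have hz := hl.2
  rw [hx0, hd, fracLap] at hz
  have hz' : ∫ y in Ioi (0:ℝ), (2*fracHeatKernel s t x - fracHeatKernel s t (x+y) - fracHeatKernel s t (x-y)) * y^(-1-2*s) = 0 := by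
    simpa [coef_ne s hs, hx0] using hz
  have hc := p_cont s t hs ht
  have h1 := max_princ s (fun y => -(2*fracHeatKernel s t x - fracHeatKernel s t (x+y) - fracHeatKernel s t (x-y)))
    (by fun_prop) (fun y _ => by
      have := p_nonneg s t hs ht (x+y)
      have := p_nonneg s t hs ht (x-y)
      linarith)
    (by simp only [neg_mul]; exact hl.1.neg)
    (by simp only [neg_mul]; rw [integral_neg, hz', neg_zero])
  have h2 := h1 |x| (abs_pos.2 hne)
  have h3 := p_nonneg s t hs ht (x+|x|)
  have h4 := p_nonneg s t hs ht (x-|x|)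
  have h5 := p_zero_pos s t hs ht
  rcases abs_cases x with ⟨h, -⟩ | ⟨h, -⟩
  · rw [h, sub_self] at h2 h4
    rw [h] at h3
    linarith
  · rw [h, show x + -x = 0 by ring] at h2
    rw [h] at h4
    linarith

lemma V_smono (s t : ℝ) (hs : s ∈ Ioo (0:ℝ) 1) (ht : 0 < t) : StrictMono (layerV s t) := by
  refine strictMono_of_deriv_pos fun x => ?_
  rw [(deriv_V s t hs ht x).deriv]
  linarith [p_pos s t hs ht x]


lemma abstract_f (V v g g1 : ℝ → ℝ) (A L : ℝ) (hV : ∀ x, HasDerivAt V (v x) x) (hv : ∀ x, 0 < v x)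
    (hodd : ∀ x, V (-x) = -V x) (htop : Tendsto V atTop (nhds 1)) (hbot : Tendsto V atBot (nhds (-1)))
    (hg : ∀ x, HasDerivAt g (v x * g1 x) x) (hgodd : ∀ x, g (-x) = -g x) (hg1 : Continuous g1)
    (hg1e : ∀ x, g1 (-x) = g1 x) (hgpos : ∀ x, 0 < x → 0 < g x)
    (hg0 : Tendsto g atTop (nhds 0)) (hgA : Tendsto g1 atTop (nhds A))
    (hL : Tendsto (fun x => (g1 x - A) / (V x - 1)) atTop (nhds L)) :
    ∃ (f f' : ℝ → ℝ),
      Continuous f ∧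
      (∀ r : ℝ, f (-r) = -f r) ∧
      f 0 = 0 ∧ f 1 = 0 ∧
      (∀ r ∈ Set.Ioo (0:ℝ) 1, 0 < f r) ∧
      ContinuousOn f' (Set.Icc (-1) 1) ∧
      (∀ r ∈ Set.Icc (-1:ℝ) 1, HasDerivWithinAt f (f' r) (Set.Icc (-1) 1) r) ∧
      f' (-1) = A ∧ f' 1 = A ∧
      (∀ x : ℝ, g x = f (V x)) ∧
      HasDerivWithinAt f' L (Set.Icc (-1) 1) 1 := by
  have hVm : StrictMono V := strictMono_of_deriv_pos fun x => by rw [(hV x).deriv]; exact hv x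
  have hVc : Continuous V := continuous_iff_continuousAt.2 fun x => (hV x).continuousAt
  have hlt : ∀ x, V x < 1 := fun x => lt_of_lt_of_le (hVm (lt_add_one x)) (hVm.monotone.ge_of_tendsto htop _)
  have hgt : ∀ x, -1 < V x := fun x => by
    have := hlt (-x); rw [hodd] at this; linarith
  have hV0 : V 0 = 0 := by have := hodd 0; simp at this; linarith
  obtain ⟨X, hX⟩ : ∃ X, X = Function.invFun V := ⟨_, rfl⟩
  have hXV : ∀ x, X (V x) = x := by rw [hX]; exact Function.leftInverse_invFun hVm.injective
  have hVX : ∀ r ∈ Ioo (-1:ℝ) 1, V (X r) = r := by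
    intro r hr
    obtain ⟨a, ha⟩ := (hbot.eventually (eventually_lt_nhds hr.1)).exists
    obtain ⟨b, hb⟩ := (htop.eventually (eventually_gt_nhds hr.2)).exists
    have : ∃ x, V x = r := mem_range_of_exists_le_of_exists_ge hVc ⟨a, ha.le⟩ ⟨b, hb.le⟩
    rw [hX]; exact Function.invFun_eq this
  have hXm : StrictMonoOn X (Ioo (-1:ℝ) 1) := by
    intro a ha b hb hab
    rw [← hVm.lt_iff_lt, hVX a ha, hVX b hb]; exact hab
  have hXim : X '' (Ioo (-1:ℝ) 1) = univ := by
    refine eq_univ_of_forall fun x => ⟨V x, ⟨hgt x, hlt x⟩, hXV x⟩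
  have hXc : ∀ r ∈ Ioo (-1:ℝ) 1, ContinuousAt X r := fun r hr =>
    hXm.continuousAt_of_image_mem_nhds (Ioo_mem_nhds hr.1 hr.2) (by rw [hXim]; exact univ_mem)
  have hXtop : Tendsto X (nhdsWithin 1 (Iio 1)) atTop := by
    refine tendsto_atTop.2 fun M => ?_
    filter_upwards [Ioo_mem_nhdsLT (hlt M)] with r hr
    have hr' : r ∈ Ioo (-1:ℝ) 1 := ⟨(hgt M).trans hr.1, hr.2⟩
    rw [← hVm.le_iff_le, hVX r hr']; exact hr.1.le
  have hXd : ∀ r ∈ Ioo (-1:ℝ) 1, HasDerivAt X (v (X r))⁻¹ r := fun r hr =>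
    HasDerivAt.of_local_left_inverse (hXc r hr) (hV _) (hv _).ne'
      (by filter_upwards [Ioo_mem_nhds hr.1 hr.2] with y hy using hVX y hy)
  have hXodd : ∀ r ∈ Ioo (-1:ℝ) 1, X (-r) = -X r := by
    intro r hr
    rw [← hXV (-X r), hodd, hVX r hr]
  obtain ⟨f, hf⟩ : ∃ f : ℝ → ℝ, f = fun r => if |r| < 1 then g (X r) else 0 := ⟨_, rfl⟩
  obtain ⟨f', hf'⟩ : ∃ f' : ℝ → ℝ, f' = fun r => if |r| < 1 then g1 (X r) else A := ⟨_, rfl⟩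
  have hfi : ∀ r ∈ Ioo (-1:ℝ) 1, f r = g (X r) := fun r hr => by rw [hf]; simp [abs_lt.2 hr]
  have hfo : ∀ r, 1 ≤ |r| → f r = 0 := fun r hr => by rw [hf]; simp [not_lt.2 hr]
  have hfi' : ∀ r ∈ Ioo (-1:ℝ) 1, f' r = g1 (X r) := fun r hr => by rw [hf']; simp [abs_lt.2 hr]
  have hfo' : ∀ r, 1 ≤ |r| → f' r = A := fun r hr => by rw [hf']; simp [not_lt.2 hr]
  have hfd : ∀ r ∈ Ioo (-1:ℝ) 1, HasDerivAt f (f' r) r := by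
    intro r hr
    have h := (hg (X r)).comp r (hXd r hr)
    rw [hfi' r hr]
    refine (h.congr_of_eventuallyEq ?_).congr_deriv ?_
    · filter_upwards [Ioo_mem_nhds hr.1 hr.2] with y hy using hfi y hy
    · have := (hv (X r)).ne'
      field_simp
  have hfc' : ∀ r ∈ Ioo (-1:ℝ) 1, ContinuousAt f' r := by
    intro r hr
    refine (hg1.continuousAt.comp (hXc r hr)).congr ?_
    filter_upwards [Ioo_mem_nhds hr.1 hr.2] with y hy using (hfi' y hy).symm
  have hnear : Ioo (-1:ℝ) 1 ∈ nhdsWithin 1 (Iio 1) := Ioo_mem_nhdsLT (by norm_num)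
  have hft : Tendsto f (nhdsWithin 1 (Iio 1)) (nhds 0) := by
    refine (hg0.comp hXtop).congr' ?_
    filter_upwards [hnear] with y hy using (hfi y hy).symm
  have hft' : Tendsto f' (nhdsWithin 1 (Iio 1)) (nhds A) := by
    refine (hgA.comp hXtop).congr' ?_
    filter_upwards [hnear] with y hy using (hfi' y hy).symm
  have hneg : ∀ r : ℝ, r ∈ Ioo (-1:ℝ) 1 → -r ∈ Ioo (-1:ℝ) 1 := fun r hr => ⟨by linarith [hr.2], by linarith [hr.1]⟩
  have hfodd : ∀ r, f (-r) = -f r := by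
    intro r
    by_cases hr : |r| < 1
    · have hr := abs_lt.1 hr
      rw [hfi r hr, hfi (-r) (hneg r hr), hXodd r hr, hgodd]
    · rw [not_lt] at hr
      rw [hfo r hr, hfo (-r) (by rwa [abs_neg]), neg_zero]
  have hfe' : ∀ r, f' (-r) = f' r := by
    intro r
    by_cases hr : |r| < 1
    · have hr := abs_lt.1 hr
      rw [hfi' r hr, hfi' (-r) (hneg r hr), hXodd r hr, hg1e]
    · rw [not_lt] at hr
      rw [hfo' r hr, hfo' (-r) (by rwa [abs_neg])]
  have hf1 : f 1 = 0 := hfo 1 (by simp)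
  have hf1' : f' 1 = A := hfo' 1 (by simp)
  have hc1 : ContinuousAt f 1 := by
    refine continuousAt_iff_continuous_left'_right'.2 ⟨?_, ?_⟩
    · rw [ContinuousWithinAt, hf1]; exact hft
    · rw [ContinuousWithinAt, hf1]
      refine tendsto_const_nhds.congr' ?_
      filter_upwards [self_mem_nhdsWithin] with y hy
      have hy : 1 < y := hy
      exact (hfo y (hy.le.trans (le_abs_self y))).symm
  have hfc : Continuous f := by
    refine continuous_iff_continuousAt.2 fun r => ?_
    rcases lt_trichotomy |r| 1 with h | h | h
    · exact (hfd r (abs_lt.1 h)).continuousAt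
    · rcases (abs_eq zero_le_one).1 h with rfl | rfl
      · exact hc1
      · have : f = fun r => -f (-r) := by funext r; rw [hfodd]; ring
        rw [this]
        refine ContinuousAt.neg (ContinuousAt.comp (g := f) ?_ continuous_neg.continuousAt)
        simpa using hc1
    · refine (continuousAt_const (y := (0:ℝ))).congr ?_
      filter_upwards [(continuous_abs.tendsto r).eventually (eventually_gt_nhds h)] with y hy
      exact (hfo y hy.le).symm
  have hmaps : MapsTo (fun r : ℝ => -r) (Icc (-1) 1) (Icc (-1) 1) := fun r hr => ⟨by linarith [hr.2], by linarith [hr.1]⟩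
  have hc1' : ContinuousWithinAt f' (Icc (-1) 1) 1 := by
    have : ContinuousWithinAt f' (Iio 1) 1 := by rw [ContinuousWithinAt, hf1']; exact hft'
    exact (continuousWithinAt_Iio_iff_Iic.1 this).mono Icc_subset_Iic_self
  have hcon' : ContinuousOn f' (Icc (-1) 1) := by
    intro r hr
    rcases eq_or_ne r 1 with rfl | h1
    · exact hc1'
    rcases eq_or_ne r (-1) with rfl | h2
    · have : f' = fun r => f' (-r) := by funext r; rw [hfe']
      rw [this]
      refine ContinuousWithinAt.comp (g := f') (t := Icc (-1) 1) ?_ continuous_neg.continuousWithinAt hmaps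
      simpa using hc1'
    · exact (hfc' r ⟨lt_of_le_of_ne hr.1 (Ne.symm h2), lt_of_le_of_ne hr.2 h1⟩).continuousWithinAt
  have hd1 : HasDerivWithinAt f A (Icc (-1) 1) 1 := by
    refine (hasDerivWithinAt_Iic_of_tendsto_deriv (s := Ioo (-1) 1) (f := f)
      (fun r hr => (hfd r hr).differentiableAt.differentiableWithinAt) hfc.continuousWithinAt hnear ?_).mono Icc_subset_Iic_self
    refine hft'.congr' ?_
    filter_upwards [hnear] with r hr using (hfd r hr).deriv.symm
  refine ⟨f, f', hfc, hfodd, ?_, hf1, ?_, hcon', ?_, ?_, hf1', ?_, ?_⟩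
  · have := hfodd 0; simp at this; linarith
  · intro r hr
    have hr' : r ∈ Ioo (-1:ℝ) 1 := ⟨by linarith [hr.1], hr.2⟩
    rw [hfi r hr']
    refine hgpos _ ?_
    rw [← hVm.lt_iff_lt, hVX r hr', hV0]; exact hr.1
  · intro r hr
    rcases eq_or_ne r 1 with rfl | h1
    · rw [hf1']; exact hd1
    rcases eq_or_ne r (-1) with rfl | h2
    · have : f = fun r => -f (-r) := by funext r; rw [hfodd]; ring
      rw [hfe', hf1']
      have hh : HasDerivWithinAt f A (Icc (-1) 1) (-(-1)) := by simpa using hd1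
      have h3 := (HasDerivWithinAt.comp (-1) hh (hasDerivAt_neg (-1:ℝ)).hasDerivWithinAt hmaps).neg
      rw [this]
      refine h3.congr_deriv ?_
      ring
    · exact (hfd r ⟨lt_of_le_of_ne hr.1 (Ne.symm h2), lt_of_le_of_ne hr.2 h1⟩).hasDerivWithinAt
  · rw [hfe', hf1']
  · intro x
    rw [hfi (V x) ⟨hgt x, hlt x⟩, hXV]
  · rw [hasDerivWithinAt_iff_tendsto_slope]
    refine Tendsto.mono_left ?_ (nhdsWithin_mono _ (t := Iio 1) ?_)
    · refine (hL.comp hXtop).congr' ?_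
      filter_upwards [hnear] with r hr
      simp only [Function.comp]
      rw [slope_def_field, hfi' r hr, hf1', hVX r hr]
    · rintro r ⟨hr, h1⟩
      exact lt_of_le_of_ne hr.2 h1


lemma eps_deriv (s t x : ℝ) (hx : 0 < x) :
    HasDerivAt (fun x : ℝ => t * x^(-(2*s))) (-(2*s) * (t * x^(-(2*s))) / x) x := by
  refine ((Real.hasDerivAt_rpow_const (p := -(2*s)) (Or.inl hx.ne')).const_mul t).congr_deriv ?_
  rw [rpow_sub_one hx.ne']
  ring

lemma pD_eq (s t x : ℝ) (hs : s ∈ Ioo (0:ℝ) 1) (ht : 0 < t) (hx : 0 < x) :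
    pD s t x = -(2*s*(t * x^(-(2*s))) * (-rayR s (2*s) (t * x^(-(2*s)))) + rayR s 0 (t * x^(-(2*s)))) / (π * x^2) := by
  have hε : 0 < t * x^(-(2*s)) := mul_pos ht (rpow_pos_of_pos hx _)
  have h1 := (rayR_deriv s 0 _ hs le_rfl hε).comp x (eps_deriv s t x hx)
  have h2 := h1.div ((hasDerivAt_id x).const_mul π) (by simp [hx.ne', Real.pi_ne_zero])
  have h3 : HasDerivAt (fracHeatKernel s t) _ x := h2.congr_of_eventuallyEq (by
    filter_upwards [eventually_gt_nhds hx] with y hy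
    exact p_eq s t y hs ht hy)
  rw [(deriv_p s t hs ht x).unique h3]
  simp only [Function.comp, id, zero_add]
  have := Real.pi_ne_zero
  field_simp
  ring

lemma V_lim (s t : ℝ) (hs : s ∈ Ioo (0:ℝ) 1) (ht : 0 < t) :
    Tendsto (fun x => (layerV s t x - 1) / (t * x^(-(2*s)))) atTop (nhds (-(-rayR s (2*s) 0) / (π * s))) := by
  have hs0 := hs.1
  refine HasDerivAt.lhopital_zero_atTop (f' := fun x => 2 * fracHeatKernel s t x)
    (g' := fun x : ℝ => -(2*s) * (t * x^(-(2*s))) / x) ?_ ?_ ?_ ?_ ?_ ?_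
  · exact Eventually.of_forall fun x => (deriv_V s t hs ht x).sub_const 1
  · filter_upwards [eventually_gt_atTop 0] with x hx using eps_deriv s t x hx
  · filter_upwards [eventually_gt_atTop 0] with x hx
    have := rpow_pos_of_pos hx (-(2*s))
    have : 0 < (2*s) * (t * x^(-(2*s))) / x := by positivity
    rw [neg_mul, neg_div]
    linarith
  · simpa using (V_top s t hs ht).sub_const 1
  · exact (eps_tend s t hs ht).mono_right nhdsWithin_le_nhds
  · have h := (((phi_lim1 s hs).comp (eps_tend s t hs ht)).neg).div_const (π * s)
    refine h.congr' ?_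
    filter_upwards [eventually_gt_atTop 0] with x hx
    have := (rpow_pos_of_pos hx (-(2*s))).ne'
    rw [p_eq s t x hs ht hx]
    simp only [Function.comp]
    have := Real.pi_ne_zero
    field_simp

lemma g1_eq (s t x : ℝ) (hs : s ∈ Ioo (0:ℝ) 1) (ht : 0 < t) (hx : 0 < x) :
    (1/(2*s*t)) * (1 + x * pD s t x / fracHeatKernel s t x) =
      -(1/t) * ((t * x^(-(2*s))) * (-rayR s (2*s) (t * x^(-(2*s)))) / rayR s 0 (t * x^(-(2*s)))) ∧
      rayR s 0 (t * x^(-(2*s))) ≠ 0 := by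
  have hs0 := hs.1
  have hp := p_pos s t hs ht x
  have hpe := p_eq s t x hs ht hx
  have hΦ : rayR s 0 (t * x^(-(2*s))) ≠ 0 := by
    intro h
    rw [h, zero_div] at hpe
    exact hp.ne' hpe
  refine ⟨?_, hΦ⟩
  rw [pD_eq s t x hs ht hx, hpe]
  generalize rayR s 0 (t * x^(-(2*s))) = P at *
  generalize rayR s (2*s) (t * x^(-(2*s))) = Q at *
  generalize t * x^(-(2*s)) = e at *
  have := Real.pi_ne_zero
  field_simp
  ring

/-- `v^t_s` is a layer solution for an odd nonlinearity `f^t_s ∈ C¹([-1,1])`,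
with the stated values of `f'(±1)` and `f''(1)`. -/
theorem statement9 (s t : ℝ) (hs : s ∈ Set.Ioo (0:ℝ) 1) (ht : 0 < t) :
    ∃ (f f' : ℝ → ℝ),
      Continuous f ∧
      (∀ r : ℝ, f (-r) = -f r) ∧
      f 0 = 0 ∧ f 1 = 0 ∧
      (∀ r ∈ Set.Ioo (0:ℝ) 1, 0 < f r) ∧
      ContinuousOn f' (Set.Icc (-1) 1) ∧
      (∀ r ∈ Set.Icc (-1:ℝ) 1, HasDerivWithinAt f (f' r) (Set.Icc (-1) 1) r) ∧
      f' (-1) = -(1/t) ∧ f' 1 = -(1/t) ∧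
      (∀ x : ℝ, fracLap s (layerV s t) x = f (layerV s t x)) ∧
      HasDerivWithinAt f'
        (-(π/t) * (Real.cos (π*s) / Real.sin (π*s)) * Real.Gamma (4*s) / (Real.Gamma (2*s))^2)
        (Set.Icc (-1) 1) 1 ∧
      (s < 1/2 →
        -(π/t) * (Real.cos (π*s) / Real.sin (π*s)) * Real.Gamma (4*s) / (Real.Gamma (2*s))^2 < 0) ∧
      (s = 1/2 →
        -(π/t) * (Real.cos (π*s) / Real.sin (π*s)) * Real.Gamma (4*s) / (Real.Gamma (2*s))^2 = 0) ∧
      (1/2 < s →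
        0 < -(π/t) * (Real.cos (π*s) / Real.sin (π*s)) * Real.Gamma (4*s) / (Real.Gamma (2*s))^2) := by
  have hs0 : 0 < s := hs.1
  have hs1 : s < 1 := hs.2
  have hπ := Real.pi_pos
  have hsin : 0 < Real.sin (π*s) := Real.sin_pos_of_pos_of_lt_pi (by positivity) (by nlinarith)
  have hG2 : 0 < Real.Gamma (2*s) := Real.Gamma_pos_of_pos (by linarith)
  have hG4 : 0 < Real.Gamma (4*s) := Real.Gamma_pos_of_pos (by linarith)
  have ha0 : -rayR s (2*s) 0 = Real.sin (π*s) * (2*s * Real.Gamma (2*s)) := by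
    rw [rayR_zero s (2*s) hs (by linarith), Real.Gamma_add_one (by linarith), show π * (2*s) / 2 = π*s by ring]
    ring
  have hb0 : rayR s (4*s) 0 = -(2 * Real.sin (π*s) * Real.cos (π*s)) * (4*s * Real.Gamma (4*s)) := by
    rw [rayR_zero s (4*s) hs (by linarith), Real.Gamma_add_one (by linarith), show π * (4*s) / 2 = 2*(π*s) by ring,
      Real.sin_two_mul]
  have ha0p : 0 < -rayR s (2*s) 0 := by rw [ha0]; positivity
  have hε := eps_tend s t hs ht
  have hl1 := (phi_lim1 s hs).comp hε
  have hl2 := (phi_lim2 s hs).comp hε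
  have hQ := ((rayR_tend s (2*s) hs (by linarith)).comp hε).neg
  have key := abstract_f (layerV s t) (fun x => 2 * fracHeatKernel s t x) (fun x => x * fracHeatKernel s t x / (s*t))
    (fun x => (1/(2*s*t)) * (1 + x * pD s t x / fracHeatKernel s t x)) (-(1/t))
    (-(π/t) * (Real.cos (π*s) / Real.sin (π*s)) * Real.Gamma (4*s) / (Real.Gamma (2*s))^2)
    (deriv_V s t hs ht) (fun x => by have := p_pos s t hs ht x; positivity) (V_odd s t) (V_top s t hs ht) (V_bot s t hs ht)
    (fun x => by
      have := (p_pos s t hs ht x).ne'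
      refine (((hasDerivAt_id x).mul (deriv_p s t hs ht x)).div_const (s*t)).congr_deriv ?_
      simp only [id]
      field_simp)
    (fun x => by simp only [p_even]; ring)
    (by
      have h1 := cont_pD s t hs ht
      have h2 := p_cont s t hs ht
      have h3 : ∀ x, fracHeatKernel s t x ≠ 0 := fun x => (p_pos s t hs ht x).ne'
      exact continuous_const.mul (continuous_const.add ((continuous_id.mul h1).div h2 h3)))
    (fun x => by simp only [p_even, pD_odd]; ring)
    (fun x hx => by have := p_pos s t hs ht x; positivity)
    (by
      have h0 := ((rayR_tend s 0 hs le_rfl).comp hε).div_const (π*s*t)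
      rw [rayR_zero0 s hs, zero_div] at h0
      refine h0.congr' ?_
      filter_upwards [eventually_gt_atTop 0] with x hx
      rw [p_eq s t x hs ht hx]
      simp only [Function.comp]
      field_simp)
    (by
      have h := (hQ.div hl1 ha0p.ne').const_mul (-(1/t))
      rw [div_self ha0p.ne', mul_one] at h
      refine h.congr' ?_
      filter_upwards [eventually_gt_atTop 0] with x hx
      rw [(g1_eq s t x hs ht hx).1]
      have h1 := (g1_eq s t x hs ht hx).2
      have h2 : t * x^(-(2*s)) ≠ 0 := (mul_pos ht (rpow_pos_of_pos hx _)).ne'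
      simp only [Function.comp, Pi.div_apply]
      generalize t * x^(-(2*s)) = e at *
      field_simp)
    (by
      have h := ((hl2.div hl1 ha0p.ne').const_mul (-(1/t))).div (V_lim s t hs ht)
        (by
          have : 0 < (-rayR s (2*s) 0) / (π*s) := by positivity
          rw [neg_div]; linarith)
      have e : -(1/t) * (rayR s (4*s) 0 / 2 / -rayR s (2*s) 0) / (-(-rayR s (2*s) 0) / (π*s)) =
          -(π/t) * (Real.cos (π*s) / Real.sin (π*s)) * Real.Gamma (4*s) / (Real.Gamma (2*s))^2 := by
        rw [ha0, hb0]
        field_simp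
        ring
      rw [e] at h
      refine h.congr' ?_
      filter_upwards [eventually_gt_atTop 0] with x hx
      rw [(g1_eq s t x hs ht hx).1]
      have h1 := (g1_eq s t x hs ht hx).2
      have h2 : t * x^(-(2*s)) ≠ 0 := (mul_pos ht (rpow_pos_of_pos hx _)).ne'
      simp only [Function.comp, Pi.div_apply]
      generalize t * x^(-(2*s)) = e at *
      have h3 : layerV s t x - 1 ≠ 0 := by
        have a1 := V_smono s t hs ht (lt_add_one x)
        have a2 := V_le_one s t hs ht (x+1)
        intro h; linarith
      field_simp
      ring)
  obtain ⟨f, f', h1, h2, h3, h4, h5, h6, h7, h8, h9, h10, h11⟩ := key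
  refine ⟨f, f', h1, h2, h3, h4, h5, h6, h7, h8, h9, fun x => ?_, h11, ?_, ?_, ?_⟩
  · rw [(lap_V s t hs ht x).2, h10]
  · intro h
    have hc : 0 < Real.cos (π*s) := Real.cos_pos_of_mem_Ioo ⟨by nlinarith, by nlinarith⟩
    have : 0 < (π/t) * (Real.cos (π*s) / Real.sin (π*s)) * Real.Gamma (4*s) / (Real.Gamma (2*s))^2 := by positivity
    simp only [neg_mul, neg_div]
    linarith
  · intro h
    have hc : Real.cos (π*s) = 0 := by rw [h, mul_one_div, Real.cos_pi_div_two]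
    simp [hc]
  · intro h
    have hc : Real.cos (π*s) < 0 := Real.cos_neg_of_pi_div_two_lt_of_lt (by nlinarith) (by nlinarith)
    have hc' : 0 < -Real.cos (π*s) := by linarith
    have : 0 < (π/t) * (-Real.cos (π*s) / Real.sin (π*s)) * Real.Gamma (4*s) / (Real.Gamma (2*s))^2 := by positivity
    calc 0 < _ := this
      _ = _ := by ring
end

section
/- Let κ > 0 and s ∈ (0,1). Then lim_{x→+∞} ∫₀^∞ sin(z) z^{κs−1} e^{−(z/x)^{2s}} dz = sin(κsπ/2) Γ(κs). -/
open Real MeasureTheory Filter Set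

lemma aux_range_exp : Real.exp '' (Set.univ : Set ℝ) = Set.Ioi 0 := by
  rw [Set.image_univ, Real.range_exp]

lemma aux_cov (f : ℝ → ℝ) :
    ∫ z in Set.Ioi (0:ℝ), f z = ∫ u : ℝ, Real.exp u * f (Real.exp u) := by
  rw [← aux_range_exp, integral_image_eq_integral_abs_deriv_smul MeasurableSet.univ
    (fun x _ => (Real.hasDerivAt_exp x).hasDerivWithinAt) Real.exp_injective.injOn]
  simp [abs_of_pos (Real.exp_pos _)]

lemma aux_cov_int (f : ℝ → ℝ) (hf : IntegrableOn f (Set.Ioi (0:ℝ))) :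
    Integrable (fun u : ℝ => Real.exp u * f (Real.exp u)) := by
  rw [← aux_range_exp, integrableOn_image_iff_integrableOn_abs_deriv_smul MeasurableSet.univ
    (fun x _ => (Real.hasDerivAt_exp x).hasDerivWithinAt) Real.exp_injective.injOn] at hf
  simpa [abs_of_pos (Real.exp_pos _)] using hf

lemma aux_exp_rpow (u p : ℝ) : (Real.exp u) ^ p = Real.exp (p * u) := by
  rw [← Real.exp_mul, mul_comm]

lemma aux_bound_int (a d p : ℝ) (ha : 0 < a) (hd : 0 < d) (hp : 0 < p) :
    Integrable (fun u : ℝ => Real.exp (a * u - d * Real.exp (p * u))) := by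
  have h := aux_cov_int _ (integrableOn_rpow_mul_exp_neg_mul_rpow (s := a - 1) (by linarith) hp hd)
  refine h.congr (Eventually.of_forall fun u => ?_)
  simp only [aux_exp_rpow, ← Real.exp_add]
  congr 1; ring

lemma aux_tail_top (a d p : ℝ) (hd : 0 < d) (hp : 0 < p) :
    Tendsto (fun u : ℝ => Real.exp (a * u - d * Real.exp (p * u))) atTop (nhds 0) := by
  have h := (tendsto_rpow_mul_exp_neg_mul_atTop_nhds_zero (a / p) d hd).comp
    (Real.tendsto_exp_atTop.comp (tendsto_id.const_mul_atTop hp))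
  refine h.congr fun u => ?_
  simp only [Function.comp, aux_exp_rpow, ← Real.exp_add, id]
  congr 1; field_simp; ring

lemma aux_tail_bot (a d p : ℝ) (ha : 0 < a) (hd : 0 < d) :
    Tendsto (fun u : ℝ => Real.exp (a * u - d * Real.exp (p * u))) atBot (nhds 0) := by
  have h : Tendsto (fun u : ℝ => Real.exp (a * u)) atBot (nhds 0) :=
    Real.tendsto_exp_atBot.comp (tendsto_id.const_mul_atBot ha)
  refine squeeze_zero (fun _ => (Real.exp_pos _).le) (fun u => ?_) h
  have := mul_pos hd (Real.exp_pos (p * u))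
  exact Real.exp_le_exp.2 (by linarith)

/-- Shifting a horizontal contour. -/
lemma aux_shift (f : ℂ → ℂ) (hf : Differentiable ℂ f) (α β a d p : ℝ) (hαβ : α ≤ β)
    (ha : 0 < a) (hd : 0 < d) (hp : 0 < p)
    (hb : ∀ u φ : ℝ, α ≤ φ → φ ≤ β →
      ‖f (u + φ * Complex.I)‖ ≤ Real.exp (a * u - d * Real.exp (p * u))) :
    ∫ u : ℝ, f (u + α * Complex.I) = ∫ u : ℝ, f (u + β * Complex.I) := by
  have hc : Continuous f := hf.continuous
  have hint : ∀ φ : ℝ, α ≤ φ → φ ≤ β → Integrable (fun u : ℝ => f (u + φ * Complex.I)) := by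
    intro φ h1 h2
    refine (aux_bound_int a d p ha hd hp).mono' ?_ (Eventually.of_forall fun u => hb u φ h1 h2)
    exact (by fun_prop : Continuous (fun u : ℝ => f (u + φ * Complex.I))).aestronglyMeasurable
  have hvert : ∀ u : ℝ, ‖∫ y in α..β, f (u + y * Complex.I)‖ ≤
      Real.exp (a * u - d * Real.exp (p * u)) * |β - α| := by
    intro u
    refine intervalIntegral.norm_integral_le_of_norm_le_const fun y hy => ?_
    rw [Set.uIoc_of_le hαβ] at hy
    exact hb u y hy.1.le hy.2
  have hv1 : Tendsto (fun u : ℝ => ∫ y in α..β, f (u + y * Complex.I)) atTop (nhds 0) :=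
    squeeze_zero_norm hvert (by simpa using (aux_tail_top a d p hd hp).mul_const |β - α|)
  have hv2 : Tendsto (fun u : ℝ => ∫ y in α..β, f (u + y * Complex.I)) atBot (nhds 0) :=
    squeeze_zero_norm hvert (by simpa using (aux_tail_bot a d p ha hd).mul_const |β - α|)
  have h1 := intervalIntegral_tendsto_integral (hint α le_rfl hαβ) tendsto_neg_atTop_atBot tendsto_id
  have h2 := intervalIntegral_tendsto_integral (hint β hαβ le_rfl) tendsto_neg_atTop_atBot tendsto_id
  have h3 := hv2.comp tendsto_neg_atTop_atBot
  have key := (((h1.sub h2).add (hv1.const_mul Complex.I)).sub (h3.const_mul Complex.I))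
  have hz : ∀ T : ℝ, ((∫ u in (-T)..(id T), f (u + α * Complex.I)) -
      (∫ u in (-T)..(id T), f (u + β * Complex.I)) +
      Complex.I * ∫ y in α..β, f (T + y * Complex.I)) -
      Complex.I * ((fun u : ℝ => ∫ y in α..β, f (u + y * Complex.I)) ∘ Neg.neg) T = 0 := by
    intro T
    have := Complex.integral_boundary_rect_eq_zero_of_differentiableOn f
      (-T + α * Complex.I) (T + β * Complex.I) hf.differentiableOn
    simpa using this
  have := tendsto_nhds_unique (key.congr hz) tendsto_const_nhds
  simp only [mul_zero, add_zero, sub_zero] at this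
  exact sub_eq_zero.1 this

noncomputable def auxG (a p c : ℝ) (w : ℂ) : ℂ :=
  Complex.exp (a * w + Complex.I * Complex.exp w - c * Complex.exp (p * w))

lemma auxG_diff (a p c : ℝ) : Differentiable ℂ (auxG a p c) := by
  unfold auxG; fun_prop

lemma auxG_norm (a p c u φ : ℝ) : ‖auxG a p c (u + φ * Complex.I)‖ =
    Real.exp (a * u - Real.exp u * Real.sin φ - c * (Real.exp (p * u) * Real.cos (p * φ))) := by
  rw [auxG, Complex.norm_exp]
  congr 1
  simp [Complex.exp_re, Complex.exp_im]
  ring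

theorem statement10 (κ s : ℝ) (hκ : 0 < κ) (hs : s ∈ Set.Ioo (0:ℝ) 1) :
    Tendsto (fun x : ℝ =>
        ∫ z in Set.Ioi (0:ℝ), Real.sin z * z ^ (κ*s - 1) * Real.exp (-((z/x) ^ (2*s))))
      atTop (nhds (Real.sin (κ*s*π/2) * Real.Gamma (κ*s))) := by
  obtain ⟨hs0, hs1⟩ := hs
  set a := κ * s with ha_def
  have ha : 0 < a := mul_pos hκ hs0
  set p := 2 * s with hp_def
  have hp : 0 < p := by positivity
  have hpi := Real.pi_pos
  have hcos : 0 < Real.cos (p * (π / 4)) := by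
    apply Real.cos_pos_of_mem_Ioo
    constructor <;> nlinarith
  have hsin : 0 < Real.sin (π / 4) := Real.sin_pos_of_pos_of_lt_pi (by linarith) (by linarith)
  -- bounds
  have hb1 : ∀ c : ℝ, 0 < c → ∀ u φ : ℝ, 0 ≤ φ → φ ≤ π / 4 → ‖auxG a p c (u + φ * Complex.I)‖ ≤
      Real.exp (a * u - (c * Real.cos (p * (π / 4))) * Real.exp (p * u)) := by
    intro c hc u φ h1 h2
    rw [auxG_norm, Real.exp_le_exp]
    have h3 : 0 ≤ Real.sin φ := Real.sin_nonneg_of_nonneg_of_le_pi h1 (by linarith)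
    have h4 : Real.cos (p * (π / 4)) ≤ Real.cos (p * φ) := by
      apply Real.cos_le_cos_of_nonneg_of_le_pi (by positivity) (by nlinarith)
      gcongr
    have h5 := mul_nonneg (Real.exp_pos u).le h3
    have h6 := mul_le_mul_of_nonneg_left h4 (mul_pos hc (Real.exp_pos (p * u))).le
    nlinarith
  have hb2 : ∀ u φ : ℝ, π / 4 ≤ φ → φ ≤ π / 2 → ‖auxG a p 0 (u + φ * Complex.I)‖ ≤
      Real.exp (a * u - Real.sin (π / 4) * Real.exp (1 * u)) := by
    intro u φ h1 h2
    rw [auxG_norm, Real.exp_le_exp]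
    have h3 : Real.sin (π / 4) ≤ Real.sin φ :=
      Real.sin_le_sin_of_le_of_le_pi_div_two (by linarith) h2 h1
    have h6 := mul_le_mul_of_nonneg_left h3 (Real.exp_pos u).le
    rw [one_mul]
    linarith
  have hb3 : ∀ c : ℝ, 0 < c → ∀ u : ℝ, ‖auxG a p c (u + (π / 4 : ℝ) * Complex.I)‖ ≤
      Real.exp (a * u - Real.sin (π / 4) * Real.exp (1 * u)) := by
    intro c hc u
    rw [auxG_norm, Real.exp_le_exp, one_mul]
    have := mul_pos hc (mul_pos (Real.exp_pos (p * u)) hcos)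
    linarith
  have hs1 : ∀ c : ℝ, 0 < c → ∫ u : ℝ, auxG a p c u =
      ∫ u : ℝ, auxG a p c (u + (π / 4 : ℝ) * Complex.I) := by
    intro c hc
    have := aux_shift (auxG a p c) (auxG_diff a p c) 0 (π / 4) a (c * Real.cos (p * (π / 4))) p
      (by positivity) ha (by positivity) hp (hb1 c hc)
    simpa only [Complex.ofReal_zero, zero_mul, add_zero] using this
  have hs2 := aux_shift (auxG a p 0) (auxG_diff a p 0) (π / 4) (π / 2) a (Real.sin (π / 4)) 1
      (by linarith) ha hsin one_pos hb2
  have hlim0 : ∫ u : ℝ, auxG a p 0 (u + (π / 2 : ℝ) * Complex.I) =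
      Complex.exp ((a * π / 2 : ℝ) * Complex.I) * (Real.Gamma a : ℝ) := by
    have h1 : Real.Gamma a = ∫ u : ℝ, Real.exp (a * u - Real.exp u) := by
      rw [Real.Gamma_eq_integral ha, aux_cov]
      refine integral_congr_ae (Eventually.of_forall fun u => ?_)
      simp only [aux_exp_rpow, ← Real.exp_add]
      congr 1; ring
    rw [h1, ← integral_complex_ofReal, ← integral_const_mul]
    refine integral_congr_ae (Eventually.of_forall fun u => ?_)
    have h2 : Complex.exp (u + (π / 2 : ℝ) * Complex.I) = Complex.exp u * Complex.I := by
      rw [Complex.exp_add]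
      push_cast
      rw [Complex.exp_pi_div_two_mul_I]
    simp only [auxG]
    rw [h2]
    push_cast
    rw [← Complex.exp_add]
    congr 1
    linear_combination Complex.exp u * Complex.I_sq
  -- dominated convergence
  have hx : Tendsto (fun x : ℝ => (x ^ p)⁻¹) atTop (nhds 0) :=
    (tendsto_rpow_atTop hp).inv_tendsto_atTop
  have hdom : Tendsto (fun x : ℝ => ∫ u : ℝ, auxG a p ((x ^ p)⁻¹) (u + (π / 4 : ℝ) * Complex.I))
      atTop (nhds (∫ u : ℝ, auxG a p 0 (u + (π / 4 : ℝ) * Complex.I))) := by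
    refine tendsto_integral_filter_of_dominated_convergence
      (fun u => Real.exp (a * u - Real.sin (π / 4) * Real.exp (1 * u))) ?_ ?_
      (aux_bound_int a _ 1 ha hsin one_pos) ?_
    · refine Eventually.of_forall fun x => ?_
      have := (auxG_diff a p ((x ^ p)⁻¹)).continuous
      exact (by fun_prop : Continuous fun u : ℝ =>
        auxG a p ((x ^ p)⁻¹) (u + (π / 4 : ℝ) * Complex.I)).aestronglyMeasurable
    · filter_upwards [eventually_gt_atTop 0] with x hx0
      exact Eventually.of_forall (hb3 _ (by positivity))
    · refine Eventually.of_forall fun u => ?_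
      have hcont : Continuous fun c : ℝ => auxG a p c (u + (π / 4 : ℝ) * Complex.I) := by
        unfold auxG; fun_prop
      exact (hcont.tendsto 0).comp hx
  rw [hs2, hlim0] at hdom
  have him := (Complex.continuous_im.tendsto _).comp hdom
  have hval : (Complex.exp ((a * π / 2 : ℝ) * Complex.I) * (Real.Gamma a : ℝ)).im =
      Real.sin (a * π / 2) * Real.Gamma a := by
    rw [Complex.im_mul_ofReal, Complex.exp_ofReal_mul_I_im]
  rw [hval] at him
  refine him.congr' ?_
  filter_upwards [eventually_gt_atTop 0] with x hx0
  have hc : 0 < (x ^ p)⁻¹ := by positivity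
  simp only [Function.comp]
  rw [← hs1 _ hc, aux_cov]
  have hint : Integrable (fun u : ℝ => auxG a p ((x ^ p)⁻¹) u) := by
    refine (aux_bound_int a _ p ha (mul_pos hc hcos) hp).mono' ?_
      (Eventually.of_forall fun u => ?_)
    · have := (auxG_diff a p ((x ^ p)⁻¹)).continuous
      exact (by fun_prop : Continuous fun u : ℝ =>
        auxG a p ((x ^ p)⁻¹) u).aestronglyMeasurable
    · simpa using hb1 _ hc u 0 le_rfl (by positivity)
  have him2 := integral_im hint
  simp only [RCLike.im_to_complex] at him2
  rw [← him2]
  refine integral_congr_ae (Eventually.of_forall fun u => ?_)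
  simp only
  rw [Real.div_rpow (Real.exp_pos u).le hx0.le, aux_exp_rpow, aux_exp_rpow]
  have h1 : (a * (u:ℂ) + Complex.I * Complex.exp u - ((x ^ p)⁻¹ : ℝ) * Complex.exp (p * u)) =
      ((a * u - (x ^ p)⁻¹ * Real.exp (p * u) : ℝ) : ℂ) + (Real.exp u : ℝ) * Complex.I := by
    push_cast; ring
  rw [auxG, h1, Complex.exp_add, ← Complex.ofReal_exp, Complex.im_ofReal_mul,
    Complex.exp_ofReal_mul_I_im]
  have h2 : Real.exp (a * u - (x ^ p)⁻¹ * Real.exp (p * u)) =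
      Real.exp u * Real.exp ((a - 1) * u) * Real.exp (-(Real.exp (p * u) / x ^ p)) := by
    rw [← Real.exp_add, ← Real.exp_add]
    congr 1; ring
  rw [h2]; ring
end

section
/- Let s ∈ (0,1) and t > 0. Then lim_{x→+∞} x^{1+2s} p_s(t,x) = t (2s/π) sin(πs) Γ(2s). Consequently, the derivative of the function v^t_s(x) = (2/π) ∫₀^∞ (sin(xr)/r) e^{−t r^{2s}} dr satisfies lim_{|x|→∞} |x|^{1+2s} (v^t_s)′(x) = t (4s/π) sin(πs) Γ(2s) > 0. -/
open Real MeasureTheory Filter Set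

lemma aux_integral_exp {E : Type*} [NormedAddCommGroup E] [NormedSpace ℝ E] (g : ℝ → E) :
    ∫ ρ in Ioi (0:ℝ), g ρ = ∫ y : ℝ, rexp y • g (rexp y) := by
  have h : rexp '' univ = Ioi 0 := by rw [image_univ, Real.range_exp]
  rw [← h, integral_image_eq_integral_abs_deriv_smul MeasurableSet.univ
    (fun x _ ↦ (Real.hasDerivAt_exp x).hasDerivWithinAt) Real.exp_injective.injOn]
  simp [abs_of_pos (Real.exp_pos _)]

lemma aux_integrable_exp {E : Type*} [NormedAddCommGroup E] [NormedSpace ℝ E] (g : ℝ → E) :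
    IntegrableOn g (Ioi (0:ℝ)) ↔ Integrable (fun y : ℝ => rexp y • g (rexp y)) := by
  have h : rexp '' univ = Ioi 0 := by rw [image_univ, Real.range_exp]
  rw [← h, integrableOn_image_iff_integrableOn_abs_deriv_smul MeasurableSet.univ
    (fun x _ ↦ (Real.hasDerivAt_exp x).hasDerivWithinAt) Real.exp_injective.injOn]
  simp [abs_of_pos (Real.exp_pos _)]

lemma aux_B_integrable {p q b : ℝ} (hp : 0 < p) (hq : 0 < q) (hb : 0 < b) :
    Integrable (fun y : ℝ => rexp (p * y - b * rexp (q * y))) := by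
  have h := (aux_integrable_exp _).1
    (integrableOn_rpow_mul_exp_neg_mul_rpow (p := q) (s := p - 1) (b := b) (by linarith) hq hb)
  refine h.congr (Eventually.of_forall fun y => ?_)
  simp only [smul_eq_mul]
  rw [← Real.exp_mul, ← Real.exp_mul, ← Real.exp_add, ← Real.exp_add, mul_comm y q]
  congr 1; ring

lemma aux_B_atTop {p q b : ℝ} (hq : 0 < q) (hb : 0 < b) :
    Tendsto (fun y : ℝ => rexp (p * y - b * rexp (q * y))) atTop (nhds 0) := by
  have h1 : Tendsto (fun y : ℝ => rexp (q * y)) atTop atTop :=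
    Real.tendsto_exp_atTop.comp (tendsto_id.const_mul_atTop hq)
  refine ((tendsto_rpow_mul_exp_neg_mul_atTop_nhds_zero (p / q) b hb).comp h1).congr fun y => ?_
  simp only [Function.comp]
  rw [← Real.exp_mul, ← Real.exp_add]
  congr 1; field_simp; ring

lemma aux_B_atBot {p q b : ℝ} (hp : 0 < p) (hb : 0 < b) :
    Tendsto (fun y : ℝ => rexp (p * y - b * rexp (q * y))) atBot (nhds 0) := by
  have h1 : Tendsto (fun y : ℝ => rexp (p * y)) atBot (nhds 0) :=
    Real.tendsto_exp_atBot.comp (tendsto_id.const_mul_atBot hp)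
  refine squeeze_zero (fun y => (Real.exp_pos _).le) (fun y => ?_) h1
  apply Real.exp_le_exp.2
  have := Real.exp_pos (q * y)
  nlinarith

/-- shift of the contour of integration. -/
lemma aux_shift_s11 (g : ℂ → ℂ) (hg : Differentiable ℂ g) (a b : ℝ) (hab : a ≤ b) (B : ℝ → ℝ)
    (hB : Integrable B) (hB1 : Tendsto B atTop (nhds 0)) (hB2 : Tendsto B atBot (nhds 0))
    (hbd : ∀ y τ : ℝ, τ ∈ Icc a b → ‖g (y + τ * Complex.I)‖ ≤ B y) :
    ∫ y : ℝ, g (y + a * Complex.I) = ∫ y : ℝ, g (y + b * Complex.I) := by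
  have hint : ∀ τ ∈ Icc a b, Integrable (fun y : ℝ => g (y + τ * Complex.I)) := by
    intro τ hτ
    refine hB.mono' ?_ (Eventually.of_forall fun y => hbd y τ hτ)
    exact (hg.continuous.comp (by fun_prop)).aestronglyMeasurable
  have hlim : ∀ τ ∈ Icc a b, Tendsto (fun R : ℝ => ∫ y in (-R)..R, g (y + τ * Complex.I)) atTop
      (nhds (∫ y : ℝ, g (y + τ * Complex.I))) := fun τ hτ =>
    intervalIntegral_tendsto_integral (hint τ hτ) tendsto_neg_atTop_atBot tendsto_id
  have hside : ∀ c : ℝ, ‖∫ τ in a..b, g (c + τ * Complex.I)‖ ≤ B c * |b - a| := by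
    intro c
    apply intervalIntegral.norm_integral_le_of_norm_le_const
    intro τ hτ
    rw [uIoc_of_le hab] at hτ
    exact hbd c τ ⟨hτ.1.le, hτ.2⟩
  have hs1 : Tendsto (fun R : ℝ => ∫ τ in a..b, g (R + τ * Complex.I)) atTop (nhds 0) := by
    refine squeeze_zero_norm (fun R => hside R) ?_
    simpa using hB1.mul_const |b - a|
  have hs2 : Tendsto (fun R : ℝ => ∫ τ in a..b, g (((-R : ℝ) : ℂ) + τ * Complex.I)) atTop
      (nhds 0) := by
    refine squeeze_zero_norm (fun R => hside (-R)) ?_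
    simpa using (hB2.comp tendsto_neg_atTop_atBot).mul_const |b - a|
  have key : ∀ R : ℝ, (∫ y in (-R)..R, g (y + a * Complex.I)) -
      (∫ y in (-R)..R, g (y + b * Complex.I)) +
      Complex.I • (∫ τ in a..b, g (R + τ * Complex.I)) -
      Complex.I • (∫ τ in a..b, g (((-R : ℝ) : ℂ) + τ * Complex.I)) = 0 := by
    intro R
    have := Complex.integral_boundary_rect_eq_zero_of_differentiableOn g
      (⟨-R, a⟩ : ℂ) (⟨R, b⟩ : ℂ) hg.differentiableOn
    simpa using this
  have hl := (((hlim a ⟨le_rfl, hab⟩).sub (hlim b ⟨hab, le_rfl⟩)).add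
    (hs1.const_smul Complex.I)).sub (hs2.const_smul Complex.I)
  have h0 := tendsto_nhds_unique (hl.congr key) tendsto_const_nhds
  simp only [smul_zero, add_zero, sub_zero] at h0
  exact sub_eq_zero.1 h0

lemma aux_rot1 {α t x : ℝ} (hα : 0 < α) (hα2 : α < 2) (ht : 0 < t) (hx : 0 < x) :
    ∫ ρ in Ioi (0:ℝ), Complex.exp (Complex.I * x * ρ - t * (ρ ^ α : ℝ)) =
    ∫ ρ in Ioi (0:ℝ), Complex.exp ((π/4:ℝ) * Complex.I) *
      Complex.exp (Complex.I * x * ρ * Complex.exp ((π/4:ℝ) * Complex.I)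
        - t * (ρ ^ α : ℝ) * Complex.exp (α * (π/4:ℝ) * Complex.I)) := by
  have hpi := Real.pi_pos
  have hc : 0 < Real.cos (α * (π/4)) :=
    Real.cos_pos_of_mem_Ioo ⟨by nlinarith, by nlinarith⟩
  have key := aux_shift_s11
    (fun z => Complex.exp (z + Complex.I * x * Complex.exp z - t * Complex.exp (α * z)))
    (by fun_prop) 0 (π/4) (by positivity)
    (fun y => rexp (1 * y - (t * Real.cos (α * (π/4))) * rexp (α * y)))
    (aux_B_integrable one_pos hα (by positivity)) (aux_B_atTop hα (by positivity))
    (aux_B_atBot one_pos (by positivity)) (by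
      intro y τ hτ
      rw [Complex.norm_exp]
      apply Real.exp_le_exp.2
      have h1 : (↑y + ↑τ * Complex.I + Complex.I * ↑x * Complex.exp (↑y + ↑τ * Complex.I) -
          ↑t * Complex.exp (↑α * (↑y + ↑τ * Complex.I))).re =
          y - x * (rexp y * Real.sin τ) - t * (rexp (α * y) * Real.cos (α * τ)) := by
        simp [Complex.exp_re, Complex.exp_im, sub_eq_add_neg]
      rw [h1]
      have h2 : 0 ≤ Real.sin τ := Real.sin_nonneg_of_nonneg_of_le_pi hτ.1 (by linarith [hτ.2])
      have h3 : Real.cos (α * (π/4)) ≤ Real.cos (α * τ) := by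
        apply Real.cos_le_cos_of_nonneg_of_le_pi
        · exact mul_nonneg hα.le hτ.1
        · nlinarith
        · exact mul_le_mul_of_nonneg_left hτ.2 hα.le
      have h4 : 0 ≤ x * (rexp y * Real.sin τ) := by positivity
      have h5 : t * (rexp (α * y) * Real.cos (α * (π/4))) ≤
        t * (rexp (α * y) * Real.cos (α * τ)) := by gcongr
      linarith)
  rw [aux_integral_exp, aux_integral_exp]
  convert key using 2
  · ext y
    rw [Complex.real_smul, ← Real.exp_mul, Complex.ofReal_exp, Complex.ofReal_exp,
      ← Complex.exp_add]
    congr 1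
    push_cast
    simp only [zero_mul, add_zero]
    rw [mul_comm (y:ℂ) α]; ring
  · ext y
    rw [Complex.real_smul, ← Real.exp_mul, Complex.ofReal_exp, Complex.ofReal_exp,
      ← Complex.exp_add, ← Complex.exp_add]
    congr 1
    rw [mul_assoc (Complex.I * (x:ℂ)), ← Complex.exp_add, mul_assoc (t:ℂ), ← Complex.exp_add]
    push_cast
    rw [show (y:ℂ) * α + α * (π/4) * Complex.I = α * (y + π/4 * Complex.I) by ring]
    ring

lemma aux_rot2 {α : ℝ} (hα : 0 < α) :
    ∫ u in Ioi (0:ℝ), Complex.exp (-((1 + α) * (π/4:ℝ) * Complex.I)) * ((u ^ α : ℝ) *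
      Complex.exp (- (u * Complex.exp (-((π/4:ℝ) * Complex.I))))) = (Real.Gamma (1 + α) : ℂ) := by
  have hpi := Real.pi_pos
  have hc : 0 < Real.cos (π/4) :=
    Real.cos_pos_of_mem_Ioo ⟨by linarith, by linarith⟩
  have key := aux_shift_s11
    (fun z => Complex.exp ((1 + α) * z - Complex.exp z))
    (by fun_prop) (-(π/4)) 0 (by linarith)
    (fun y => rexp ((1 + α) * y - (Real.cos (π/4)) * rexp (1 * y)))
    (aux_B_integrable (by positivity) one_pos hc) (aux_B_atTop one_pos hc)
    (aux_B_atBot (by positivity) hc) (by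
      intro y τ hτ
      rw [Complex.norm_exp]
      apply Real.exp_le_exp.2
      have h1 : ((1 + α) * (↑y + ↑τ * Complex.I) - Complex.exp (↑y + ↑τ * Complex.I)).re =
          (1 + α) * y - rexp y * Real.cos τ := by
        simp [Complex.exp_re]
      rw [h1, one_mul]
      have h3 : Real.cos (π/4) ≤ Real.cos τ := by
        rw [← Real.cos_neg τ]
        apply Real.cos_le_cos_of_nonneg_of_le_pi
        · linarith [hτ.2]
        · linarith
        · linarith [hτ.1]
      have := mul_le_mul_of_nonneg_left h3 (Real.exp_pos y).le
      linarith)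
  have hG : (Real.Gamma (1 + α) : ℂ) =
      ∫ u in Ioi (0:ℝ), ((rexp (-u) * u ^ (1 + α - 1) : ℝ) : ℂ) := by
    rw [Real.Gamma_eq_integral (by positivity)]
    exact integral_complex_ofReal.symm
  rw [hG, aux_integral_exp, aux_integral_exp]
  refine Eq.trans ?_ (key.trans ?_)
  · congr 1
    ext y
    rw [Complex.real_smul, ← Real.exp_mul, Complex.ofReal_exp, Complex.ofReal_exp,
      ← Complex.exp_add, ← Complex.exp_add, ← Complex.exp_add, ← Complex.exp_add]
    congr 1
    push_cast
    rw [show (y:ℂ) + -(π/4 * Complex.I) = y + -(π/4) * Complex.I by ring]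
    ring
  · congr 1
    ext y
    rw [Complex.real_smul, ← Real.exp_mul]
    push_cast
    rw [← Complex.exp_add, ← Complex.exp_add]
    congr 1
    simp only [zero_mul, add_zero]
    ring

lemma aux_exp_sub_one {w : ℂ} (hw : 0 ≤ w.re) : ‖Complex.exp (-w) - 1‖ ≤ ‖w‖ := by
  have h := (convex_halfSpace_re_ge 0).norm_image_sub_le_of_norm_hasDerivWithin_le
    (f := fun z : ℂ => Complex.exp (-z)) (f' := fun z => Complex.exp (-z) * (-1)) (C := 1)
    (x := 0) (y := w)
    (fun z _ => ((hasDerivAt_neg z).cexp).hasDerivWithinAt)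
    (fun z hz => by
      have hz' : 0 ≤ z.re := hz
      simp [Complex.norm_exp, hz']) (by simp) hw
  simpa using h

lemma aux_IE : Complex.I * Complex.exp ((π/4:ℝ) * Complex.I) =
    -Complex.exp (-((π/4:ℝ) * Complex.I)) := by
  have h1 : Complex.exp (-((π/4:ℝ) * Complex.I)) =
    Complex.exp (((-(π/4):ℝ):ℂ) * Complex.I) := by push_cast; ring_nf
  rw [h1, Complex.exp_mul_I, Complex.exp_mul_I, ← Complex.ofReal_cos, ← Complex.ofReal_sin,
    ← Complex.ofReal_cos, ← Complex.ofReal_sin, Real.cos_neg, Real.sin_neg, Real.cos_pi_div_four,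
    Real.sin_pi_div_four]
  apply Complex.ext <;> simp

lemma aux_normJ (u : ℝ) : ‖Complex.exp (-(u * Complex.exp (-((π/4:ℝ) * Complex.I))))‖ =
    rexp (-Real.cos (π/4) * u ^ (1:ℝ)) := by
  rw [Complex.norm_exp]
  congr 1
  have h1 : Complex.exp (-((π/4:ℝ) * Complex.I)) =
    Complex.exp (((-(π/4):ℝ):ℂ) * Complex.I) := by push_cast; ring_nf
  rw [h1, Complex.exp_mul_I, ← Complex.ofReal_cos, ← Complex.ofReal_sin, Real.cos_neg, Real.rpow_one]
  simp
  ring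

lemma aux_cos4 : 0 < Real.cos (π/4) :=
  Real.cos_pos_of_mem_Ioo ⟨by linarith [Real.pi_pos], by linarith [Real.pi_pos]⟩

lemma aux_lim {α : ℝ} (hα : 0 < α) (c e : ℂ) (hc : 0 ≤ c.re) :
    Tendsto (fun ε : ℝ => ∫ u in Ioi (0:ℝ),
      e * Complex.exp (-(u * Complex.exp (-((π/4:ℝ) * Complex.I)))) *
        ((ε:ℂ)⁻¹ * (Complex.exp (-((ε * (u ^ α : ℝ) : ℝ) * c)) - 1))) (nhdsWithin 0 (Ioi 0))
      (nhds (∫ u in Ioi (0:ℝ),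
      e * Complex.exp (-(u * Complex.exp (-((π/4:ℝ) * Complex.I)))) * (-((u ^ α : ℝ) * c)))) := by
  apply tendsto_integral_filter_of_dominated_convergence
    (fun u => (‖e‖ * ‖c‖) * (u ^ α * rexp (-Real.cos (π/4) * u ^ (1:ℝ))))
  · refine Eventually.of_forall fun ε => Measurable.aestronglyMeasurable ?_
    fun_prop
  · filter_upwards [self_mem_nhdsWithin] with ε hε
    have hε' : 0 < ε := hε
    filter_upwards [ae_restrict_mem measurableSet_Ioi] with u hu
    have hu' : 0 < u := hu
    have hp : 0 < u ^ α := Real.rpow_pos_of_pos hu' _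
    have h1 := aux_exp_sub_one (w := (ε * (u ^ α : ℝ) : ℝ) * c) (by
      rw [Complex.re_ofReal_mul]; positivity)
    rw [norm_mul, norm_mul, norm_mul, aux_normJ, norm_inv, Complex.norm_real,
      Real.norm_of_nonneg hε'.le]
    rw [norm_mul, Complex.norm_real, Real.norm_of_nonneg (by positivity)] at h1
    calc _ ≤ ‖e‖ * rexp (-Real.cos (π/4) * u ^ (1:ℝ)) * (ε⁻¹ * (ε * u ^ α * ‖c‖)) := by gcongr
      _ = _ := by field_simp
  · exact (integrableOn_rpow_mul_exp_neg_mul_rpow (by linarith) one_pos aux_cos4).const_mul _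
  · refine Eventually.of_forall fun u => Tendsto.const_mul _ ?_
    have hd : HasDerivAt (fun ε : ℝ => Complex.exp (-((ε * (u ^ α : ℝ) : ℝ) * c)))
        (-((u ^ α : ℝ) * c)) 0 := by
      have h0 : HasDerivAt (fun ε : ℝ => -(((ε * (u ^ α : ℝ) : ℝ) : ℂ) * c))
          (-(((1 * u ^ α : ℝ) : ℂ) * c)) 0 :=
        ((((hasDerivAt_id (0:ℝ)).mul_const (u ^ α)).ofReal_comp).mul_const c).neg
      simpa using h0.cexp
    have := hd.tendsto_slope_zero_right
    refine this.congr fun ε => ?_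
    simp

lemma aux_main {α t : ℝ} (hα : 0 < α) (hα2 : α < 2) (ht : 0 < t) :
    Tendsto (fun x : ℝ => x ^ (1 + α) *
      (∫ ρ in Ioi (0:ℝ), Complex.exp (Complex.I * x * ρ - t * (ρ ^ α : ℝ))).re) atTop
      (nhds (t * Real.sin (π * α / 2) * Real.Gamma (1 + α))) := by
  have hpi := Real.pi_pos
  set E : ℂ := Complex.exp ((π/4:ℝ) * Complex.I) with hE
  set D : ℂ := Complex.exp (-((π/4:ℝ) * Complex.I)) with hD
  set A : ℂ := Complex.exp (α * (π/4:ℝ) * Complex.I) with hA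
  have hIE : Complex.I * E = -D := aux_IE
  have hAre : A.re = Real.cos (α * (π/4)) := by
    rw [hA, ← Complex.ofReal_mul, Complex.exp_ofReal_mul_I_re]
  have hc : 0 < Real.cos (α * (π/4)) :=
    Real.cos_pos_of_mem_Ioo ⟨by nlinarith, by nlinarith⟩
  have hDre : D.re = Real.cos (π/4) := by
    rw [hD, show -(((π/4:ℝ):ℂ) * Complex.I) = ((-(π/4):ℝ):ℂ) * Complex.I by push_cast; ring,
      Complex.exp_ofReal_mul_I_re, Real.cos_neg]
  have hcre : 0 ≤ ((t:ℂ) * A).re := by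
    rw [Complex.re_ofReal_mul, hAre]; positivity
  have hlim := aux_lim hα (t * A) E hcre
  have hε : Tendsto (fun x : ℝ => x ^ (-α)) atTop (nhdsWithin 0 (Ioi 0)) := by
    refine tendsto_nhdsWithin_iff.2 ⟨tendsto_rpow_neg_atTop hα, ?_⟩
    filter_upwards [eventually_gt_atTop 0] with x hx
    exact Real.rpow_pos_of_pos hx _
  have hlim2 := (Complex.continuous_re.tendsto _).comp (hlim.comp hε)
  have hval : (∫ u in Ioi (0:ℝ), E * Complex.exp (-(u * D)) * (-((u ^ α : ℝ) * (t * A)))).re =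
      t * Real.sin (π * α / 2) * Real.Gamma (1 + α) := by
    have h2 := aux_rot2 hα
    rw [integral_const_mul] at h2
    have h3 : (∫ u in Ioi (0:ℝ), E * Complex.exp (-(u * D)) * (-((u ^ α : ℝ) * (t * A)))) =
        -(E * A * t) * ∫ u in Ioi (0:ℝ), ((u ^ α : ℝ) : ℂ) * Complex.exp (-(u * D)) := by
      rw [← integral_const_mul]
      congr 1; ext u; ring
    have h4 : (∫ u in Ioi (0:ℝ), ((u ^ α : ℝ) : ℂ) * Complex.exp (-(u * D))) =
        Complex.exp ((1 + α) * (π/4:ℝ) * Complex.I) * (Real.Gamma (1 + α) : ℂ) := by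
      rw [← h2, ← mul_assoc, ← Complex.exp_add, add_neg_cancel, Complex.exp_zero, one_mul]
    have h5 : E * A * Complex.exp ((1 + α) * (π/4:ℝ) * Complex.I) =
        Complex.exp (((π * α / 2 + π / 2 : ℝ) : ℂ) * Complex.I) := by
      rw [hE, hA, ← Complex.exp_add, ← Complex.exp_add]
      congr 1
      push_cast; ring
    rw [h3, h4, show -(E * A * t) * (Complex.exp ((1 + α) * (π/4:ℝ) * Complex.I) *
      (Real.Gamma (1 + α) : ℂ)) = ((-(t * Real.Gamma (1 + α)) : ℝ) : ℂ) *
      (E * A * Complex.exp ((1 + α) * (π/4:ℝ) * Complex.I)) by push_cast; ring, h5,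
      Complex.re_ofReal_mul, Complex.exp_ofReal_mul_I_re, Real.cos_add_pi_div_two]
    ring
  rw [hval] at hlim2
  refine hlim2.congr' ?_
  filter_upwards [eventually_gt_atTop 0] with x hx
  simp only [Function.comp]
  have hxp : 0 < x ^ (-α) := Real.rpow_pos_of_pos hx _
  have hxa : x ^ α * x ^ (-α) = 1 := by
    rw [← Real.rpow_add hx]; simp
  -- the scaled integral
  have hsc : (∫ ρ in Ioi (0:ℝ), Complex.exp (Complex.I * x * ρ - t * (ρ ^ α : ℝ))) =
      x⁻¹ • ∫ u in Ioi (0:ℝ), E * Complex.exp (-(u * D)) *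
        Complex.exp (-((x ^ (-α) * (u ^ α : ℝ) : ℝ) * (t * A))) := by
    rw [aux_rot1 hα hα2 ht hx]
    have h := integral_comp_mul_left_Ioi (fun u : ℝ => E * Complex.exp (-(u * D)) *
        Complex.exp (-((x ^ (-α) * (u ^ α : ℝ) : ℝ) * (t * A)))) 0 hx
    rw [mul_zero] at h
    rw [← h]
    refine setIntegral_congr_fun measurableSet_Ioi fun ρ hρ => ?_
    have hρ' : 0 < ρ := hρ
    beta_reduce
    rw [mul_assoc E, ← Complex.exp_add (-(((x * ρ : ℝ) : ℂ) * D)), Real.mul_rpow hx.le hρ'.le, ← mul_assoc (x ^ (-α)),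
      mul_comm (x ^ (-α)), hxa, one_mul]
    congr 2
    have : Complex.I * x * ρ * E = x * ρ * (Complex.I * E) := by ring
    rw [this, hIE, ← hA]
    push_cast
    ring
  have hneg : (-D).re < 0 := by
    rw [Complex.neg_re, hDre]; linarith [aux_cos4]
  have hJint : IntegrableOn (fun u : ℝ => E * Complex.exp (-(u * D))) (Ioi 0) := by
    have := (integrableOn_exp_mul_complex_Ioi hneg 0).const_mul E
    refine this.congr (Eventually.of_forall fun u => ?_)
    simp only
    congr 2; ring
  have hJ : ∫ u in Ioi (0:ℝ), E * Complex.exp (-(u * D)) = Complex.I := by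
    rw [integral_const_mul]
    have := integral_exp_mul_complex_Ioi hneg 0
    have h6 : ∫ u in Ioi (0:ℝ), Complex.exp (-(u * D)) =
        ∫ u in Ioi (0:ℝ), Complex.exp (-D * u) := by
      congr 1; ext u; congr 1; ring
    rw [h6, this]
    have hD0 : D ≠ 0 := Complex.exp_ne_zero _
    have : E = Complex.I * D := by
      linear_combination (-Complex.I) * hIE + E * Complex.I_mul_I
    rw [this]
    simp [hD0]
  have hGint : IntegrableOn (fun u : ℝ => E * Complex.exp (-(u * D)) *
        Complex.exp (-((x ^ (-α) * (u ^ α : ℝ) : ℝ) * (t * A)))) (Ioi 0) := by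
    refine Integrable.mono hJint (Measurable.aestronglyMeasurable (by fun_prop)) ?_
    filter_upwards [ae_restrict_mem measurableSet_Ioi] with u hu
    have hu' : 0 < u := hu
    have hp : 0 < u ^ α := Real.rpow_pos_of_pos hu' _
    rw [norm_mul]
    refine mul_le_of_le_one_right (norm_nonneg _) ?_
    rw [Complex.norm_exp, Complex.neg_re, Complex.re_ofReal_mul]
    apply Real.exp_le_one_iff.2
    have : 0 ≤ x ^ (-α) * u ^ α * ((t:ℂ) * A).re := by positivity
    linarith
  have hdiff : (∫ u in Ioi (0:ℝ), E * Complex.exp (-(u * D)) *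
      (((x ^ (-α) : ℝ) : ℂ)⁻¹ *
        (Complex.exp (-((x ^ (-α) * (u ^ α : ℝ) : ℝ) * (t * A))) - 1))) =
      ((x ^ α : ℝ) : ℂ) * ((∫ u in Ioi (0:ℝ), E * Complex.exp (-(u * D)) *
        Complex.exp (-((x ^ (-α) * (u ^ α : ℝ) : ℝ) * (t * A)))) - Complex.I) := by
    rw [← hJ, ← integral_sub hGint hJint, ← integral_const_mul]
    congr 1; ext u
    rw [← Complex.ofReal_inv, ← Real.rpow_neg hx.le, neg_neg]
    ring
  rw [hdiff, hsc, Complex.re_ofReal_mul, Complex.sub_re, Complex.I_re, sub_zero, Complex.smul_re,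
    smul_eq_mul, Real.rpow_add hx, Real.rpow_one, mul_comm x (x ^ α), mul_assoc (x ^ α),
    mul_inv_cancel_left₀ hx.ne']

lemma aux_kernel {α t : ℝ} (hα : 0 < α) (ht : 0 < t) (x : ℝ) :
    ∫ r in Ioi (0:ℝ), Real.cos (x * r) * rexp (-(t * r ^ α)) =
    (∫ ρ in Ioi (0:ℝ), Complex.exp (Complex.I * x * ρ - t * (ρ ^ α : ℝ))).re := by
  have hnorm : ∀ ρ : ℝ, ‖Complex.exp (Complex.I * x * ρ - t * (ρ ^ α : ℝ))‖ =
      ρ ^ (0:ℝ) * rexp (-t * ρ ^ α) := by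
    intro ρ
    rw [Complex.norm_exp]
    simp
  have hint : IntegrableOn
      (fun ρ : ℝ => Complex.exp (Complex.I * x * ρ - t * (ρ ^ α : ℝ))) (Ioi 0) := by
    refine Integrable.mono' (integrableOn_rpow_mul_exp_neg_mul_rpow (s := 0) (by norm_num) hα ht)
      (Measurable.aestronglyMeasurable (by fun_prop)) ?_
    exact Eventually.of_forall fun ρ => (hnorm ρ).le
  have := integral_re hint
  simp only [RCLike.re_eq_complex_re] at this
  rw [← this]
  congr 1; ext r
  rw [Complex.exp_re]
  simp [mul_comm]

lemma aux_deriv {α t : ℝ} (hα : 0 < α) (ht : 0 < t) (x : ℝ) :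
    HasDerivAt (fun x : ℝ => ∫ r in Ioi (0:ℝ), (Real.sin (x*r) / r) * rexp (-(t * r ^ α)))
      (∫ r in Ioi (0:ℝ), Real.cos (x * r) * rexp (-(t * r ^ α))) x := by
  have hb : IntegrableOn (fun r : ℝ => rexp (-(t * r ^ α))) (Ioi 0) := by
    have := integrableOn_rpow_mul_exp_neg_mul_rpow (s := 0) (by norm_num) hα ht
    simpa using this
  refine (hasDerivAt_integral_of_dominated_loc_of_deriv_le (𝕜 := ℝ) (s := univ)
    (F := fun (x r : ℝ) => (Real.sin (x*r) / r) * rexp (-(t * r ^ α)))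
    (F' := fun (x r : ℝ) => Real.cos (x*r) * rexp (-(t * r ^ α)))
    (bound := fun r => rexp (-(t * r ^ α))) univ_mem ?_ ?_ ?_ ?_ hb ?_).2
  · exact Eventually.of_forall fun y => Measurable.aestronglyMeasurable (by fun_prop)
  · refine Integrable.mono' (hb.const_mul |x|) (Measurable.aestronglyMeasurable (by fun_prop)) ?_
    filter_upwards [ae_restrict_mem measurableSet_Ioi] with r hr
    have hr' : 0 < r := hr
    rw [norm_mul, Real.norm_of_nonneg (Real.exp_pos _).le, norm_div, Real.norm_eq_abs,
      Real.norm_eq_abs, abs_of_pos hr']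
    gcongr
    rw [div_le_iff₀ hr']
    calc |Real.sin (x * r)| ≤ |x * r| := Real.abs_sin_le_abs
      _ = _ := by rw [abs_mul, abs_of_pos hr']
  · exact Measurable.aestronglyMeasurable (by fun_prop)
  · refine Eventually.of_forall fun r y _ => ?_
    rw [norm_mul, Real.norm_of_nonneg (Real.exp_pos _).le]
    exact mul_le_of_le_one_left (Real.exp_pos _).le (Real.abs_cos_le_one _)
  · filter_upwards [ae_restrict_mem measurableSet_Ioi] with r hr y _
    have hr' : r ≠ 0 := (show (0:ℝ) < r from hr).ne'
    have h := (((hasDerivAt_mul_const r (x := y)).sin).div_const r).mul_const (rexp (-(t * r ^ α)))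
    rwa [mul_div_assoc, div_self hr', mul_one] at h

/-- Asymptotics of the fractional heat kernel and of `(v^t_s)'`. -/
theorem statement11 (s t : ℝ) (hs : s ∈ Set.Ioo (0:ℝ) 1) (ht : 0 < t) :
    Tendsto (fun x : ℝ => x ^ (1 + 2*s) * fracHeatKernel s t x) atTop
      (nhds (t * (2*s/π) * Real.sin (π*s) * Real.Gamma (2*s))) ∧
    Tendsto (fun x : ℝ => |x| ^ (1 + 2*s) * deriv (layerV s t) x) (cocompact ℝ)
      (nhds (t * (4*s/π) * Real.sin (π*s) * Real.Gamma (2*s))) ∧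
    0 < t * (4*s/π) * Real.sin (π*s) * Real.Gamma (2*s) := by
  have hs0 : 0 < s := hs.1
  have hs1 : s < 1 := hs.2
  have hpi := Real.pi_pos
  have hα : 0 < 2 * s := by linarith
  have h1 : Tendsto (fun x : ℝ => x ^ (1 + 2*s) * fracHeatKernel s t x) atTop
      (nhds (t * (2*s/π) * Real.sin (π*s) * Real.Gamma (2*s))) := by
    have h := (aux_main hα (by linarith) ht).const_mul (1/π)
    have hv : 1/π * (t * Real.sin (π * (2*s) / 2) * Real.Gamma (1 + 2*s)) =
        t * (2*s/π) * Real.sin (π*s) * Real.Gamma (2*s) := by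
      rw [add_comm, Real.Gamma_add_one hα.ne', show π * (2*s) / 2 = π * s by ring]
      ring
    rw [hv] at h
    refine h.congr fun x => ?_
    rw [fracHeatKernel, aux_kernel hα ht]
    ring
  refine ⟨h1, ?_, ?_⟩
  · have h2 := (h1.comp (tendsto_norm_cocompact_atTop (E := ℝ))).const_mul 2
    rw [show 2 * (t * (2*s/π) * Real.sin (π*s) * Real.Gamma (2*s)) =
      t * (4*s/π) * Real.sin (π*s) * Real.Gamma (2*s) by ring] at h2
    refine h2.congr fun x => ?_
    have hd : deriv (layerV s t) x =
        (2/π) * ∫ r in Ioi (0:ℝ), Real.cos (x * r) * rexp (-(t * r ^ (2*s))) :=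
      ((aux_deriv hα ht x).const_mul (2/π)).deriv
    simp only [Function.comp, Real.norm_eq_abs]
    rw [hd, fracHeatKernel]
    have hcos : ∀ r : ℝ, Real.cos (|x| * r) = Real.cos (x * r) := by
      intro r
      rcases abs_choice x with h | h <;> rw [h]
      rw [neg_mul, Real.cos_neg]
    simp only [hcos]
    ring
  · have hsin : 0 < Real.sin (π * s) :=
      Real.sin_pos_of_pos_of_lt_pi (by positivity) (by nlinarith)
    have hG : 0 < Real.Gamma (2*s) := Real.Gamma_pos_of_pos hα
    positivity
end
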